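/- arXiv:1206.2557 — 2 statements merged into one kernel-verified Lean document; each statement's English description precedes it below -/
import Mathlib

section
/- Let (X_i)_{i∈ℤ} be a strictly stationary sequence of ℝ^d-valued random vectors whose marginal c.d.f.s F_1,…,F_d are continuous and whose strong mixing coefficients satisfy α_r = O(r^{-a}) for some a > 1. Then sup_{(s,t,u)∈Δ×[0,1]^d} |C_n^{alt}(s,t,u) − C̄_n(s,t,u)| converges to 0 in outer probability as n → ∞, where C_n^{alt}(s,t,u) = (1/√n) Σ_{i=⌊ns⌋+1}^{⌊nt⌋} [1{U_i ≤ H⁻¹_{⌊ns⌋+1:⌊nt⌋}(u)} − C(u)]. -/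
open MeasureTheory Set Filter

noncomputable section

variable {Ω : Type*}

/-- Rescaled maximal rank (pseudo-observation): the `j`-th component of
`Û_i^{k:l} = R_i^{k:l}/(l−k+1)`, computed within the subsample `X_k, …, X_l`. -/
def pseudoObs (d : ℕ) (X : ℤ → Ω → Fin d → ℝ) (k l i : ℕ) (ω : Ω) (j : Fin d) : ℝ :=
  (((Finset.Icc k l).filter fun t : ℕ => X t ω j ≤ X i ω j).card : ℝ) / ((l : ℝ) - (k : ℝ) + 1)

/-- Empirical copula of the subsample `X_k, …, X_l` (equal to `0` if `k > l`). -/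
def empCop (d : ℕ) (X : ℤ → Ω → Fin d → ℝ) (k l : ℕ) (u : Fin d → ℝ) (ω : Ω) : ℝ :=
  if k ≤ l then
    ((l : ℝ) - (k : ℝ) + 1)⁻¹ *
      ∑ i ∈ Finset.Icc k l, (if ∀ j, pseudoObs d X k l i ω j ≤ u j then (1 : ℝ) else 0)
  else 0

/-- Two-sided sequential empirical copula process
`C̄_n(s,t,u) = √n·λ_n(s,t)·(C_{⌊ns⌋+1:⌊nt⌋}(u) − C(u))`. -/
def seqEmpCopProc (d : ℕ) (X : ℤ → Ω → Fin d → ℝ) (C : (Fin d → ℝ) → ℝ)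
    (n : ℕ) (s t : ℝ) (u : Fin d → ℝ) (ω : Ω) : ℝ :=
  Real.sqrt n * (((⌊(n : ℝ) * t⌋₊ : ℝ) - (⌊(n : ℝ) * s⌋₊ : ℝ)) / n) *
    (empCop d X (⌊(n : ℝ) * s⌋₊ + 1) ⌊(n : ℝ) * t⌋₊ u ω - C u)

/-- Marginal empirical c.d.f. `H_{k:l,j}` of the unobservable sample
`U_{kj}, …, U_{lj}`, where `U_{ij} = F_j(X_{ij})`. -/
def empCdfU (d : ℕ) (X : ℤ → Ω → Fin d → ℝ) (F : Fin d → ℝ → ℝ)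
    (k l : ℕ) (j : Fin d) (v : ℝ) (ω : Ω) : ℝ :=
  (((Finset.Icc k l).filter fun i : ℕ => F j (X i ω j) ≤ v).card : ℝ)
    / ((l : ℝ) - (k : ℝ) + 1)

/-- Empirical quantile function `H_{k:l,j}^{-1}(u) = inf{v ∈ [0,1] : H_{k:l,j}(v) ≥ u}`. -/
def empQuantU (d : ℕ) (X : ℤ → Ω → Fin d → ℝ) (F : Fin d → ℝ → ℝ)
    (k l : ℕ) (j : Fin d) (u : ℝ) (ω : Ω) : ℝ :=
  sInf {v : ℝ | v ∈ Icc (0:ℝ) 1 ∧ u ≤ empCdfU d X F k l j v ω}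

/-- The process
`C_n^{alt}(s,t,u) = n^{-1/2} Σ_{i=⌊ns⌋+1}^{⌊nt⌋} (1{U_i ≤ H⁻¹_{⌊ns⌋+1:⌊nt⌋}(u)} − C(u))`. -/
def seqEmpCopProcAlt (d : ℕ) (X : ℤ → Ω → Fin d → ℝ) (F : Fin d → ℝ → ℝ)
    (C : (Fin d → ℝ) → ℝ) (n : ℕ) (s t : ℝ) (u : Fin d → ℝ) (ω : Ω) : ℝ :=
  (Real.sqrt n)⁻¹ *
    ∑ i ∈ Finset.Icc (⌊(n : ℝ) * s⌋₊ + 1) ⌊(n : ℝ) * t⌋₊,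
      ((if ∀ j, F j (X i ω j)
            ≤ empQuantU d X F (⌊(n : ℝ) * s⌋₊ + 1) ⌊(n : ℝ) * t⌋₊ j (u j) ω
        then (1 : ℝ) else 0) - C u)

theorem sum_diagonal_le_four_mul (T : Finset ℕ) (c : ℕ → ℕ → ℝ) (α : ℝ)
    (h : ∀ S ⊆ T, ∑ k ∈ S, ∑ l ∈ S, c k l ≤ α)
    (h0 : ∑ k ∈ T, ∑ l ∈ T, c k l = 0) :
    ∑ k ∈ T, c k k ≤ 4 * α := by
  have hcount : ∀ k ∈ T, ∀ l ∈ T,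
      4 * ∑ S ∈ T.powerset, (if k ∈ S ∧ l ∈ S then c k l else 0)
        = 2 ^ T.card * (c k l + if k = l then c k l else 0) := by
    intro k hk l hl
    have hsub : {k, l} ⊆ T := by
      intro x hx
      simp only [Finset.mem_insert, Finset.mem_singleton] at hx
      rcases hx with rfl | rfl <;> assumption
    have hIcc : T.powerset.filter (fun S => k ∈ S ∧ l ∈ S) = Finset.Icc {k, l} T := by
      ext S
      simp [Finset.insert_subset_iff, and_comm]
    rw [← Finset.sum_filter, Finset.sum_const, hIcc, Finset.card_Icc_finset hsub, nsmul_eq_mul]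
    have hle := Finset.card_le_card hsub
    by_cases hkl : k = l
    · subst hkl
      simp only [Finset.insert_eq_of_mem, Finset.mem_singleton, Finset.card_singleton] at hle ⊢
      obtain ⟨t, ht⟩ := Nat.exists_eq_add_of_le hle
      rw [ht]
      simp [pow_add]
      ring
    · rw [Finset.card_pair hkl] at hle ⊢
      obtain ⟨t, ht⟩ := Nat.exists_eq_add_of_le hle
      rw [ht]
      simp [pow_add, hkl]
      ring
  have hsum : 4 * ∑ S ∈ T.powerset, ∑ k ∈ S, ∑ l ∈ S, c k l
      = 2 ^ T.card * ∑ k ∈ T, c k k := by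
    have h1 : ∀ S ∈ T.powerset, ∑ k ∈ S, ∑ l ∈ S, c k l
        = ∑ k ∈ T, ∑ l ∈ T, (if k ∈ S ∧ l ∈ S then c k l else 0) := by
      intro S hS
      have hST := Finset.mem_powerset.1 hS
      simp only [ite_and, Finset.sum_ite_irrel, Finset.sum_const_zero]
      rw [← Finset.sum_filter, Finset.filter_mem_eq_inter, Finset.inter_eq_right.2 hST]
      refine Finset.sum_congr rfl fun k _ => ?_
      rw [← Finset.sum_filter, Finset.filter_mem_eq_inter, Finset.inter_eq_right.2 hST]
    rw [Finset.sum_congr rfl h1, Finset.sum_comm, Finset.mul_sum]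
    have h2 : ∀ k ∈ T, 4 * ∑ S ∈ T.powerset, ∑ l ∈ T, (if k ∈ S ∧ l ∈ S then c k l else 0)
        = 2 ^ T.card * (∑ l ∈ T, c k l + c k k) := by
      intro k hk
      rw [Finset.sum_comm, Finset.mul_sum, Finset.sum_congr rfl (hcount k hk), ← Finset.mul_sum,
        Finset.sum_add_distrib, Finset.sum_ite_eq, if_pos hk]
    rw [Finset.sum_congr rfl h2, ← Finset.mul_sum, Finset.sum_add_distrib, h0, zero_add]
  have hle : ∑ S ∈ T.powerset, ∑ k ∈ S, ∑ l ∈ S, c k l ≤ 2 ^ T.card * α := by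
    refine (Finset.sum_le_card_nsmul _ _ α fun S hS => h S (Finset.mem_powerset.1 hS)).trans_eq ?_
    simp
  have hpos : (0 : ℝ) < 2 ^ T.card := by positivity
  nlinarith

theorem measure_le_of_cdf_sub_le (μ : Measure ℝ) [IsProbabilityMeasure μ] {F : ℝ → ℝ}
    (hF : ∀ x, F x = μ.real (Iic x)) (hc : Continuous F) {S : Set ℝ} (hS : MeasurableSet S)
    {δ : ℝ} (hδ : ∀ x ∈ S, ∀ y ∈ S, F y - F x ≤ δ) : μ S ≤ ENNReal.ofReal δ := by
  have hcdf : ⇑(ProbabilityTheory.cdf μ) = F := by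
    ext x
    rw [hF, ProbabilityTheory.cdf_eq_real]
  rw [hS.measure_eq_iSup_isCompact]
  refine iSup₂_le fun K hKS => iSup_le fun hK => ?_
  rcases K.eq_empty_or_nonempty with rfl | hne
  · simp
  calc μ K ≤ μ (Icc (sInf K) (sSup K)) :=
        measure_mono (subset_Icc_csInf_csSup hK.bddBelow hK.bddAbove)
    _ = (ProbabilityTheory.cdf μ).measure (Icc (sInf K) (sSup K)) := by
        rw [ProbabilityTheory.measure_cdf]
    _ = ENNReal.ofReal (F (sSup K) - F (sInf K)) := by
        rw [StieltjesFunction.measure_Icc, hcdf, hc.continuousAt.continuousWithinAt.leftLim_eq]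
    _ ≤ ENNReal.ofReal δ :=
        ENNReal.ofReal_le_ofReal (hδ _ (hKS (hK.sInf_mem hne)) _ (hKS (hK.sSup_mem hne)))

/-- Two real random variables that tie with each other, one of which has a continuous
c.d.f., do so with probability at most four times their strong mixing coefficient. -/
theorem measure_eq_le_four_mul_mixing [MeasurableSpace Ω] (P : Measure Ω)
    [IsProbabilityMeasure P] {Y Z : Ω → ℝ} (hY : Measurable Y) (hZ : Measurable Z)
    {F : ℝ → ℝ} (hF : ∀ x, F x = P.real {ω | Y ω ≤ x}) (hc : Continuous F) {α : ℝ}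
    (hα : ∀ A B : Set ℝ, MeasurableSet A → MeasurableSet B →
      |P.real (Y ⁻¹' A ∩ Z ⁻¹' B) - P.real (Y ⁻¹' A) * P.real (Z ⁻¹' B)| ≤ α) :
    P.real {ω | Y ω = Z ω} ≤ 4 * α := by
  have hμ : IsProbabilityMeasure (P.map Y) := Measure.isProbabilityMeasure_map hY.aemeasurable
  have hFμ : ∀ x, F x = (P.map Y).real (Iic x) := fun x => by
    rw [hF, map_measureReal_apply hY measurableSet_Iic]; rfl
  have hF0 : ∀ x, 0 ≤ F x := fun x => by rw [hF]; positivity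
  have hF1 : ∀ x, F x ≤ 1 := fun x => by rw [hF]; exact measureReal_le_one
  suffices hN : ∀ N : ℕ, P.real {ω | Y ω = Z ω} ≤ 4 * α + 1 / ((N : ℝ) + 1) by
    have hlim := (tendsto_one_div_add_atTop_nhds_zero_nat (𝕜 := ℝ)).const_add (4 * α)
    rw [add_zero] at hlim
    exact ge_of_tendsto' hlim hN
  intro N
  have hN0 : (0 : ℝ) < (N : ℝ) + 1 := by positivity
  set κ : ℝ → ℕ := fun x => ⌊((N : ℝ) + 1) * F x⌋₊ with hκ
  have hκm : Measurable κ := Nat.measurable_floor.comp (hc.measurable.const_mul _)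
  have hsing : ∀ k, MeasurableSet (κ ⁻¹' {k}) := fun k => hκm (measurableSet_singleton k)
  set T := Finset.range (N + 2) with hT
  have hκT : ∀ x, κ x ∈ T := by
    intro x
    rw [hT, Finset.mem_range, hκ]
    refine (Nat.floor_lt (by have := hF0 x; positivity)).2 ?_
    push_cast
    nlinarith [hF1 x]
  have hcell : ∀ k, P.real (Y ⁻¹' (κ ⁻¹' {k})) ≤ 1 / ((N : ℝ) + 1) := by
    intro k
    rw [← map_measureReal_apply hY (hsing k), measureReal_def]
    refine ENNReal.toReal_le_of_le_ofReal (by positivity)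
      (measure_le_of_cdf_sub_le _ hFμ hc (hsing k) ?_)
    intro x hx y hy
    simp only [mem_preimage, mem_singleton_iff, hκ] at hx hy
    have h1 : (k : ℝ) ≤ (N + 1) * F x := by
      rw [← hx]; exact Nat.floor_le (by have := hF0 x; positivity)
    have h2 : (N + 1) * F y < k + 1 := by rw [← hy]; exact Nat.lt_floor_add_one _
    rw [le_div_iff₀ hN0]
    nlinarith
  have hprod : ∀ S : Finset ℕ, P.real (Y ⁻¹' (κ ⁻¹' S) ∩ Z ⁻¹' (κ ⁻¹' S))
      = ∑ k ∈ S, ∑ l ∈ S, P.real (Y ⁻¹' (κ ⁻¹' {k}) ∩ Z ⁻¹' (κ ⁻¹' {l})) := by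
    intro S
    have := sum_measureReal_preimage_singleton (μ := P) (S ×ˢ S)
      (f := fun ω => (κ (Y ω), κ (Z ω)))
      (fun y _ => ((hκm.comp hY).prodMk (hκm.comp hZ)) (measurableSet_singleton y))
    rw [Finset.sum_product] at this
    convert this.symm using 2
    · ext ω; simp
    · refine Finset.sum_congr rfl fun l _ => ?_
      congr 1
      ext ω; simp
  have hmarg : ∀ (W : Ω → ℝ), Measurable W → ∀ S : Finset ℕ,
      P.real (W ⁻¹' (κ ⁻¹' S)) = ∑ k ∈ S, P.real (W ⁻¹' (κ ⁻¹' {k})) := by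
    intro W hW S
    exact (sum_measureReal_preimage_singleton (μ := P) S (f := κ ∘ W)
      (fun y _ => (hκm.comp hW) (measurableSet_singleton y))).symm
  have huniv : κ ⁻¹' (T : Set ℕ) = univ := eq_univ_of_forall fun x => by simpa using hκT x
  set c : ℕ → ℕ → ℝ := fun k l => P.real (Y ⁻¹' (κ ⁻¹' {k}) ∩ Z ⁻¹' (κ ⁻¹' {l}))
    - P.real (Y ⁻¹' (κ ⁻¹' {k})) * P.real (Z ⁻¹' (κ ⁻¹' {l})) with hcdef
  have hcS : ∀ S : Finset ℕ, ∑ k ∈ S, ∑ l ∈ S, c k l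
      = P.real (Y ⁻¹' (κ ⁻¹' S) ∩ Z ⁻¹' (κ ⁻¹' S))
        - P.real (Y ⁻¹' (κ ⁻¹' S)) * P.real (Z ⁻¹' (κ ⁻¹' S)) := by
    intro S
    rw [hprod, hmarg Y hY, hmarg Z hZ, Finset.sum_mul_sum]
    simp only [hcdef, Finset.sum_sub_distrib]
  have hdiag : ∑ k ∈ T, c k k ≤ 4 * α := by
    refine sum_diagonal_le_four_mul T c α (fun S _ => ?_) ?_
    · rw [hcS]
      have hSm : MeasurableSet (κ ⁻¹' (S : Set ℕ)) := hκm S.measurableSet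
      exact (le_abs_self _).trans (hα _ _ hSm hSm)
    · rw [hcS, huniv]
      simp
  calc P.real {ω | Y ω = Z ω}
      ≤ P.real (⋃ k ∈ T, Y ⁻¹' (κ ⁻¹' {k}) ∩ Z ⁻¹' (κ ⁻¹' {k})) := by
        refine measureReal_mono (fun ω hω => ?_) (measure_ne_top _ _)
        simp only [mem_ofPred_eq] at hω
        simp only [mem_iUnion]
        exact ⟨κ (Y ω), hκT _, rfl, by simp [hω]⟩
    _ ≤ ∑ k ∈ T, P.real (Y ⁻¹' (κ ⁻¹' {k}) ∩ Z ⁻¹' (κ ⁻¹' {k})) :=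
        measureReal_biUnion_finset_le _ _
    _ = ∑ k ∈ T, c k k + ∑ k ∈ T, P.real (Y ⁻¹' (κ ⁻¹' {k})) * P.real (Z ⁻¹' (κ ⁻¹' {k})) := by
        rw [← Finset.sum_add_distrib]
        exact Finset.sum_congr rfl fun k _ => by simp [hcdef]
    _ ≤ 4 * α + ∑ k ∈ T, 1 / ((N : ℝ) + 1) * P.real (Z ⁻¹' (κ ⁻¹' {k})) := by
        gcongr with k _
        exact hcell k
    _ = 4 * α + 1 / ((N : ℝ) + 1) := by
        rw [← Finset.mul_sum, ← hmarg Z hZ, huniv]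
        simp

/-- Almost surely, no value strictly below `Y` has the same c.d.f. value as `Y`, so that
comparisons with `Y` may be made through the c.d.f. -/
theorem ae_forall_cdf_le_imp_le [MeasurableSpace Ω] (P : Measure Ω)
    [IsProbabilityMeasure P] {Y : Ω → ℝ} (hY : Measurable Y)
    {F : ℝ → ℝ} (hF : ∀ x, F x = P.real {ω | Y ω ≤ x}) (hc : Continuous F) :
    ∀ᵐ ω ∂P, ∀ x, F (Y ω) ≤ F x → Y ω ≤ x := by
  have hμ : IsProbabilityMeasure (P.map Y) := Measure.isProbabilityMeasure_map hY.aemeasurable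
  have hFμ : ∀ x, F x = (P.map Y).real (Iic x) := fun x => by
    rw [hF, map_measureReal_apply hY measurableSet_Iic]; rfl
  have hmono : Monotone F := fun x y hxy => by
    rw [hFμ, hFμ]; exact measureReal_mono (Iic_subset_Iic.2 hxy)
  have hlevel : ∀ q : ℚ, ∀ᵐ ω ∂P, F (Y ω) ≠ F q := by
    intro q
    have hm : MeasurableSet (F ⁻¹' {F q}) := hc.measurable (measurableSet_singleton _)
    have h0 : P.map Y (F ⁻¹' {F q}) ≤ ENNReal.ofReal 0 := by
      refine measure_le_of_cdf_sub_le _ hFμ hc hm fun x hx y hy => ?_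
      simp only [mem_preimage, mem_singleton_iff] at hx hy
      simp [hx, hy]
    rw [Measure.map_apply hY hm] at h0
    rw [ae_iff]
    simpa [preimage] using h0
  filter_upwards [ae_all_iff.2 hlevel] with ω hω x hx
  by_contra! hlt
  obtain ⟨q, hq1, hq2⟩ := exists_rat_btwn hlt
  exact hω q (le_antisymm (hx.trans (hmono hq1.le)) (hmono hq2.le))

theorem card_sq_le_card_pairs (n L : ℕ) (I : Finset ℕ) (hI : I ⊆ Finset.Icc 1 n) :
    I.card ^ 2 ≤ 2 * ((Finset.Icc 1 n ×ˢ Finset.Ico L n).filter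
      fun p : ℕ × ℕ => p.1 ∈ I ∧ p.1 + p.2 ∈ I).card + I.card * (2 * L) := by
  set E := (Finset.Icc 1 n ×ˢ Finset.Ico L n).filter
    fun p : ℕ × ℕ => p.1 ∈ I ∧ p.1 + p.2 ∈ I with hE
  have hcover : I ×ˢ I ⊆ (E.image fun p => (p.1, p.1 + p.2)) ∪
      ((E.image fun p => (p.1 + p.2, p.1)) ∪
        (I ×ˢ Finset.range (2 * L)).image fun p => (p.1, p.1 + p.2 - L)) := by
    rintro ⟨i, k⟩ hik
    rw [Finset.mem_product] at hik
    obtain ⟨hi, hk⟩ := hik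
    have hi' := Finset.mem_Icc.1 (hI hi)
    have hk' := Finset.mem_Icc.1 (hI hk)
    simp only at hi hk hi' hk'
    simp only [Finset.mem_union, Finset.mem_image, hE, Finset.mem_filter, Finset.mem_product,
      Finset.mem_Icc, Finset.mem_Ico, Finset.mem_range, Prod.exists, Prod.mk.injEq]
    rcases le_or_gt (i + L) k with h | h
    · refine Or.inl ⟨i, k - i, ⟨⟨hi', by omega, by omega⟩, hi, ?_⟩, rfl, by omega⟩
      rwa [show i + (k - i) = k by omega]
    rcases le_or_gt (k + L) i with h' | h'
    · refine Or.inr (Or.inl ⟨k, i - k, ⟨⟨hk', by omega, by omega⟩, hk, ?_⟩, by omega, rfl⟩)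
      rwa [show k + (i - k) = i by omega]
    · exact Or.inr (Or.inr ⟨i, k + L - i, ⟨hi, by omega⟩, rfl, by omega⟩)
  have h1 := Finset.card_le_card hcover
  have h2 := Finset.card_union_le (E.image fun p => (p.1, p.1 + p.2))
    ((E.image fun p => (p.1 + p.2, p.1)) ∪
        (I ×ˢ Finset.range (2 * L)).image fun p => (p.1, p.1 + p.2 - L))
  have h3 := Finset.card_union_le (E.image fun p => (p.1 + p.2, p.1))
        ((I ×ˢ Finset.range (2 * L)).image fun p => (p.1, p.1 + p.2 - L))
  have h4 : (E.image fun p => (p.1, p.1 + p.2)).card ≤ E.card := Finset.card_image_le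
  have h5 : (E.image fun p => (p.1 + p.2, p.1)).card ≤ E.card := Finset.card_image_le
  have h6 : ((I ×ˢ Finset.range (2 * L)).image fun p => (p.1, p.1 + p.2 - L)).card
      ≤ (I ×ˢ Finset.range (2 * L)).card := Finset.card_image_le
  rw [Finset.card_product] at h1 h6
  rw [Finset.card_range] at h6
  rw [pow_two]
  omega

open scoped Classical in
theorem measure_le_card_filter_le [MeasurableSpace Ω] {ι : Type*} (P : Measure Ω)
    (S : Finset ι) (E : ι → Set Ω) (hE : ∀ i, MeasurableSet (E i)) {c : ℝ} (hc : 0 < c) :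
    P {ω | c ≤ ((S.filter fun i => ω ∈ E i).card : ℝ)}
      ≤ (∑ i ∈ S, P (E i)) / ENNReal.ofReal c := by
  have hmeas : Measurable fun ω => ∑ i ∈ S, (E i).indicator (1 : Ω → ENNReal) ω :=
    Finset.measurable_fun_sum _ fun i _ => measurable_one.indicator (hE i)
  have hmarkov := meas_ge_le_lintegral_div (μ := P) hmeas.aemeasurable
    (ε := ENNReal.ofReal c) (by simpa using hc) ENNReal.ofReal_ne_top
  rw [lintegral_finsetSum _ fun i _ => measurable_one.indicator (hE i)] at hmarkov
  simp only [lintegral_indicator_one (hE _)] at hmarkov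
  refine (measure_mono fun ω hω => ?_).trans hmarkov
  simp only [mem_ofPred_eq] at hω ⊢
  have : ∑ i ∈ S, (E i).indicator (1 : Ω → ENNReal) ω
      = ((S.filter fun i => ω ∈ E i).card : ENNReal) := by
    simp [indicator_apply]
  rw [this, ← ENNReal.ofReal_natCast]
  exact ENNReal.ofReal_le_ofReal hω

/-- If pairs of observations at lag `r` tie with summable probability, then the largest group
of tied observations among the first `n` is of smaller order than `√n`, in probability. -/
theorem tendsto_measure_exists_card_tie [MeasurableSpace Ω] (P : Measure Ω)
    [IsProbabilityMeasure P] (Z : ℕ → Ω → ℝ) (hZ : ∀ i, Measurable (Z i)) (f : ℕ → ℝ)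
    (hf0 : ∀ r, 0 ≤ f r) (hf : Summable f)
    (htie : ∀ i r, 1 ≤ r → P.real {ω | Z i ω = Z (i + r) ω} ≤ f r) {ε : ℝ} (hε : 0 < ε) :
    Tendsto (fun n : ℕ => P {ω | ∃ v, ε * √n
      < (((Finset.Icc 1 n).filter fun i => Z i ω = v).card : ℝ)}) atTop (nhds 0) := by
  rw [ENNReal.tendsto_nhds_zero]
  intro δ hδ
  have htail : Tendsto (fun L => ENNReal.ofReal (4 / ε ^ 2 * ∑' r, f (r + L))) atTop (nhds 0) := by
    have := ENNReal.tendsto_ofReal ((_root_.tendsto_sum_nat_add f).const_mul (4 / ε ^ 2))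
    simpa using this
  obtain ⟨L, hLδ, hL1⟩ :=
    (((ENNReal.tendsto_nhds_zero.1 htail) δ hδ).and (eventually_ge_atTop 1)).exists
  have hlarge : ∀ᶠ n : ℕ in atTop, 4 * (L : ℝ) < ε * √n :=
    ((Real.tendsto_sqrt_atTop.comp
      tendsto_natCast_atTop_atTop).const_mul_atTop hε).eventually_gt_atTop _
  filter_upwards [hlarge, eventually_ge_atTop 1] with n hn hn1
  refine le_trans ?_ hLδ
  have hn0 : (0 : ℝ) < n := by exact_mod_cast hn1
  have hc : 0 < ε ^ 2 * n / 4 := by positivity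
  have hEm : ∀ p : ℕ × ℕ, MeasurableSet {ω | Z p.1 ω = Z (p.1 + p.2) ω} := fun p =>
    measurableSet_eq_fun (hZ _) (hZ _)
  have hmarkov := measure_le_card_filter_le P (Finset.Icc 1 n ×ˢ Finset.Ico L n) _ hEm hc
  refine (measure_mono ?_).trans (hmarkov.trans ?_)
  · rintro ω ⟨v, hv⟩
    set I := (Finset.Icc 1 n).filter fun i => Z i ω = v with hI
    have hcomb := card_sq_le_card_pairs n L I (Finset.filter_subset _ _)
    have hsub : ((Finset.Icc 1 n ×ˢ Finset.Ico L n).filter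
        fun p : ℕ × ℕ => p.1 ∈ I ∧ p.1 + p.2 ∈ I).card ≤
        ((Finset.Icc 1 n ×ˢ Finset.Ico L n).filter
          fun p : ℕ × ℕ => Z p.1 ω = Z (p.1 + p.2) ω).card := by
      refine Finset.card_le_card (Finset.monotone_filter_right _ fun p _ hp => ?_)
      simp only [hI, Finset.mem_filter] at hp
      exact hp.1.2.trans hp.2.2.symm
    simp only [mem_ofPred_eq]
    have hcomb' : (I.card : ℝ) ^ 2 ≤ 2 * (((Finset.Icc 1 n ×ˢ Finset.Ico L n).filter
          fun p : ℕ × ℕ => Z p.1 ω = Z (p.1 + p.2) ω).card : ℝ) + I.card * (2 * L) := by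
      exact_mod_cast hcomb.trans (by omega)
    have hsq : (ε * √n) ^ 2 = ε ^ 2 * n := by rw [mul_pow, Real.sq_sqrt hn0.le]
    have hpos : 0 < ε * √n := by positivity
    have h1 : (I.card : ℝ) * (4 * L) ≤ I.card * I.card :=
      mul_le_mul_of_nonneg_left (hn.trans hv).le (by positivity)
    have h2 : (ε * √n) ^ 2 ≤ (I.card : ℝ) ^ 2 := pow_le_pow_left₀ hpos.le hv.le 2
    convert (by nlinarith : ε ^ 2 * n / 4 ≤ (((Finset.Icc 1 n ×ˢ Finset.Ico L n).filter
          fun p : ℕ × ℕ => Z p.1 ω = Z (p.1 + p.2) ω).card : ℝ))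
  · have hsum : ∑ p ∈ Finset.Icc 1 n ×ˢ Finset.Ico L n, P {ω | Z p.1 ω = Z (p.1 + p.2) ω}
        ≤ ENNReal.ofReal (n * ∑' r, f (r + L)) := by
      calc _ ≤ ∑ p ∈ Finset.Icc 1 n ×ˢ Finset.Ico L n, ENNReal.ofReal (f p.2) := by
            refine Finset.sum_le_sum fun p hp => ?_
            rw [Finset.mem_product, Finset.mem_Ico] at hp
            rw [← ofReal_measureReal]
            exact ENNReal.ofReal_le_ofReal (htie _ _ (hL1.trans hp.2.1))
        _ = ENNReal.ofReal (n * ∑ r ∈ Finset.Ico L n, f r) := by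
            rw [← ENNReal.ofReal_sum_of_nonneg fun p _ => hf0 _, Finset.sum_product]
            simp
        _ ≤ ENNReal.ofReal (n * ∑' r, f (r + L)) := by
            refine ENNReal.ofReal_le_ofReal (mul_le_mul_of_nonneg_left ?_ hn0.le)
            rw [Finset.sum_Ico_eq_sum_range]
            simp only [add_comm L]
            exact ((summable_nat_add_iff L).2 hf).sum_le_tsum _ fun r _ => hf0 _
    refine (ENNReal.div_le_div_right hsum _).trans_eq ?_
    rw [← ENNReal.ofReal_div_of_pos hc]
    congr 1
    field_simp

section Pointwise

variable {d : ℕ} {X : ℤ → Ω → Fin d → ℝ} {F : Fin d → ℝ → ℝ} {ω : Ω} {k l i : ℕ} {j : Fin d}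
  {u : ℝ}

theorem pseudoObs_eq_empCdfU (hmono : Monotone (F j))
    (hlt : ∀ i : ℕ, ∀ x, F j (X i ω j) ≤ F j x → X i ω j ≤ x) :
    pseudoObs d X k l i ω j = empCdfU d X F k l j (F j (X i ω j)) ω := by
  unfold pseudoObs empCdfU
  congr 3
  exact Finset.filter_congr fun t _ => ⟨fun h => hmono h, fun h => hlt t _ h⟩

theorem empQuantU_le (hF0 : ∀ x, 0 ≤ F j x) (hF1 : ∀ x, F j x ≤ 1) {x : ℝ}
    (h : u ≤ empCdfU d X F k l j (F j x) ω) : empQuantU d X F k l j u ω ≤ F j x :=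
  csInf_le ⟨0, fun _ hv => hv.1.1⟩ ⟨⟨hF0 _, hF1 _⟩, h⟩

theorem le_empQuantU_of_empCdfU_le (hF1 : ∀ x, F j x ≤ 1) (hi : i ∈ Finset.Icc k l)
    (hu : u ≤ 1) (h : empCdfU d X F k l j (F j (X i ω j)) ω ≤ u) :
    F j (X i ω j) ≤ empQuantU d X F k l j u ω := by
  have hkl := (Finset.mem_Icc.1 hi).1.trans (Finset.mem_Icc.1 hi).2
  have hm : (0 : ℝ) < (l : ℝ) - k + 1 := by
    have : (k : ℝ) ≤ l := by exact_mod_cast hkl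
    linarith
  have hone : empCdfU d X F k l j 1 ω = 1 := by
    unfold empCdfU
    rw [Finset.filter_true_of_mem fun t _ => hF1 _, Nat.card_Icc,
      Nat.cast_sub (hkl.trans (Nat.le_succ l))]
    push_cast
    rw [div_eq_one_iff_eq hm.ne']
    ring
  refine le_csInf ⟨1, ⟨zero_le_one, le_rfl⟩, by rwa [hone]⟩ fun v hv => ?_
  by_contra! hvi
  refine absurd (hv.2.trans_lt ?_) (not_lt.2 h)
  unfold empCdfU
  refine div_lt_div_of_pos_right ?_ hm
  norm_cast
  refine Finset.card_lt_card (Finset.ssubset_iff_of_subset ?_ |>.2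
    ⟨i, Finset.mem_filter.2 ⟨hi, le_rfl⟩, fun hmem => ?_⟩)
  · exact Finset.monotone_filter_right _ fun t _ ht => ht.trans hvi.le
  · exact absurd (Finset.mem_filter.1 hmem).2 (not_le.2 hvi)

theorem abs_seqEmpCopProcAlt_sub_le {C : (Fin d → ℝ) → ℝ} (hmono : ∀ j, Monotone (F j))
    (hF0 : ∀ j x, 0 ≤ F j x) (hF1 : ∀ j x, F j x ≤ 1)
    (hlt : ∀ j, ∀ i : ℕ, ∀ x, F j (X i ω j) ≤ F j x → X i ω j ≤ x) {n : ℕ} (hn : 1 ≤ n) {B : ℝ}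
    (hB : ∀ j v, (((Finset.Icc 1 n).filter fun i : ℕ => X i ω j = v).card : ℝ) ≤ B)
    {s t : ℝ} (hst : s ≤ t) (ht : t ≤ 1) {u : Fin d → ℝ}
    (hu : ∀ j, u j ≤ 1) :
    |seqEmpCopProcAlt d X F C n s t u ω - seqEmpCopProc d X C n s t u ω| ≤ (√n)⁻¹ * (d * B) := by
  have hn0 : (0 : ℝ) < n := by exact_mod_cast hn
  have hB0 : 0 ≤ d * B := by
    rcases Nat.eq_zero_or_pos d with rfl | hd
    · simp
    · have := hB ⟨0, hd⟩ 0
      have : 0 ≤ B := le_trans (by positivity) this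
      positivity
  unfold seqEmpCopProcAlt seqEmpCopProc empCop
  have hfl : ⌊(n : ℝ) * s⌋₊ ≤ ⌊(n : ℝ) * t⌋₊ := Nat.floor_mono (by gcongr)
  have hln : ⌊(n : ℝ) * t⌋₊ ≤ n := by
    rw [← Nat.floor_natCast (R := ℝ) n]
    exact Nat.floor_mono (by simpa using mul_le_mul_of_nonneg_left ht hn0.le)
  generalize ⌊(n : ℝ) * s⌋₊ = k at *
  generalize ⌊(n : ℝ) * t⌋₊ = l at *
  rcases hfl.eq_or_lt with rfl | hkl
  · simp
    positivity
  rw [if_pos (show k + 1 ≤ l by omega)]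
  have hm : (0 : ℝ) < (l : ℝ) - k := by
    have : (k : ℝ) < l := by exact_mod_cast hkl
    linarith
  have hcard : ((Finset.Icc (k + 1) l).card : ℝ) = l - k := by
    rw [Nat.card_Icc, Nat.add_sub_add_right, Nat.cast_sub hkl.le]
  set A : ℕ → ℝ := fun i =>
    if ∀ j, F j (X i ω j) ≤ empQuantU d X F (k + 1) l j (u j) ω then (1 : ℝ) else 0 with hA
  set D : ℕ → ℝ := fun i =>
    if ∀ j, pseudoObs d X (k + 1) l i ω j ≤ u j then (1 : ℝ) else 0 with hD
  have hsqrt : √n * √n = (n : ℝ) := Real.mul_self_sqrt hn0.le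
  have hsq0 : 0 < √(n : ℝ) := Real.sqrt_pos.2 hn0
  have hrew : (√n)⁻¹ * ∑ i ∈ Finset.Icc (k + 1) l, (A i - C u) -
      √n * ((l - k) / n) * (((l : ℝ) - ((k + 1 : ℕ) : ℝ) + 1)⁻¹ *
        ∑ i ∈ Finset.Icc (k + 1) l, D i - C u)
      = (√n)⁻¹ * ∑ i ∈ Finset.Icc (k + 1) l, (A i - D i) := by
    have h1 : √n * (((l : ℝ) - k) / n) = (√n)⁻¹ * (l - k) := by
      field_simp
      rw [pow_two, hsqrt]
    have h2 : (l : ℝ) - ((k + 1 : ℕ) : ℝ) + 1 = l - k := by push_cast; ring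
    rw [h1, h2, Finset.sum_sub_distrib, Finset.sum_sub_distrib, Finset.sum_const, nsmul_eq_mul,
      hcard]
    field_simp
    ring
  rw [hrew, abs_mul, abs_of_pos (inv_pos.2 hsq0)]
  refine mul_le_mul_of_nonneg_left ?_ (inv_pos.2 hsq0).le
  have hterm : ∀ i ∈ Finset.Icc (k + 1) l, |A i - D i| ≤
      ∑ j, if F j (X i ω j) = empQuantU d X F (k + 1) l j (u j) ω then (1 : ℝ) else 0 := by
    intro i hi
    have hDA : (∀ j, pseudoObs d X (k + 1) l i ω j ≤ u j) →
        ∀ j, F j (X i ω j) ≤ empQuantU d X F (k + 1) l j (u j) ω := fun h j =>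
      le_empQuantU_of_empCdfU_le (hF1 j) hi (hu j)
        ((pseudoObs_eq_empCdfU (hmono j) (hlt j)).symm.le.trans (h j))
    have hnn : ∀ j, 0 ≤ if F j (X i ω j) = empQuantU d X F (k + 1) l j (u j) ω
        then (1 : ℝ) else 0 := fun j => by positivity
    by_cases hDi : ∀ j, pseudoObs d X (k + 1) l i ω j ≤ u j
    · simp only [hA, hD, if_pos hDi, if_pos (hDA hDi), sub_self, abs_zero]
      exact Finset.sum_nonneg fun j _ => hnn j
    by_cases hAi : ∀ j, F j (X i ω j) ≤ empQuantU d X F (k + 1) l j (u j) ω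
    · simp only [hA, hD, if_neg hDi, if_pos hAi, sub_zero, abs_one]
      push Not at hDi
      obtain ⟨j, hj⟩ := hDi
      rw [pseudoObs_eq_empCdfU (hmono j) (hlt j)] at hj
      have heq := le_antisymm (hAi j) (empQuantU_le (hF0 j) (hF1 j) hj.le)
      refine le_trans ?_ (Finset.single_le_sum (fun j _ => hnn j) (Finset.mem_univ j))
      rw [if_pos heq]
    · simp only [hA, hD, if_neg hDi, if_neg hAi, sub_self, abs_zero]
      exact Finset.sum_nonneg fun j _ => hnn j
  calc |∑ i ∈ Finset.Icc (k + 1) l, (A i - D i)|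
      ≤ ∑ i ∈ Finset.Icc (k + 1) l, |A i - D i| := Finset.abs_sum_le_sum_abs _ _
    _ ≤ ∑ i ∈ Finset.Icc (k + 1) l, ∑ j,
        if F j (X i ω j) = empQuantU d X F (k + 1) l j (u j) ω then (1 : ℝ) else 0 :=
      Finset.sum_le_sum hterm
    _ = ∑ j, (((Finset.Icc (k + 1) l).filter fun i : ℕ =>
        F j (X i ω j) = empQuantU d X F (k + 1) l j (u j) ω).card : ℝ) := by
      rw [Finset.sum_comm]
      exact Finset.sum_congr rfl fun j _ => Finset.sum_boole _ _
    _ ≤ ∑ _j : Fin d, B := by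
      refine Finset.sum_le_sum fun j _ => ?_
      set J := (Finset.Icc (k + 1) l).filter fun i : ℕ =>
        F j (X i ω j) = empQuantU d X F (k + 1) l j (u j) ω with hJ
      rcases J.eq_empty_or_nonempty with he | ⟨i₀, hi₀⟩
      · rw [he]
        exact le_trans (by simp) (hB j 0)
      · refine le_trans ?_ (hB j (X i₀ ω j))
        norm_cast
        refine Finset.card_le_card fun i hi => ?_
        rw [hJ, Finset.mem_filter] at hi hi₀
        have hmem := Finset.mem_Icc.1 hi.1
        have heq := hi.2.trans hi₀.2.symm
        exact Finset.mem_filter.2 ⟨Finset.mem_Icc.2 ⟨by omega, by omega⟩,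
          le_antisymm (hlt j i _ heq.le) (hlt j i₀ _ heq.symm.le)⟩
    _ = d * B := by simp

end Pointwise

/-- for a strictly stationary, strongly mixing sequence with
`α_r = O(r^{-a})`, `a > 1`, and continuous margins,
`sup_{(s,t,u)∈Δ×[0,1]^d} |C_n^{alt}(s,t,u) − C̄_n(s,t,u)|` converges to `0` in outer
probability. -/
theorem seqEmpCopProc_alt_approx {Ω : Type*} [MeasurableSpace Ω]
    (P : Measure Ω) [IsProbabilityMeasure P]
    (d : ℕ) (hd : 1 ≤ d)
    (X : ℤ → Ω → Fin d → ℝ) (hX : ∀ i, Measurable (X i))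
    -- strict stationarity
    (hstat : ∀ k : ℤ,
      Measure.map (fun ω => fun i : ℤ => X (i + k) ω) P
        = Measure.map (fun ω => fun i : ℤ => X i ω) P)
    -- marginal c.d.f.s, assumed continuous
    (F : Fin d → ℝ → ℝ)
    (hF : ∀ j x, F j x = (P {ω | X 0 ω j ≤ x}).toReal)
    (hFcont : ∀ j, Continuous (F j))
    -- strong mixing coefficients α_r = O(r^{-a}) for some a > 1
    (a : ℝ) (ha : 1 < a)
    (hmix : ∃ K : ℝ, ∀ r : ℕ, 1 ≤ r → ∀ p : ℤ, ∀ A B : Set Ω,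
      MeasurableSet[⨆ i : {i : ℤ // i ≤ p},
        MeasurableSpace.comap (X i.1) (inferInstance : MeasurableSpace (Fin d → ℝ))] A →
      MeasurableSet[⨆ i : {i : ℤ // p + r ≤ i},
        MeasurableSpace.comap (X i.1) (inferInstance : MeasurableSpace (Fin d → ℝ))] B →
      |(P (A ∩ B)).toReal - (P A).toReal * (P B).toReal| ≤ K * (r : ℝ) ^ (-a))
    -- the copula of X_0
    (C : (Fin d → ℝ) → ℝ)
    (hC : ∀ u : Fin d → ℝ, C u = (P {ω | ∀ j, F j (X 0 ω j) ≤ u j}).toReal) :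
    -- conclusion: convergence to 0 in outer probability of the uniform distance
    ∀ ε : ℝ, 0 < ε →
      Tendsto (fun n : ℕ =>
          P {ω | ε < ⨆ q : {q : ℝ × ℝ × (Fin d → ℝ) //
                0 ≤ q.1 ∧ q.1 ≤ q.2.1 ∧ q.2.1 ≤ 1 ∧ ∀ j, q.2.2 j ∈ Icc (0:ℝ) 1},
              |seqEmpCopProcAlt d X F C n q.1.1 q.1.2.1 q.1.2.2 ω
                - seqEmpCopProc d X C n q.1.1 q.1.2.1 q.1.2.2 ω|})
        atTop (nhds 0) := by
  intro ε hε
  obtain ⟨K, hK⟩ := hmix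
  have hXj : ∀ (i : ℤ) (j : Fin d), Measurable fun ω => X i ω j := fun i j =>
    (measurable_pi_apply j).comp (hX i)
  have hFi : ∀ (j : Fin d) (i : ℤ) (x : ℝ), F j x = P.real {ω | X i ω j ≤ x} := by
    intro j i x
    have hS : MeasurableSet {z : ℤ → Fin d → ℝ | z 0 j ≤ x} :=
      measurableSet_le ((measurable_pi_apply j).comp (measurable_pi_apply 0)) measurable_const
    have h := congrArg (fun ν => ν {z : ℤ → Fin d → ℝ | z 0 j ≤ x}) (hstat i)
    rw [Measure.map_apply (measurable_pi_lambda _ fun k => hX (k + i)) hS,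
      Measure.map_apply (measurable_pi_lambda _ fun k => hX k) hS] at h
    simp only [preimage_ofPred_eq, zero_add] at h
    rw [hF, measureReal_def, h]
  have hF0 : ∀ j x, 0 ≤ F j x := fun j x => by rw [hF]; exact ENNReal.toReal_nonneg
  have hF1 : ∀ j x, F j x ≤ 1 := fun j x => by rw [hFi j 0]; exact measureReal_le_one
  have hmono : ∀ j, Monotone (F j) := fun j x y hxy => by
    rw [hFi j 0, hFi j 0]
    exact measureReal_mono fun ω (hω : _ ≤ x) => hω.trans hxy
  have hK0 : 0 ≤ K := by
    have h := hK 1 le_rfl 0 ∅ ∅ (MeasurableSpace.measurableSet_empty _)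
      (MeasurableSpace.measurableSet_empty _)
    simpa using (abs_nonneg _).trans h
  have htie : ∀ (j : Fin d) (i r : ℕ), 1 ≤ r →
      P.real {ω | X i ω j = X (i + r : ℕ) ω j} ≤ 4 * (K * (r : ℝ) ^ (-a)) := by
    intro j i r hr
    refine measure_eq_le_four_mul_mixing P (hXj _ j) (hXj _ j) (hFi j i) (hFcont j) ?_
    intro A B hA hB
    refine hK r hr i _ _ ?_ ?_
    · exact le_iSup (fun i' : {i' : ℤ // i' ≤ i} => MeasurableSpace.comap (X i'.1)
        (inferInstance : MeasurableSpace (Fin d → ℝ))) ⟨i, le_rfl⟩ _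
        ⟨_, measurable_pi_apply j hA, rfl⟩
    · exact le_iSup (fun i' : {i' : ℤ // (i : ℤ) + r ≤ i'} => MeasurableSpace.comap (X i'.1)
        (inferInstance : MeasurableSpace (Fin d → ℝ))) ⟨(i + r : ℕ), by push_cast; rfl⟩ _
        ⟨_, measurable_pi_apply j hB, rfl⟩
  have hd0 : (0 : ℝ) < d := by exact_mod_cast hd
  have hlim : ∀ j, Tendsto (fun n : ℕ => P {ω | ∃ v, ε / d * √n
      < (((Finset.Icc 1 n).filter fun i : ℕ => X i ω j = v).card : ℝ)}) atTop (nhds 0) := by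
    intro j
    refine tendsto_measure_exists_card_tie P (fun i : ℕ => fun ω => X i ω j)
      (fun i => hXj i j) (fun r => 4 * (K * (r : ℝ) ^ (-a))) (fun r => by positivity) ?_
      (htie j) (by positivity)
    exact ((Real.summable_nat_rpow.2 (by linarith)).mul_left K).mul_left 4
  have hsum := tendsto_finsetSum Finset.univ fun j (_ : j ∈ Finset.univ) => hlim j
  rw [Finset.sum_const_zero] at hsum
  have hgood : ∀ᵐ ω ∂P, ∀ j, ∀ i : ℕ, ∀ x, F j (X i ω j) ≤ F j x → X i ω j ≤ x :=
    ae_all_iff.2 fun j => ae_all_iff.2 fun i =>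
      ae_forall_cdf_le_imp_le P (hXj i j) (hFi j i) (hFcont j)
  refine tendsto_of_tendsto_of_tendsto_of_le_of_le' tendsto_const_nhds hsum
    (Eventually.of_forall fun _ => zero_le) ?_
  filter_upwards [eventually_ge_atTop 1] with n hn
  refine le_trans (measure_mono_ae ?_) (measure_iUnion_fintype_le P _)
  filter_upwards [hgood] with ω hω hsup
  by_contra hnot
  have hB : ∀ j v, (((Finset.Icc 1 n).filter fun i : ℕ => X i ω j = v).card : ℝ)
      ≤ ε / d * √n := by
    intro j v
    by_contra! hlt
    exact hnot (mem_iUnion.2 ⟨j, v, hlt⟩)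
  refine absurd hsup (not_lt.2 (Real.iSup_le (fun q => ?_) hε.le))
  refine (abs_seqEmpCopProcAlt_sub_le hmono hF0 hF1 hω hn hB q.2.2.1 q.2.2.2.1
    fun j => (q.2.2.2.2 j).2).trans_eq ?_
  have : 0 < √(n : ℝ) := Real.sqrt_pos.2 (by exact_mod_cast hn)
  field_simp
end
end

section
/- Let (X_i)_{i∈ℤ} be a strictly stationary sequence of ℝ^d-valued random vectors whose marginal c.d.f.s are continuous and whose strong mixing coefficients satisfy α_r = O(r^{-a}) for some a > 1, and suppose the copula C of X_0 satisfies Condition 2. Fix j ∈ {1,…,d}. Then for every δ ∈ (0,1/2) and every ε ∈ (0,1), the supremum over u ∈ [0,1]^d with δ ≤ u_j ≤ 1−δ and over (s,t) ∈ [0,1]² with s ≤ t and t − s ≥ ε of |Ċ_{j,⌊ns⌋+1:⌊nt⌋}(u) − Ċ_j(u)| converges to 0 in outer probability as n → ∞. -/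
open MeasureTheory Set Filter

noncomputable section

variable {Ω : Type*}

/-- The bandwidth `h(k,l) = min((l−k+1)^{-1/2}, 1/2)`. -/
def bandwidth (k l : ℕ) : ℝ :=
  min (Real.sqrt ((l : ℝ) - (k : ℝ) + 1))⁻¹ (1 / 2)

/-- Boundary-corrected finite-difference estimator
`Ċ_{j,k:l}(u) = (C_{k:l}(u + h e_j) − C_{k:l}(u − h e_j)) / (min(u_j+h,1) − max(u_j−h,0))`
of the `j`-th partial derivative, based on the subsample `X_k, …, X_l`. -/
def pdEst (d : ℕ) (X : ℤ → Ω → Fin d → ℝ) (j : Fin d) (k l : ℕ)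
    (u : Fin d → ℝ) (ω : Ω) : ℝ :=
  (empCop d X k l (Function.update u j (u j + bandwidth k l)) ω
      - empCop d X k l (Function.update u j (u j - bandwidth k l)) ω)
    / (min (u j + bandwidth k l) 1 - max (u j - bandwidth k l) 0)

/-! ### Covariance inequalities under strong mixing -/

lemma integrable_of_abs_le [MeasurableSpace Ω] {P : Measure Ω} [IsFiniteMeasure P]
    {f : Ω → ℝ} (hf : Measurable f) {a : ℝ} (hfa : ∀ ω, |f ω| ≤ a) : Integrable f P :=
  Integrable.of_bound hf.aestronglyMeasurable a (Eventually.of_forall hfa)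

/-- The covariance of `f` and `g` is dominated by that of a sign variable and `g`. -/
lemma exists_sign_cov_le {m mΩ : MeasurableSpace Ω} {P : Measure Ω} [IsProbabilityMeasure P]
    (hm : m ≤ mΩ) {f g : Ω → ℝ} (hf : Measurable[m] f) (hg : Measurable g) {a b : ℝ}
    (hfa : ∀ ω, |f ω| ≤ a) (hgb : ∀ ω, |g ω| ≤ b) :
    ∃ A, MeasurableSet[m] A ∧
      |∫ ω, f ω * g ω ∂P - (∫ ω, f ω ∂P) * ∫ ω, g ω ∂P| ≤
        a * (∫ ω, (2 * A.indicator 1 ω - 1) * g ω ∂P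
          - (∫ ω, (2 * A.indicator 1 ω - 1) ∂P) * ∫ ω, g ω ∂P) := by
  have hgi : Integrable g P := integrable_of_abs_le hg hgb
  set c := ∫ ω, g ω ∂P with hc
  set e : Ω → ℝ := P[g | m] with he
  have hem : Measurable[m] e := stronglyMeasurable_condExp.measurable
  have hei : Integrable e P := integrable_condExp
  have key : ∀ f' : Ω → ℝ, Measurable[m] f' → ∀ a', (∀ ω, |f' ω| ≤ a') →
      ∫ ω, f' ω * g ω ∂P - (∫ ω, f' ω ∂P) * c = ∫ ω, f' ω * (e ω - c) ∂P := by
    intro f' hf' a' ha'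
    have hf'i : Integrable f' P := integrable_of_abs_le (hf'.mono hm le_rfl) ha'
    have hfg : Integrable (f' * g) P := hgi.bdd_mul (hf'.mono hm le_rfl).aestronglyMeasurable
      (Eventually.of_forall ha')
    have hfe : Integrable (fun ω => f' ω * e ω) P :=
      hei.bdd_mul (hf'.mono hm le_rfl).aestronglyMeasurable (Eventually.of_forall ha')
    have h1 : P[f' * g | m] =ᵐ[P] f' * e :=
      condExp_mul_of_stronglyMeasurable_left hf'.stronglyMeasurable hfg hgi
    have h2 : ∫ ω, f' ω * g ω ∂P = ∫ ω, f' ω * e ω ∂P := by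
      rw [← integral_condExp (f := fun ω => f' ω * g ω) hm]
      exact integral_congr_ae h1
    rw [h2, ← integral_mul_const, ← integral_sub hfe (hf'i.mul_const c)]
    simp only [mul_sub]
  have hA : MeasurableSet[m] {ω | 0 ≤ e ω - c} :=
    measurableSet_le measurable_const (hem.sub_const c)
  refine ⟨{ω | 0 ≤ e ω - c}, hA, ?_⟩
  have hbd : ∀ ω, |2 * indicator {ω | 0 ≤ e ω - c} (1 : Ω → ℝ) ω - 1| ≤ 1 := by
    intro ω
    by_cases h : ω ∈ {ω | 0 ≤ e ω - c} <;> simp only [h, indicator_of_mem, indicator_of_notMem,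
      not_false_eq_true, Pi.one_apply] <;> norm_num
  rw [key f hf a hfa, key (fun ω => 2 * indicator {ω | 0 ≤ e ω - c} (1 : Ω → ℝ) ω - 1)
    (((measurable_const.indicator hA).const_mul 2).sub_const 1) 1 hbd,
    ← integral_const_mul]
  have hi : Integrable (fun ω => e ω - c) P := hei.sub (integrable_const c)
  refine (abs_integral_le_integral_abs).trans (integral_mono ?_ ?_ ?_)
  · exact (hi.bdd_mul (hf.mono hm le_rfl).aestronglyMeasurable (Eventually.of_forall hfa)).abs
  · refine (hi.bdd_mul (c := 1) ?_ (Eventually.of_forall hbd)).const_mul a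
    exact ((((measurable_const.indicator (hm _ hA)).const_mul 2).sub_const 1)).aestronglyMeasurable
  · intro ω
    have ha0 : |f ω| ≤ a := hfa ω
    by_cases h : ω ∈ {ω | 0 ≤ e ω - c}
    · simp only [h, indicator_of_mem, Pi.one_apply, abs_mul]
      rw [abs_of_nonneg (show 0 ≤ e ω - c from h)]
      have h' : 0 ≤ e ω - c := h
      nlinarith
    · simp only [h, indicator_of_notMem, not_false_eq_true, abs_mul]
      have h' : e ω - c < 0 := not_le.mp h
      rw [abs_of_neg h']
      nlinarith

/-- Davydov-type covariance inequality for bounded variables. -/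
lemma abs_cov_le_of_mixing {m₁ m₂ mΩ : MeasurableSpace Ω} {P : Measure Ω} [IsProbabilityMeasure P]
    (h₁ : m₁ ≤ mΩ) (h₂ : m₂ ≤ mΩ) {α : ℝ}
    (hα : ∀ A B, MeasurableSet[m₁] A → MeasurableSet[m₂] B →
      |P.real (A ∩ B) - P.real A * P.real B| ≤ α)
    {f g : Ω → ℝ} (hf : Measurable[m₁] f) (hg : Measurable[m₂] g) {a b : ℝ}
    (hfa : ∀ ω, |f ω| ≤ a) (hgb : ∀ ω, |g ω| ≤ b) :
    |∫ ω, f ω * g ω ∂P - (∫ ω, f ω ∂P) * ∫ ω, g ω ∂P| ≤ 4 * a * b * α := by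
  obtain ⟨ω₀⟩ : Nonempty Ω := nonempty_of_isProbabilityMeasure P
  have ha : 0 ≤ a := (abs_nonneg _).trans (hfa ω₀)
  have hb : 0 ≤ b := (abs_nonneg _).trans (hgb ω₀)
  obtain ⟨A, hA, hA'⟩ := exists_sign_cov_le (P := P) h₁ hf (hg.mono h₂ le_rfl) hfa hgb
  have hAm := h₁ _ hA
  have hσ : Measurable (fun ω => 2 * A.indicator (1 : Ω → ℝ) ω - 1) :=
    ((measurable_const.indicator hAm).const_mul 2).sub_const 1
  have hbd : ∀ ω, |2 * A.indicator (1 : Ω → ℝ) ω - 1| ≤ 1 := by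
    intro ω
    by_cases h : ω ∈ A <;> simp only [h, indicator_of_mem, indicator_of_notMem,
      not_false_eq_true, Pi.one_apply] <;> norm_num
  obtain ⟨B, hB, hB'⟩ := exists_sign_cov_le (P := P) h₂ hg hσ hgb hbd
  have hBm := h₂ _ hB
  have hAi : Integrable (A.indicator (1 : Ω → ℝ)) P := (integrable_const (1:ℝ)).indicator hAm
  have hBi : Integrable (B.indicator (1 : Ω → ℝ)) P := (integrable_const (1:ℝ)).indicator hBm
  have hABi : Integrable ((A ∩ B).indicator (1 : Ω → ℝ)) P :=
    (integrable_const (1:ℝ)).indicator (hAm.inter hBm)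
  have hI : ∀ D : Set Ω, MeasurableSet D → ∫ ω, D.indicator (1 : Ω → ℝ) ω ∂P = P.real D :=
    fun D hD => integral_indicator_one hD
  have e1 : ∀ D : Set Ω, MeasurableSet D → ∫ ω, (2 * D.indicator (1 : Ω → ℝ) ω - 1) ∂P
      = 2 * P.real D - 1 := by
    intro D hD
    have hDi : Integrable (D.indicator (1 : Ω → ℝ)) P := (integrable_const (1:ℝ)).indicator hD
    rw [integral_sub (hDi.const_mul 2) (integrable_const 1), integral_const_mul, hI D hD]
    simp
  have e2 : ∫ ω, (2 * B.indicator (1 : Ω → ℝ) ω - 1) * (2 * A.indicator (1 : Ω → ℝ) ω - 1) ∂P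
      = 4 * P.real (A ∩ B) - 2 * P.real A - 2 * P.real B + 1 := by
    have : ∀ ω, (2 * B.indicator (1 : Ω → ℝ) ω - 1) * (2 * A.indicator (1 : Ω → ℝ) ω - 1)
        = 4 * (A ∩ B).indicator (1 : Ω → ℝ) ω - 2 * A.indicator (1 : Ω → ℝ) ω
          - 2 * B.indicator (1 : Ω → ℝ) ω + 1 := by
      intro ω
      rw [inter_indicator_one, Pi.mul_apply]; ring
    simp_rw [this]
    have i1 : Integrable (fun ω => 4 * (A ∩ B).indicator (1 : Ω → ℝ) ω
        - 2 * A.indicator (1 : Ω → ℝ) ω) P := (hABi.const_mul 4).sub (hAi.const_mul 2)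
    have i2 : Integrable (fun ω => 4 * (A ∩ B).indicator (1 : Ω → ℝ) ω
        - 2 * A.indicator (1 : Ω → ℝ) ω - 2 * B.indicator (1 : Ω → ℝ) ω) P :=
      i1.sub (hBi.const_mul 2)
    rw [integral_add i2 (integrable_const 1), integral_sub i1 (hBi.const_mul 2),
      integral_sub (hABi.const_mul 4) (hAi.const_mul 2),
      integral_const_mul, integral_const_mul, integral_const_mul, hI _ hAm, hI _ hBm,
      hI _ (hAm.inter hBm)]
    simp
  rw [e2, e1 A hAm, e1 B hBm] at hB'
  refine hA'.trans ?_
  have h3 : ∫ ω, (2 * A.indicator (1 : Ω → ℝ) ω - 1) * g ω ∂P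
      - (∫ ω, (2 * A.indicator (1 : Ω → ℝ) ω - 1) ∂P) * ∫ ω, g ω ∂P ≤ b * (4 * α) := by
    have h4 := le_abs_self (∫ ω, g ω * (2 * A.indicator (1 : Ω → ℝ) ω - 1) ∂P
      - (∫ ω, g ω ∂P) * ∫ ω, (2 * A.indicator (1 : Ω → ℝ) ω - 1) ∂P)
    rw [e1 A hAm] at h4 ⊢
    have h5 : ∫ ω, (2 * A.indicator (1 : Ω → ℝ) ω - 1) * g ω ∂P
        = ∫ ω, g ω * (2 * A.indicator (1 : Ω → ℝ) ω - 1) ∂P := by simp_rw [mul_comm]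
    rw [h5, mul_comm (2 * P.real A - 1)]
    refine (h4.trans hB').trans (mul_le_mul_of_nonneg_left ?_ hb)
    have := (le_abs_self _).trans (hα A B hA hB)
    nlinarith
  calc a * _ ≤ a * (b * (4 * α)) := mul_le_mul_of_nonneg_left h3 ha
    _ = 4 * a * b * α := by ring

/-- A choice of signs makes the full double sum dominate the diagonal one. -/
lemma exists_signs_sum_diag_le {ι : Type*} (s : Finset ι) (b : ι → ι → ℝ) :
    ∃ ε : ι → ℝ, (∀ i, |ε i| = 1) ∧
      ∑ i ∈ s, b i i ≤ ∑ i ∈ s, ∑ k ∈ s, ε i * ε k * b i k := by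
  classical
  induction s using Finset.induction_on with
  | empty => exact ⟨fun _ => 1, by simp, by simp⟩
  | insert x s hx ih =>
    obtain ⟨ε, hε, hle⟩ := ih
    set c := ∑ k ∈ s, ε k * b x k + ∑ i ∈ s, ε i * b i x with hc
    obtain ⟨σ, hσ, hσc⟩ : ∃ σ : ℝ, |σ| = 1 ∧ 0 ≤ σ * c := by
      rcases le_total 0 c with h | h
      · exact ⟨1, by simp, by simpa⟩
      · exact ⟨-1, by simp, by simpa⟩
    refine ⟨fun i => if i = x then σ else ε i, fun i => by dsimp only; split_ifs; exacts [hσ, hε i],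
      ?_⟩
    have hne : ∀ i ∈ s, i ≠ x := fun i hi h => hx (h ▸ hi)
    have hσ2 : σ * σ = 1 := by rw [← abs_mul_abs_self, hσ, one_mul]
    rw [Finset.sum_insert hx, Finset.sum_insert hx, Finset.sum_insert hx]
    have e1 : ∑ k ∈ s, (if x = x then σ else ε x) * (if k = x then σ else ε k) * b x k
        = σ * ∑ k ∈ s, ε k * b x k := by
      rw [Finset.mul_sum]
      exact Finset.sum_congr rfl fun k hk => by simp only [if_true, if_neg (hne k hk), mul_assoc]
    have e2 : ∑ i ∈ s, ∑ k ∈ insert x s,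
          (if i = x then σ else ε i) * (if k = x then σ else ε k) * b i k
        = σ * ∑ i ∈ s, ε i * b i x + ∑ i ∈ s, ∑ k ∈ s, ε i * ε k * b i k := by
      rw [Finset.mul_sum, ← Finset.sum_add_distrib]
      refine Finset.sum_congr rfl fun i hi => ?_
      rw [Finset.sum_insert hx, if_neg (hne i hi), if_pos rfl]
      congr 1
      · ring
      · exact Finset.sum_congr rfl fun k hk => by rw [if_neg (hne k hk)]
    rw [e1, e2]
    simp only [↓reduceIte, hσ2, one_mul]
    rw [hc, mul_add] at hσc
    linarith

/-- Covariance inequality summed over families whose absolute values have bounded sum. -/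
lemma sum_abs_cov_le_of_mixing {ι : Type*} {m₁ m₂ mΩ : MeasurableSpace Ω} {P : Measure Ω}
    [IsProbabilityMeasure P] (h₁ : m₁ ≤ mΩ) (h₂ : m₂ ≤ mΩ) {α : ℝ}
    (hα : ∀ A B, MeasurableSet[m₁] A → MeasurableSet[m₂] B →
      |P.real (A ∩ B) - P.real A * P.real B| ≤ α)
    (s : Finset ι) {f g : ι → Ω → ℝ} (hf : ∀ i, Measurable[m₁] (f i))
    (hg : ∀ i, Measurable[m₂] (g i)) {a b : ℝ}
    (hfa : ∀ ω, ∑ i ∈ s, |f i ω| ≤ a) (hgb : ∀ ω, ∑ i ∈ s, |g i ω| ≤ b) :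
    ∑ i ∈ s, |∫ ω, f i ω * g i ω ∂P - (∫ ω, f i ω ∂P) * ∫ ω, g i ω ∂P| ≤ 4 * a * b * α := by
  have hfi : ∀ i ∈ s, ∀ ω, |f i ω| ≤ a := fun i hi ω =>
    (Finset.single_le_sum (f := fun i => |f i ω|) (fun _ _ => abs_nonneg _) hi).trans (hfa ω)
  have hgi : ∀ i ∈ s, ∀ ω, |g i ω| ≤ b := fun i hi ω =>
    (Finset.single_le_sum (f := fun i => |g i ω|) (fun _ _ => abs_nonneg _) hi).trans (hgb ω)
  have hfI : ∀ i ∈ s, Integrable (f i) P := fun i hi =>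
    integrable_of_abs_le ((hf i).mono h₁ le_rfl) (hfi i hi)
  have hgI : ∀ i ∈ s, Integrable (g i) P := fun i hi =>
    integrable_of_abs_le ((hg i).mono h₂ le_rfl) (hgi i hi)
  have hfgI : ∀ i ∈ s, ∀ k ∈ s, Integrable (fun ω => f i ω * g k ω) P := fun i hi k hk =>
    (hgI k hk).bdd_mul ((hf i).mono h₁ le_rfl).aestronglyMeasurable
      (Eventually.of_forall (hfi i hi))
  set cv : ι → ι → ℝ := fun i k => ∫ ω, f i ω * g k ω ∂P - (∫ ω, f i ω ∂P) * ∫ ω, g k ω ∂P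
    with hcv
  have hsg : ∀ i, ∃ σ : ℝ, |σ| = 1 ∧ |cv i i| = σ * cv i i := by
    intro i
    rcases le_total 0 (cv i i) with h | h
    · exact ⟨1, by simp, by rw [abs_of_nonneg h, one_mul]⟩
    · exact ⟨-1, by simp, by rw [abs_of_nonpos h]; ring⟩
  choose σ hσ hσc using hsg
  obtain ⟨ε, hε, hle⟩ := exists_signs_sum_diag_le s (fun i k => σ i * cv i k)
  have hF : Measurable[m₁] (fun ω => ∑ i ∈ s, ε i * σ i * f i ω) :=
    Finset.measurable_fun_sum _ fun i _ => (hf i).const_mul _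
  have hG : Measurable[m₂] (fun ω => ∑ i ∈ s, ε i * g i ω) :=
    Finset.measurable_fun_sum _ fun i _ => (hg i).const_mul _
  have hFa : ∀ ω, |∑ i ∈ s, ε i * σ i * f i ω| ≤ a := fun ω =>
    (Finset.abs_sum_le_sum_abs _ _).trans (le_trans (le_of_eq
      (Finset.sum_congr rfl fun i _ => by simp [abs_mul, hε, hσ])) (hfa ω))
  have hGb : ∀ ω, |∑ i ∈ s, ε i * g i ω| ≤ b := fun ω =>
    (Finset.abs_sum_le_sum_abs _ _).trans (le_trans (le_of_eq
      (Finset.sum_congr rfl fun i _ => by simp [abs_mul, hε])) (hgb ω))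
  have hmain := (le_abs_self _).trans (abs_cov_le_of_mixing (P := P) h₁ h₂ hα hF hG hFa hGb)
  refine le_trans ?_ hmain
  have e1 : ∫ ω, (∑ i ∈ s, ε i * σ i * f i ω) * ∑ i ∈ s, ε i * g i ω ∂P
      = ∑ i ∈ s, ∑ k ∈ s, ε i * ε k * σ i * ∫ ω, f i ω * g k ω ∂P := by
    have : ∀ ω, (∑ i ∈ s, ε i * σ i * f i ω) * ∑ i ∈ s, ε i * g i ω
        = ∑ i ∈ s, ∑ k ∈ s, ε i * ε k * σ i * (f i ω * g k ω) := by
      intro ω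
      rw [Finset.sum_mul_sum]
      exact Finset.sum_congr rfl fun i _ => Finset.sum_congr rfl fun k _ => by ring
    simp_rw [this]
    rw [integral_finsetSum _ fun i hi => integrable_finsetSum _ fun k hk =>
      (hfgI i hi k hk).const_mul _]
    refine Finset.sum_congr rfl fun i hi => ?_
    rw [integral_finsetSum _ fun k hk => (hfgI i hi k hk).const_mul _]
    exact Finset.sum_congr rfl fun k _ => integral_const_mul _ _
  have e2 : (∫ ω, ∑ i ∈ s, ε i * σ i * f i ω ∂P) * ∫ ω, ∑ i ∈ s, ε i * g i ω ∂P
      = ∑ i ∈ s, ∑ k ∈ s, ε i * ε k * σ i * ((∫ ω, f i ω ∂P) * ∫ ω, g k ω ∂P) := by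
    rw [integral_finsetSum _ fun i hi => (hfI i hi).const_mul _,
      integral_finsetSum _ fun i hi => (hgI i hi).const_mul _, Finset.sum_mul_sum]
    refine Finset.sum_congr rfl fun i _ => Finset.sum_congr rfl fun k _ => ?_
    rw [integral_const_mul, integral_const_mul]; ring
  rw [e1, e2, ← Finset.sum_sub_distrib]
  calc ∑ i ∈ s, |cv i i| = ∑ i ∈ s, σ i * cv i i := Finset.sum_congr rfl fun i _ => hσc i
    _ ≤ _ := hle
    _ = _ := by
      refine Finset.sum_congr rfl fun i _ => ?_
      rw [← Finset.sum_sub_distrib]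
      refine Finset.sum_congr rfl fun k _ => ?_
      simp only [hcv]; ring

/-! ### A smooth test function -/

/-- A convex function comparable to `x⁴` near zero and to `x²` at infinity. -/
def cosTest (x : ℝ) : ℝ := x ^ 2 / 2 - 1 + Real.cos x

lemma cosTest_nonneg (x : ℝ) : 0 ≤ cosTest x := by
  have := Real.one_sub_sq_div_two_le_cos (x := x)
  unfold cosTest; linarith

lemma cosTest_zero : cosTest 0 = 0 := by simp [cosTest]

lemma continuous_cosTest : Continuous cosTest := by unfold cosTest; fun_prop

lemma abs_sub_sin_sub_le (x y : ℝ) :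
    |(x - Real.sin x) - (y - Real.sin y)| ≤ 2 * |x - y| := by
  have h := Real.abs_sin_sub_sin_le x y
  calc |(x - Real.sin x) - (y - Real.sin y)| = |(x - y) - (Real.sin x - Real.sin y)| := by ring_nf
    _ ≤ |x - y| + |Real.sin x - Real.sin y| := abs_sub _ _
    _ ≤ 2 * |x - y| := by linarith

lemma hasDerivAt_cosTest (x : ℝ) : HasDerivAt cosTest (x - Real.sin x) x := by
  have h := (((hasDerivAt_pow 2 x).div_const 2).sub_const 1).add (Real.hasDerivAt_cos x)
  refine h.congr_deriv ?_
  push_cast; ring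

lemma one_sub_cos_le_abs (x : ℝ) : 1 - Real.cos x ≤ |x| := by
  have h1 := Real.one_sub_sq_div_two_le_cos (x := x)
  have h2 := Real.neg_one_le_cos x
  rw [← sq_abs] at h1
  rcases le_total |x| 2 with h | h
  · nlinarith [abs_nonneg x]
  · linarith

lemma cosTest_mono_abs {x y : ℝ} (hy : 0 ≤ y) (h : y ≤ |x|) : cosTest y ≤ cosTest x := by
  have hx : cosTest x = cosTest |x| := by simp [cosTest]
  rw [hx]
  refine monotoneOn_of_deriv_nonneg (convex_Ici 0) continuous_cosTest.continuousOn
    (fun z _ => (hasDerivAt_cosTest z).differentiableAt.differentiableWithinAt) ?_ hy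
    (abs_nonneg x) h
  intro z hz
  rw [interior_Ici] at hz
  rw [(hasDerivAt_cosTest z).deriv]
  linarith [Real.sin_lt hz]

lemma cosTest_pos {x : ℝ} (hx : 0 < x) : 0 < cosTest x := by
  have h := Real.one_sub_sq_div_two_lt_cos hx.ne'
  unfold cosTest; linarith

/-- Second-order expansion of `cosTest` with second derivative frozen at a nearby point. -/
lemma cosTest_sub_le {A B S x δ : ℝ} (hS : |S - A| ≤ δ) (hB : |B - A| ≤ δ)
    (hSx : |S + x - A| ≤ δ) :
    cosTest (S + x) - cosTest S ≤ (B - Real.sin B) * x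
      + (1 - Real.cos A) * (x ^ 2 / 2 + (S - B) * x)
      + δ * (x ^ 2 + |S - B| * |x|) := by
  have hδ : 0 ≤ δ := (abs_nonneg _).trans hS
  have hlip : ∀ y ∈ Metric.closedBall A δ, ∀ z ∈ Metric.closedBall A δ,
      |(z * Real.cos A - Real.sin z) - (y * Real.cos A - Real.sin y)| ≤ δ * |z - y| := by
    intro y hy z hz
    refine Convex.norm_image_sub_le_of_norm_hasDerivWithin_le (𝕜 := ℝ)
      (f := fun y => y * Real.cos A - Real.sin y) (f' := fun y => 1 * Real.cos A - Real.cos y)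
      (fun w _ => (((hasDerivAt_id w).mul_const _).sub (Real.hasDerivAt_sin w)).hasDerivWithinAt)
      (fun w hw => ?_) (convex_closedBall A δ) hy hz
    rw [one_mul, Real.norm_eq_abs, abs_sub_comm]
    exact (Real.abs_cos_sub_cos_le _ _).trans hw
  have hSm : S ∈ Metric.closedBall A δ := hS
  have hBm : B ∈ Metric.closedBall A δ := hB
  have hSxm : S + x ∈ Metric.closedBall A δ := hSx
  have hseg : segment ℝ S (S + x) ⊆ Metric.closedBall A δ :=
    (convex_closedBall A δ).segment_subset hSm hSxm
  have h2 := Convex.norm_image_sub_le_of_norm_hasDerivWithin_le (𝕜 := ℝ)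
    (f := fun y => cosTest y - (1 - Real.cos A) * (y ^ 2 / 2) - (S * Real.cos A - Real.sin S) * y)
    (f' := fun y => (y * Real.cos A - Real.sin y) - (S * Real.cos A - Real.sin S))
    (s := segment ℝ S (S + x)) (C := δ * |x|) (x := S) (y := S + x)
    (fun w _ => by
      have h := ((hasDerivAt_cosTest w).sub (((hasDerivAt_pow 2 w).div_const 2).const_mul
        (1 - Real.cos A))).sub ((hasDerivAt_id w).const_mul (S * Real.cos A - Real.sin S))
      refine (h.congr_deriv ?_).hasDerivWithinAt
      push_cast; ring)
    (fun w hw => by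
      refine (hlip S hSm w (hseg hw)).trans (mul_le_mul_of_nonneg_left ?_ hδ)
      obtain ⟨t, ⟨ht0, ht1⟩, rfl⟩ : ∃ t ∈ Icc (0:ℝ) 1, S + t * x = w := by
        rw [segment_eq_image'] at hw
        simpa using hw
      rw [add_sub_cancel_left, abs_mul, abs_of_nonneg ht0]
      exact mul_le_of_le_one_left (abs_nonneg x) ht1)
    (convex_segment _ _) (left_mem_segment _ _ _) (right_mem_segment _ _ _)
  have h3 := hlip B hBm S hSm
  simp only [Real.norm_eq_abs, add_sub_cancel_left] at h2
  have h2' := (le_abs_self _).trans h2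
  have h3' : ((S * Real.cos A - Real.sin S) - (B * Real.cos A - Real.sin B)) * x
      ≤ δ * |S - B| * |x| := by
    refine (le_abs_self _).trans ?_
    rw [abs_mul]
    exact mul_le_mul_of_nonneg_right h3 (abs_nonneg x)
  have hx2 : |x| * |x| = x ^ 2 := by rw [abs_mul_abs_self, sq]
  have h4 : δ * |x| * |x| = δ * x ^ 2 := by rw [mul_assoc, hx2]
  rw [h4] at h2'
  linarith

/-! ### Bounded measurable functions -/

/-- Measurable and uniformly bounded. -/
def BddMeas [MeasurableSpace Ω] (f : Ω → ℝ) : Prop := Measurable f ∧ ∃ c, ∀ ω, |f ω| ≤ c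

namespace BddMeas

variable [MeasurableSpace Ω] {f g : Ω → ℝ}

lemma integrable (hf : BddMeas f) {P : Measure Ω} [IsFiniteMeasure P] : Integrable f P :=
  let ⟨_, hc⟩ := hf.2
  integrable_of_abs_le hf.1 hc

lemma const (c : ℝ) : BddMeas (fun _ : Ω => c) := ⟨measurable_const, |c|, fun _ => le_rfl⟩

lemma add (hf : BddMeas f) (hg : BddMeas g) : BddMeas (fun ω => f ω + g ω) := by
  obtain ⟨a, ha⟩ := hf.2
  obtain ⟨b, hb⟩ := hg.2
  exact ⟨hf.1.add hg.1, a + b, fun ω => (abs_add_le _ _).trans (add_le_add (ha ω) (hb ω))⟩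

lemma sub (hf : BddMeas f) (hg : BddMeas g) : BddMeas (fun ω => f ω - g ω) := by
  obtain ⟨a, ha⟩ := hf.2
  obtain ⟨b, hb⟩ := hg.2
  exact ⟨hf.1.sub hg.1, a + b, fun ω => (abs_sub _ _).trans (add_le_add (ha ω) (hb ω))⟩

lemma mul (hf : BddMeas f) (hg : BddMeas g) : BddMeas (fun ω => f ω * g ω) := by
  obtain ⟨a, ha⟩ := hf.2
  obtain ⟨b, hb⟩ := hg.2
  refine ⟨hf.1.mul hg.1, a * b, fun ω => ?_⟩
  rw [abs_mul]
  exact mul_le_mul (ha ω) (hb ω) (abs_nonneg _) ((abs_nonneg _).trans (ha ω))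

lemma continuous_comp (hf : BddMeas f) {φ : ℝ → ℝ} (hφ : Continuous φ) :
    BddMeas (fun ω => φ (f ω)) := by
  obtain ⟨a, ha⟩ := hf.2
  obtain ⟨c, hc⟩ := (isCompact_Icc (a := -a) (b := a)).exists_bound_of_continuousOn
    hφ.continuousOn
  exact ⟨hφ.measurable.comp hf.1, c, fun ω => hc _ (abs_le.mp (ha ω))⟩

lemma abs (hf : BddMeas f) : BddMeas (fun ω => |f ω|) := hf.continuous_comp continuous_abs

lemma sum {ι : Type*} (t : Finset ι) {f : ι → Ω → ℝ} (hf : ∀ i ∈ t, BddMeas (f i)) :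
    BddMeas (fun ω => ∑ i ∈ t, f i ω) := by
  classical
  induction t using Finset.induction_on with
  | empty => simpa using const (Ω := Ω) 0
  | insert x t hx ih =>
    simp only [Finset.sum_insert hx]
    exact (hf x (Finset.mem_insert_self _ _)).add
      (ih fun i hi => hf i (Finset.mem_insert_of_mem hi))

end BddMeas

/-! ### Partial sums of a mixing family -/

/-- A family `x m` of centered sequences, adapted to a mixing pair of past and future
`σ`-algebras, each term being at most `s` and the sum over the family at most `2 s`. -/
structure IsMixingFamily {ι : Type*} [mΩ : MeasurableSpace Ω] (P : Measure Ω)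
    (past fut : ℕ → MeasurableSpace Ω) (α : ℕ → ℝ) (t : Finset ι) (x : ι → ℕ → Ω → ℝ)
    (s : ℝ) : Prop where
  past_le : ∀ p, past p ≤ mΩ
  fut_le : ∀ p, fut p ≤ mΩ
  past_mono : Monotone past
  fut_anti : Antitone fut
  mixing : ∀ r, 1 ≤ r → ∀ p A B, MeasurableSet[past p] A → MeasurableSet[fut (p + r)] B →
    |P.real (A ∩ B) - P.real A * P.real B| ≤ α r
  meas_past : ∀ m i, Measurable[past i] (x m i)
  meas_fut : ∀ m i, Measurable[fut i] (x m i)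
  abs_le : ∀ m i ω, |x m i ω| ≤ s
  sum_abs_le : ∀ i ω, ∑ m ∈ t, |x m i ω| ≤ 2 * s
  centered : ∀ m i, ∫ ω, x m i ω ∂P = 0

/-- Partial sums of the first `k` terms. -/
def partSum {ι : Type*} (x : ι → ℕ → Ω → ℝ) (m : ι) (k : ℕ) (ω : Ω) : ℝ :=
  ∑ i ∈ Finset.range k, x m i ω

lemma partSum_sub {ι : Type*} (x : ι → ℕ → Ω → ℝ) (m : ι) {l k : ℕ} (hlk : l ≤ k) (ω : Ω) :
    partSum x m k ω - partSum x m l ω = ∑ i ∈ Finset.Ico l k, x m i ω := by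
  rw [Finset.sum_Ico_eq_sub _ hlk]; rfl

namespace IsMixingFamily

variable {ι : Type*} [mΩ : MeasurableSpace Ω] {P : Measure Ω}
  {past fut : ℕ → MeasurableSpace Ω} {α : ℕ → ℝ} {t : Finset ι} {x : ι → ℕ → Ω → ℝ} {s : ℝ}

lemma nonneg [IsProbabilityMeasure P] (h : IsMixingFamily P past fut α t x s) : 0 ≤ s := by
  obtain ⟨ω₀⟩ : Nonempty Ω := nonempty_of_isProbabilityMeasure P
  have := (Finset.sum_nonneg fun m _ => abs_nonneg (x m 0 ω₀)).trans (h.sum_abs_le 0 ω₀)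
  linarith

lemma bddMeas (h : IsMixingFamily P past fut α t x s) (m : ι) (i : ℕ) : BddMeas (x m i) :=
  ⟨(h.meas_past m i).mono (h.past_le i) le_rfl, s, h.abs_le m i⟩

lemma bddMeas_partSum (h : IsMixingFamily P past fut α t x s) (m : ι) (k : ℕ) :
    BddMeas (partSum x m k) := BddMeas.sum _ fun i _ => h.bddMeas m i

lemma measurable_partSum (h : IsMixingFamily P past fut α t x s) (m : ι) (k : ℕ) :
    Measurable[past k] (partSum x m k) :=
  Finset.measurable_fun_sum _ fun i hi =>
    (h.meas_past m i).mono (h.past_mono (Finset.mem_range.mp hi).le) le_rfl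

lemma abs_partSum_sub_le (h : IsMixingFamily P past fut α t x s) (m : ι) {l k : ℕ} (hlk : l ≤ k)
    (ω : Ω) : |partSum x m k ω - partSum x m l ω| ≤ (k - l : ℕ) * s := by
  rw [partSum_sub x m hlk]
  refine (Finset.abs_sum_le_sum_abs _ _).trans ((Finset.sum_le_card_nsmul _ _ s
    fun i _ => h.abs_le m i ω).trans ?_)
  simp

lemma sum_abs_partSum_le (h : IsMixingFamily P past fut α t x s) (k : ℕ) (ω : Ω) :
    ∑ m ∈ t, |partSum x m k ω| ≤ k * (2 * s) := by
  calc ∑ m ∈ t, |partSum x m k ω| ≤ ∑ m ∈ t, ∑ i ∈ Finset.range k, |x m i ω| :=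
        Finset.sum_le_sum fun m _ => Finset.abs_sum_le_sum_abs _ _
    _ = ∑ i ∈ Finset.range k, ∑ m ∈ t, |x m i ω| := Finset.sum_comm
    _ ≤ ∑ i ∈ Finset.range k, 2 * s := Finset.sum_le_sum fun i _ => h.sum_abs_le i ω
    _ = k * (2 * s) := by simp

variable [IsProbabilityMeasure P]

lemma integral_partSum_sq_le (h : IsMixingFamily P past fut α t x s) {w T : ℝ} {R : ℕ}
    (hT : ∀ k, ∑ i ∈ Finset.range (k - R), α (k - i) ≤ T) {m : ι}
    (hw : ∀ i, ∫ ω, |x m i ω| ∂P ≤ s * w) (k : ℕ) :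
    ∫ ω, partSum x m k ω ^ 2 ∂P ≤ k * (s ^ 2 * (2 * (R * w + 4 * T) + w)) := by
  have hs := h.nonneg
  have hcross : ∀ i k, |∫ ω, x m i ω * x m k ω ∂P| ≤ s ^ 2 * w := by
    intro i k
    refine abs_integral_le_integral_abs.trans ?_
    calc ∫ ω, |x m i ω * x m k ω| ∂P ≤ ∫ ω, s * |x m k ω| ∂P := by
          refine integral_mono ((h.bddMeas m i).mul (h.bddMeas m k)).abs.integrable
            ((BddMeas.const s).mul (h.bddMeas m k).abs).integrable fun ω => ?_
          rw [abs_mul]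
          exact mul_le_mul_of_nonneg_right (h.abs_le m i ω) (abs_nonneg _)
      _ = s * ∫ ω, |x m k ω| ∂P := integral_const_mul _ _
      _ ≤ s * (s * w) := mul_le_mul_of_nonneg_left (hw k) hs
      _ = s ^ 2 * w := by ring
  have hw0 : 0 ≤ s ^ 2 * w := (abs_nonneg _).trans (hcross 0 0)
  have hmix : ∀ i k, i < k → |∫ ω, x m i ω * x m k ω ∂P| ≤ 4 * s ^ 2 * α (k - i) := by
    intro i k hik
    have hr : i + (k - i) = k := by omega
    have := abs_cov_le_of_mixing (P := P) (h.past_le i) (h.fut_le k) (α := α (k - i))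
      (fun A B hA hB => h.mixing (k - i) (by omega) i A B hA (by rwa [hr]))
      (h.meas_past m i) (h.meas_fut m k) (h.abs_le m i) (h.abs_le m k)
    rw [h.centered, zero_mul, sub_zero] at this
    calc _ ≤ _ := this
      _ = _ := by ring
  induction k with
  | zero => simp [partSum]
  | succ k ih =>
    have e : ∀ ω, partSum x m (k + 1) ω ^ 2 = partSum x m k ω ^ 2
        + (2 * ∑ i ∈ Finset.range k, x m i ω * x m k ω + x m k ω * x m k ω) := by
      intro ω
      have h1 : partSum x m (k + 1) ω = partSum x m k ω + x m k ω := Finset.sum_range_succ _ _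
      have h2 : ∑ i ∈ Finset.range k, x m i ω * x m k ω = partSum x m k ω * x m k ω :=
        (Finset.sum_mul _ _ _).symm
      rw [h1, h2]; ring
    have hxx : ∀ i, BddMeas (fun ω => x m i ω * x m k ω) := fun i =>
      (h.bddMeas m i).mul (h.bddMeas m k)
    have hsum := BddMeas.sum (Finset.range k) fun i _ => hxx i
    have hsq : BddMeas (fun ω => partSum x m k ω ^ 2) :=
      (h.bddMeas_partSum m k).continuous_comp (continuous_pow 2)
    simp_rw [e]
    rw [integral_add hsq.integrable (((BddMeas.const 2).mul hsum).add (hxx k)).integrable,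
      integral_add ((BddMeas.const 2).mul hsum).integrable (hxx k).integrable,
      integral_const_mul, integral_finsetSum _ fun i _ => (hxx i).integrable]
    have hsplit : ∑ i ∈ Finset.range k, ∫ ω, x m i ω * x m k ω ∂P
        ≤ s ^ 2 * (R * w + 4 * T) := by
      rw [← Finset.sum_range_add_sum_Ico _ (Nat.sub_le k R)]
      have h1 : ∑ i ∈ Finset.range (k - R), ∫ ω, x m i ω * x m k ω ∂P ≤ 4 * s ^ 2 * T := by
        calc _ ≤ ∑ i ∈ Finset.range (k - R), 4 * s ^ 2 * α (k - i) :=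
              Finset.sum_le_sum fun i hi => (le_abs_self _).trans
                (hmix i k (by have := Finset.mem_range.mp hi; omega))
          _ = 4 * s ^ 2 * ∑ i ∈ Finset.range (k - R), α (k - i) := (Finset.mul_sum _ _ _).symm
          _ ≤ _ := mul_le_mul_of_nonneg_left (hT k) (by positivity)
      have h2 : ∑ i ∈ Finset.Ico (k - R) k, ∫ ω, x m i ω * x m k ω ∂P ≤ R * (s ^ 2 * w) := by
        refine (Finset.sum_le_card_nsmul _ _ _ fun i _ =>
          (le_abs_self _).trans (hcross i k)).trans ?_
        rw [nsmul_eq_mul, Nat.card_Ico]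
        refine mul_le_mul_of_nonneg_right ?_ hw0
        exact_mod_cast (by omega : k - (k - R) ≤ R)
      linarith
    have h3 := (le_abs_self _).trans (hcross k k)
    push_cast
    linarith

/-- One step of the Lindeberg-type telescoping, summed over the family. -/
lemma sum_integral_cosTest_step_le (h : IsMixingFamily P past fut α t x s) {q Q n : ℕ}
    (hqQ : q < Q) {T V : ℝ} (hT : ∀ k, ∑ i ∈ Finset.range (k - q), α (k - i) ≤ T)
    (hα : ∀ r, 0 ≤ α r) (hV0 : 0 ≤ V)
    (hV : ∀ m ∈ t, ∀ k ≤ n, ∫ ω, partSum x m k ω ^ 2 ∂P ≤ V) {k : ℕ} (hk : k ≤ n) :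
    ∑ m ∈ t, ∫ ω, cosTest (partSum x m (k + 1) ω) ∂P
      - ∑ m ∈ t, ∫ ω, cosTest (partSum x m k ω) ∂P
      ≤ s ^ 2 * (32 * T + 2 * ((Q + 1) * s) * (1 + q)
        + (1 + 2 * q) * (8 * (n * s) * α (Q - q) + V / 2)) := by
  have hs := h.nonneg
  set A : ι → Ω → ℝ := fun m => partSum x m (k - Q) with hA
  set B : ι → Ω → ℝ := fun m => partSum x m (k - q) with hB
  set S : ι → Ω → ℝ := fun m => partSum x m k with hS
  set Y : ι → Ω → ℝ := fun m ω => x m k ω ^ 2 / 2 + (S m ω - B m ω) * x m k ω with hY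
  set δ : ℝ := (Q + 1) * s with hδ
  have hAb : ∀ m, BddMeas (A m) := fun m => h.bddMeas_partSum m _
  have hBb : ∀ m, BddMeas (B m) := fun m => h.bddMeas_partSum m _
  have hSb : ∀ m, BddMeas (S m) := fun m => h.bddMeas_partSum m _
  have hxb : ∀ m, BddMeas (x m k) := fun m => h.bddMeas m k
  have hYb : ∀ m, BddMeas (Y m) := fun m =>
    ((hxb m).continuous_comp (φ := fun y => y ^ 2 / 2) (by fun_prop)).add
      (((hSb m).sub (hBb m)).mul (hxb m))
  have hBx : ∀ m, BddMeas (fun ω => (B m ω - Real.sin (B m ω)) * x m k ω) := fun m =>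
    ((hBb m).continuous_comp (φ := fun y => y - Real.sin y) (by fun_prop)).mul (hxb m)
  have hAc : ∀ m, BddMeas (fun ω => 1 - Real.cos (A m ω)) := fun m =>
    (hAb m).continuous_comp (φ := fun y => 1 - Real.cos y) (by fun_prop)
  have hEb : ∀ m, BddMeas (fun ω => δ * (x m k ω ^ 2 + |S m ω - B m ω| * |x m k ω|)) := fun m =>
    (BddMeas.const δ).mul (((hxb m).continuous_comp (continuous_pow 2)).add
      (((hSb m).sub (hBb m)).abs.mul (hxb m).abs))
  have hSBabs : ∀ m ω, |S m ω - B m ω| ≤ q * s := fun m ω =>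
    (h.abs_partSum_sub_le m (Nat.sub_le k q) ω).trans
      (mul_le_mul_of_nonneg_right (by exact_mod_cast (by omega : k - (k - q) ≤ q)) hs)
  have hpt : ∀ m ω, cosTest (partSum x m (k + 1) ω) - cosTest (S m ω) ≤
      (B m ω - Real.sin (B m ω)) * x m k ω + (1 - Real.cos (A m ω)) * Y m ω
        + δ * (x m k ω ^ 2 + |S m ω - B m ω| * |x m k ω|) := by
    intro m ω
    have h1 : partSum x m (k + 1) ω = S m ω + x m k ω := Finset.sum_range_succ _ _
    have hle : ∀ l, k - Q ≤ l → l ≤ k + 1 → |partSum x m l ω - A m ω| ≤ δ := fun l hl1 hl2 =>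
      (h.abs_partSum_sub_le m hl1 ω).trans (mul_le_mul_of_nonneg_right
        (by exact_mod_cast (by omega : l - (k - Q) ≤ Q + 1)) hs)
    rw [h1]
    refine cosTest_sub_le (hle k (by omega) (by omega)) (hle (k - q) (by omega) (by omega)) ?_
    rw [← h1]
    exact hle (k + 1) (by omega) le_rfl
  have hint : ∀ m, ∫ ω, cosTest (partSum x m (k + 1) ω) ∂P - ∫ ω, cosTest (S m ω) ∂P
      ≤ ∫ ω, (B m ω - Real.sin (B m ω)) * x m k ω ∂P
        + ∫ ω, (1 - Real.cos (A m ω)) * Y m ω ∂P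
        + ∫ ω, δ * (x m k ω ^ 2 + |S m ω - B m ω| * |x m k ω|) ∂P := by
    intro m
    have c1 :=
      ((h.bddMeas_partSum m (k + 1)).continuous_comp continuous_cosTest).integrable (P := P)
    have c2 := ((hSb m).continuous_comp continuous_cosTest).integrable (P := P)
    rw [← integral_sub c1 c2, ← integral_add (hBx m).integrable ((hAc m).mul (hYb m)).integrable,
      ← integral_add ((hBx m).add ((hAc m).mul (hYb m))).integrable (hEb m).integrable]
    exact integral_mono (c1.sub c2)
      (((hBx m).add ((hAc m).mul (hYb m))).add (hEb m)).integrable (hpt m)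
  have hfirst : ∑ m ∈ t, ∫ ω, (B m ω - Real.sin (B m ω)) * x m k ω ∂P ≤ s ^ 2 * (32 * T) := by
    have hBeq : ∀ m ω, (B m ω - Real.sin (B m ω)) * x m k ω
        = ∑ i ∈ Finset.range (k - q), ((partSum x m (i + 1) ω - Real.sin (partSum x m (i + 1) ω))
          - (partSum x m i ω - Real.sin (partSum x m i ω))) * x m k ω := by
      intro m ω
      rw [← Finset.sum_mul,
        Finset.sum_range_sub (fun i => partSum x m i ω - Real.sin (partSum x m i ω))]
      simp [hB, partSum]
    have hψ : Continuous fun y : ℝ => y - Real.sin y := by fun_prop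
    have hD : ∀ m i, BddMeas (fun ω => (partSum x m (i + 1) ω - Real.sin (partSum x m (i + 1) ω))
          - (partSum x m i ω - Real.sin (partSum x m i ω))) := fun m i =>
      ((h.bddMeas_partSum m (i + 1)).continuous_comp hψ).sub
        ((h.bddMeas_partSum m i).continuous_comp hψ)
    simp_rw [hBeq]
    rw [Finset.sum_congr rfl fun m _ => integral_finsetSum _ fun i _ =>
      ((hD m i).mul (hxb m)).integrable, Finset.sum_comm]
    have hi : ∀ i ∈ Finset.range (k - q), ∑ m ∈ t, ∫ ω,
        ((partSum x m (i + 1) ω - Real.sin (partSum x m (i + 1) ω))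
          - (partSum x m i ω - Real.sin (partSum x m i ω))) * x m k ω ∂P
        ≤ 32 * s ^ 2 * α (k - i) := by
      intro i hi
      have hik := Finset.mem_range.mp hi
      have hr : i + (k - i) = k := by omega
      have hsucc : ∀ m ω, partSum x m (i + 1) ω = partSum x m i ω + x m i ω :=
        fun m ω => Finset.sum_range_succ _ _
      have hmi : ∀ m, Measurable[past i] (partSum x m (i + 1)) := fun m => by
        have : partSum x m (i + 1) = fun ω => partSum x m i ω + x m i ω := funext (hsucc m)
        rw [this]
        exact (h.measurable_partSum m i).add (h.meas_past m i)
      have hc := sum_abs_cov_le_of_mixing (P := P) (h.past_le i) (h.fut_le k) (α := α (k - i))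
        (fun A B hA hB => h.mixing (k - i) (by omega) i A B hA (by rwa [hr])) t
        (f := fun m ω => (partSum x m (i + 1) ω - Real.sin (partSum x m (i + 1) ω))
          - (partSum x m i ω - Real.sin (partSum x m i ω))) (g := fun m => x m k)
        (fun m => (hψ.measurable.comp (hmi m)).sub
          (hψ.measurable.comp (h.measurable_partSum m i)))
        (fun m => h.meas_fut m k) (a := 2 * (2 * s)) (b := 2 * s)
        (fun ω => by
          calc _ ≤ ∑ m ∈ t, 2 * |x m i ω| := Finset.sum_le_sum fun m _ => by
                refine (abs_sub_sin_sub_le _ _).trans (le_of_eq ?_)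
                rw [hsucc, add_sub_cancel_left]
            _ = 2 * ∑ m ∈ t, |x m i ω| := (Finset.mul_sum _ _ _).symm
            _ ≤ _ := by linarith [h.sum_abs_le i ω])
        (h.sum_abs_le k)
      refine (Finset.sum_le_sum fun m _ => ?_).trans (hc.trans (le_of_eq (by ring)))
      rw [h.centered, mul_zero, sub_zero]
      exact le_abs_self _
    calc _ ≤ ∑ i ∈ Finset.range (k - q), 32 * s ^ 2 * α (k - i) := Finset.sum_le_sum hi
      _ = 32 * s ^ 2 * ∑ i ∈ Finset.range (k - q), α (k - i) := (Finset.mul_sum _ _ _).symm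
      _ ≤ 32 * s ^ 2 * T := mul_le_mul_of_nonneg_left (hT k) (by positivity)
      _ = _ := by ring
  have hsecond : ∑ m ∈ t, ∫ ω, (1 - Real.cos (A m ω)) * Y m ω ∂P ≤
      s ^ 2 * ((1 + 2 * q) * (8 * (n * s) * α (Q - q) + V / 2)) := by
    rcases lt_or_ge k Q with hkQ | hkQ
    · have : ∀ m ω, A m ω = 0 := fun m ω => by
        simp [hA, partSum, Nat.sub_eq_zero_of_le hkQ.le]
      simp only [this, Real.cos_zero, sub_self, zero_mul, integral_zero, Finset.sum_const_zero]
      have := hα (Q - q)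
      positivity
    have hYabs : ∀ m ω, |Y m ω| ≤ s * (1 / 2 + q) * |x m k ω| := by
      intro m ω
      have h1 : x m k ω ^ 2 ≤ s * |x m k ω| := by
        rw [← sq_abs, sq]
        exact mul_le_mul_of_nonneg_right (h.abs_le m k ω) (abs_nonneg _)
      have h2 : |(S m ω - B m ω) * x m k ω| ≤ q * s * |x m k ω| := by
        rw [abs_mul]
        exact mul_le_mul_of_nonneg_right (hSBabs m ω) (abs_nonneg _)
      refine (abs_add_le _ _).trans ?_
      rw [abs_of_nonneg (by positivity)]
      linarith
    have hYsum : ∀ ω, ∑ m ∈ t, |Y m ω| ≤ s ^ 2 * (1 + 2 * q) := by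
      intro ω
      calc _ ≤ ∑ m ∈ t, s * (1 / 2 + q) * |x m k ω| := Finset.sum_le_sum fun m _ => hYabs m ω
        _ = s * (1 / 2 + q) * ∑ m ∈ t, |x m k ω| := (Finset.mul_sum _ _ _).symm
        _ ≤ s * (1 / 2 + q) * (2 * s) :=
          mul_le_mul_of_nonneg_left (h.sum_abs_le k ω) (by positivity)
        _ = _ := by ring
    have hYm : ∀ m, Measurable[fut (k - q)] (Y m) := by
      intro m
      have hfi : ∀ i, k - q ≤ i → Measurable[fut (k - q)] (x m i) := fun i hi =>
        (h.meas_fut m i).mono (h.fut_anti hi) le_rfl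
      have hSB : Measurable[fut (k - q)] (fun ω => S m ω - B m ω) := by
        have : (fun ω => S m ω - B m ω) = fun ω => ∑ i ∈ Finset.Ico (k - q) k, x m i ω :=
          funext fun ω => partSum_sub x m (Nat.sub_le k q) ω
        rw [this]
        exact Finset.measurable_fun_sum _ fun i hi => hfi i (Finset.mem_Ico.mp hi).1
      exact (((hfi k (Nat.sub_le k q)).pow_const 2).div_const 2).add
        (hSB.mul (hfi k (Nat.sub_le k q)))
    have hr : k - Q + (Q - q) = k - q := by omega
    have hAnn : ∀ m ω, 0 ≤ 1 - Real.cos (A m ω) := fun m ω => by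
      linarith [Real.cos_le_one (A m ω)]
    have hc := sum_abs_cov_le_of_mixing (P := P) (h.past_le (k - Q)) (h.fut_le (k - q))
      (α := α (Q - q))
      (fun A B hA hB => h.mixing (Q - q) (by omega) (k - Q) A B hA (by rwa [hr])) t
      (f := fun m ω => 1 - Real.cos (A m ω)) (g := Y)
      (fun m => (measurable_const.sub (Real.continuous_cos.measurable.comp
        (h.measurable_partSum m (k - Q)))))
      hYm (a := n * (2 * s)) (b := s ^ 2 * (1 + 2 * q))
      (fun ω => by
        calc _ ≤ ∑ m ∈ t, |A m ω| := Finset.sum_le_sum fun m _ => by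
              rw [abs_of_nonneg (hAnn m ω)]
              exact one_sub_cos_le_abs _
          _ ≤ ((k - Q : ℕ) : ℝ) * (2 * s) := h.sum_abs_partSum_le _ ω
          _ ≤ n * (2 * s) := mul_le_mul_of_nonneg_right
            (by exact_mod_cast (by omega : k - Q ≤ n)) (by positivity))
      hYsum
    have hcosV : ∀ m ∈ t, ∫ ω, (1 - Real.cos (A m ω)) ∂P ≤ V / 2 := by
      intro m hm
      have hsq : BddMeas (fun ω => A m ω ^ 2) := (hAb m).continuous_comp (continuous_pow 2)
      calc ∫ ω, (1 - Real.cos (A m ω)) ∂P ≤ ∫ ω, A m ω ^ 2 / 2 ∂P :=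
            integral_mono (hAc m).integrable (hsq.integrable.div_const 2) fun ω => by
              have := Real.one_sub_sq_div_two_le_cos (x := A m ω)
              dsimp only; linarith
        _ = (∫ ω, A m ω ^ 2 ∂P) / 2 := integral_div _ _
        _ ≤ V / 2 := by linarith [hV m hm (k - Q) (by omega)]
    have hprod : ∑ m ∈ t, (∫ ω, (1 - Real.cos (A m ω)) ∂P) * ∫ ω, Y m ω ∂P
        ≤ V / 2 * (s ^ 2 * (1 + 2 * q)) := by
      calc _ ≤ ∑ m ∈ t, V / 2 * ∫ ω, |Y m ω| ∂P := Finset.sum_le_sum fun m hm => by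
            have h0 : 0 ≤ ∫ ω, (1 - Real.cos (A m ω)) ∂P := integral_nonneg (hAnn m)
            exact (mul_le_mul_of_nonneg_left ((le_abs_self _).trans abs_integral_le_integral_abs)
              h0).trans (mul_le_mul_of_nonneg_right (hcosV m hm)
                (integral_nonneg fun ω => abs_nonneg _))
        _ = V / 2 * ∫ ω, ∑ m ∈ t, |Y m ω| ∂P := by
          rw [← Finset.mul_sum, integral_finsetSum _ fun m _ => (hYb m).abs.integrable]
        _ ≤ V / 2 * (s ^ 2 * (1 + 2 * q)) := by
          refine mul_le_mul_of_nonneg_left ?_ (by positivity)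
          calc _ ≤ ∫ _, s ^ 2 * (1 + 2 * q) ∂P := integral_mono
                (BddMeas.sum t fun m _ => (hYb m).abs).integrable (integrable_const _) hYsum
            _ = _ := by simp
    have hle : ∑ m ∈ t, ∫ ω, (1 - Real.cos (A m ω)) * Y m ω ∂P
        ≤ ∑ m ∈ t, (|∫ ω, (1 - Real.cos (A m ω)) * Y m ω ∂P
            - (∫ ω, (1 - Real.cos (A m ω)) ∂P) * ∫ ω, Y m ω ∂P|
          + (∫ ω, (1 - Real.cos (A m ω)) ∂P) * ∫ ω, Y m ω ∂P) :=
      Finset.sum_le_sum fun m _ => by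
        linarith [le_abs_self (∫ ω, (1 - Real.cos (A m ω)) * Y m ω ∂P
            - (∫ ω, (1 - Real.cos (A m ω)) ∂P) * ∫ ω, Y m ω ∂P)]
    rw [Finset.sum_add_distrib] at hle
    calc _ ≤ _ := hle
      _ ≤ _ := add_le_add hc hprod
      _ = _ := by ring
  have hthird : ∑ m ∈ t, ∫ ω, δ * (x m k ω ^ 2 + |S m ω - B m ω| * |x m k ω|) ∂P ≤
      s ^ 2 * (2 * δ * (1 + q)) := by
    have hδ0 : 0 ≤ δ := by positivity
    rw [← integral_finsetSum _ fun m _ => (hEb m).integrable]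
    calc _ ≤ ∫ _, s ^ 2 * (2 * δ * (1 + q)) ∂P := by
          refine integral_mono (BddMeas.sum t fun m _ => hEb m).integrable
            (integrable_const _) fun ω => ?_
          calc _ ≤ ∑ m ∈ t, δ * (s * (1 + q)) * |x m k ω| := Finset.sum_le_sum fun m _ => by
                have h1 : x m k ω ^ 2 ≤ s * |x m k ω| := by
                  rw [← sq_abs, sq]
                  exact mul_le_mul_of_nonneg_right (h.abs_le m k ω) (abs_nonneg _)
                have h2 := mul_le_mul_of_nonneg_right (hSBabs m ω) (abs_nonneg (x m k ω))
                have h3 : x m k ω ^ 2 + |S m ω - B m ω| * |x m k ω| ≤ s * (1 + q) * |x m k ω| := by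
                  linarith
                exact (mul_le_mul_of_nonneg_left h3 hδ0).trans (le_of_eq (by ring))
            _ = δ * (s * (1 + q)) * ∑ m ∈ t, |x m k ω| := (Finset.mul_sum _ _ _).symm
            _ ≤ δ * (s * (1 + q)) * (2 * s) :=
              mul_le_mul_of_nonneg_left (h.sum_abs_le k ω) (by positivity)
            _ = _ := by ring
      _ = _ := by simp
  rw [← Finset.sum_sub_distrib]
  refine (Finset.sum_le_sum fun m _ => hint m).trans ?_
  rw [Finset.sum_add_distrib, Finset.sum_add_distrib]
  linarith

/-- Bound on the summed test functional of the partial sums. -/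
lemma sum_integral_cosTest_le (h : IsMixingFamily P past fut α t x s) {q Q n : ℕ}
    (hqQ : q < Q) {T V : ℝ} (hT : ∀ k, ∑ i ∈ Finset.range (k - q), α (k - i) ≤ T)
    (hα : ∀ r, 0 ≤ α r) (hV0 : 0 ≤ V)
    (hV : ∀ m ∈ t, ∀ k ≤ n, ∫ ω, partSum x m k ω ^ 2 ∂P ≤ V) {k : ℕ} (hk : k ≤ n) :
    ∑ m ∈ t, ∫ ω, cosTest (partSum x m k ω) ∂P
      ≤ k * (s ^ 2 * (32 * T + 2 * ((Q + 1) * s) * (1 + q)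
        + (1 + 2 * q) * (8 * (n * s) * α (Q - q) + V / 2))) := by
  induction k with
  | zero => simp [partSum, cosTest_zero]
  | succ k ih =>
    have h1 := ih (by omega)
    have h2 := h.sum_integral_cosTest_step_le hqQ hT hα hV0 hV (k := k) (by omega)
    push_cast
    linarith

end IsMixingFamily

/-! ### Uniform deviation bound over disjoint families of small sets -/

lemma sum_range_sub_le_tsum {α : ℕ → ℝ} (hα : ∀ r, 0 ≤ α r) (hs : Summable α) (q k : ℕ) :
    ∑ i ∈ Finset.range (k - q), α (k - i) ≤ ∑' r, α (r + (q + 1)) := by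
  rw [← Finset.sum_range_reflect]
  refine le_trans (le_of_eq (Finset.sum_congr rfl fun j hj => ?_))
    (((summable_nat_add_iff (q + 1)).mpr hs).sum_le_tsum (Finset.range (k - q)) fun _ _ => hα _)
  have := Finset.mem_range.mp hj
  congr 1
  omega

/-- The centered, scaled indicators of a disjoint family of sets along a mixing stationary
sequence form a mixing family. -/
lemma isMixingFamily_indicator {E ι : Type*} [MeasurableSpace E] [mΩ : MeasurableSpace Ω]
    {P : Measure Ω} [IsProbabilityMeasure P] {past fut : ℕ → MeasurableSpace Ω} {α : ℕ → ℝ}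
    (past_le : ∀ p, past p ≤ mΩ) (fut_le : ∀ p, fut p ≤ mΩ) (past_mono : Monotone past)
    (fut_anti : Antitone fut)
    (mixing : ∀ r, 1 ≤ r → ∀ p A B, MeasurableSet[past p] A → MeasurableSet[fut (p + r)] B →
      |P.real (A ∩ B) - P.real A * P.real B| ≤ α r)
    {Z : ℕ → Ω → E} (hZp : ∀ i, Measurable[past i] (Z i)) (hZf : ∀ i, Measurable[fut i] (Z i))
    {t : Finset ι} {D : ι → Set E} (hD : ∀ m, MeasurableSet (D m))
    (hdisj : (t : Set ι).PairwiseDisjoint D) {p : ι → ℝ}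
    (hp : ∀ m i, P.real (Z i ⁻¹' D m) = p m) {s : ℝ} (hs : 0 ≤ s) :
    IsMixingFamily P past fut α t (fun m i ω => s * ((D m).indicator 1 (Z i ω) - p m)) s := by
  have hZ : ∀ i, Measurable (Z i) := fun i => (hZp i).mono (past_le i) le_rfl
  have hp0 : ∀ m, 0 ≤ p m := fun m => by rw [← hp m 0]; exact measureReal_nonneg
  have hp1 : ∀ m, p m ≤ 1 := fun m => by rw [← hp m 0]; exact measureReal_le_one
  have hind : ∀ m, Measurable ((D m).indicator (1 : E → ℝ)) := fun m =>
    measurable_const.indicator (hD m)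
  have hi0 : ∀ m e, 0 ≤ (D m).indicator (1 : E → ℝ) e := fun m e =>
    indicator_nonneg (fun _ _ => zero_le_one) e
  have hi1 : ∀ m e, (D m).indicator (1 : E → ℝ) e ≤ 1 := fun m e =>
    indicator_le_self' (f := (1 : E → ℝ)) (fun _ _ => zero_le_one) e
  have hsum : ∀ e, ∑ m ∈ t, (D m).indicator (1 : E → ℝ) e ≤ 1 := by
    intro e
    rw [← Finset.indicator_biUnion_apply t D (f := (1 : E → ℝ)) hdisj]
    exact indicator_le_self' (f := (1 : E → ℝ)) (fun _ _ => zero_le_one) e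
  have hint : ∀ m i, ∫ ω, (D m).indicator (1 : E → ℝ) (Z i ω) ∂P = p m := by
    intro m i
    rw [← hp m i, ← integral_indicator_one (hZ i (hD m))]
    rfl
  have hii : ∀ m i, Integrable (fun ω => (D m).indicator (1 : E → ℝ) (Z i ω)) P := fun m i =>
    integrable_of_abs_le ((hind m).comp (hZ i)) (a := 1) fun ω => by
      rw [abs_of_nonneg (hi0 m _)]; exact hi1 m _
  have hpsum : ∑ m ∈ t, p m ≤ 1 := by
    simp_rw [← fun m => hint m 0]
    rw [← integral_finsetSum _ fun m _ => hii m 0]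
    calc _ ≤ ∫ _, (1 : ℝ) ∂P := integral_mono (integrable_finsetSum _ fun m _ => hii m 0)
          (integrable_const _) fun ω => hsum _
      _ = 1 := by simp
  refine ⟨past_le, fut_le, past_mono, fut_anti, mixing, fun m i => ?_, fun m i => ?_,
    fun m i ω => ?_, fun i ω => ?_, fun m i => ?_⟩
  · exact (((hind m).comp (hZp i)).sub_const _).const_mul _
  · exact (((hind m).comp (hZf i)).sub_const _).const_mul _
  · rw [abs_mul, abs_of_nonneg hs]
    refine mul_le_of_le_one_right hs (abs_le.mpr ⟨?_, ?_⟩)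
    · linarith [hi0 m (Z i ω), hp1 m]
    · linarith [hi1 m (Z i ω), hp0 m]
  · calc _ ≤ ∑ m ∈ t, s * ((D m).indicator (1 : E → ℝ) (Z i ω) + p m) :=
          Finset.sum_le_sum fun m _ => by
            rw [abs_mul, abs_of_nonneg hs]
            refine mul_le_mul_of_nonneg_left (abs_le.mpr ⟨?_, ?_⟩) hs
            · linarith [hi0 m (Z i ω)]
            · linarith [hp0 m]
      _ = s * (∑ m ∈ t, (D m).indicator (1 : E → ℝ) (Z i ω) + ∑ m ∈ t, p m) := by
          rw [← Finset.mul_sum, Finset.sum_add_distrib]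
      _ ≤ s * 2 := mul_le_mul_of_nonneg_left (by linarith [hsum (Z i ω)]) hs
      _ = 2 * s := mul_comm _ _
  · rw [integral_const_mul, integral_sub (hii m i) (integrable_const _), hint]
    simp

/-- Under summable mixing coefficients with `r α_r → 0`, the deviation probabilities of empirical
counts, summed over a disjoint family of sets of small probability, are uniformly small. -/
lemma exists_sum_deviation_le {E : Type*} [MeasurableSpace E] [mΩ : MeasurableSpace Ω]
    {P : Measure Ω} [IsProbabilityMeasure P] {past fut : ℕ → MeasurableSpace Ω} {α : ℕ → ℝ}
    (past_le : ∀ p, past p ≤ mΩ) (fut_le : ∀ p, fut p ≤ mΩ) (past_mono : Monotone past)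
    (fut_anti : Antitone fut)
    (mixing : ∀ r, 1 ≤ r → ∀ p A B, MeasurableSet[past p] A → MeasurableSet[fut (p + r)] B →
      |P.real (A ∩ B) - P.real A * P.real B| ≤ α r)
    (hα : ∀ r, 0 ≤ α r) (hαs : Summable α)
    (hαr : Tendsto (fun r : ℕ => (r : ℝ) * α r) atTop (nhds 0))
    {Z : ℕ → Ω → E} (hZp : ∀ i, Measurable[past i] (Z i)) (hZf : ∀ i, Measurable[fut i] (Z i))
    {η μ : ℝ} (hη : 0 < η) (hμ : 0 < μ) :
    ∃ p₀ > 0, ∀ᶠ n : ℕ in atTop, ∀ k ≤ n, ∀ (t : Finset ℕ) (D : ℕ → Set E) (p : ℕ → ℝ),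
      (∀ m, MeasurableSet (D m)) → (t : Set ℕ).PairwiseDisjoint D →
      (∀ m i, P.real (Z i ⁻¹' D m) = p m) → (∀ m ∈ t, p m ≤ p₀) →
      ∑ m ∈ t, P.real {ω | η * √n ≤ |∑ i ∈ Finset.range k, ((D m).indicator 1 (Z i ω) - p m)|}
        ≤ μ := by
  set ν := μ * cosTest η with hν
  have hcη := cosTest_pos hη
  have hν0 : 0 < ν := mul_pos hμ hcη
  set T : ℕ → ℝ := fun q => ∑' r, α (r + (q + 1)) with hTdef
  have hT0 : ∀ q, 0 ≤ T q := fun q => tsum_nonneg fun _ => hα _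
  have hTlim : Tendsto T atTop (nhds 0) :=
    (tendsto_sum_nat_add α).comp (tendsto_add_atTop_nat 1)
  have hTle := sum_range_sub_le_tsum hα hαs
  obtain ⟨q, hq⟩ : ∃ q, 32 * T q < ν / 4 := by
    have h : Tendsto (fun q => 32 * T q) atTop (nhds 0) := by simpa using hTlim.const_mul 32
    exact (h.eventually_lt_const (by positivity)).exists
  obtain ⟨R, hR⟩ : ∃ R, (1 + 2 * q) * (4 * T R) < ν / 8 := by
    have h : Tendsto (fun R => (1 + 2 * (q:ℝ)) * (4 * T R)) atTop (nhds 0) := by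
      simpa using (hTlim.const_mul 4).const_mul (1 + 2 * (q:ℝ))
    exact (h.eventually_lt_const (by positivity)).exists
  set p₀ : ℝ := ν / (8 * (1 + 2 * q) * (2 * R + 1)) with hp₀
  set γ : ℝ := ν / (16 * (1 + q)) with hγ
  have hγ0 : 0 < γ := by positivity
  have hp₀0 : 0 < p₀ := by positivity
  have hsqrt : Tendsto (fun n : ℕ => √(n : ℝ)) atTop atTop :=
    Real.tendsto_sqrt_atTop.comp tendsto_natCast_atTop_atTop
  have hceil : Tendsto (fun n : ℕ => ⌈γ * √(n : ℝ)⌉₊) atTop atTop :=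
    tendsto_nat_ceil_atTop.comp (hsqrt.const_mul_atTop hγ0)
  have hev1 : ∀ᶠ n : ℕ in atTop, 8 * (1 + 2 * (q:ℝ)) / γ *
      ((⌈γ * √(n : ℝ)⌉₊ : ℝ) * α ⌈γ * √(n : ℝ)⌉₊) < ν / 4 := by
    have h := (hαr.comp hceil).const_mul (8 * (1 + 2 * (q:ℝ)) / γ)
    rw [mul_zero] at h
    exact h.eventually_lt_const (by positivity)
  have hev2 : ∀ᶠ n : ℕ in atTop, 2 * ((q:ℝ) + 2) * (1 + q) / √(n:ℝ) < ν / 8 :=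
    (hsqrt.const_div_atTop _).eventually_lt_const (by positivity)
  refine ⟨p₀, hp₀0, ?_⟩
  filter_upwards [hev1, hev2, eventually_gt_atTop 0] with n hn1 hn2 hn0 k hkn t D p hD hdisj hp hpp
  have hn0' : (0:ℝ) < n := by exact_mod_cast hn0
  set s : ℝ := (√n)⁻¹ with hs
  have hsq : 0 < √(n:ℝ) := Real.sqrt_pos.mpr hn0'
  have hs0 : 0 < s := inv_pos.mpr hsq
  have hns : (n:ℝ) * s = √n := by
    rw [hs]; nth_rewrite 1 [← Real.mul_self_sqrt hn0'.le]; field_simp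
  have hns2 : (n:ℝ) * s ^ 2 = 1 := by
    rw [sq, ← mul_assoc, hns, hs, mul_inv_cancel₀ hsq.ne']
  have hfam := isMixingFamily_indicator past_le fut_le past_mono fut_anti mixing hZp hZf hD hdisj
    hp hs0.le
  set x : ℕ → ℕ → Ω → ℝ := fun m i ω => s * ((D m).indicator 1 (Z i ω) - p m) with hx
  set g : ℕ := ⌈γ * √(n : ℝ)⌉₊ with hg
  have hg1 : γ * √n ≤ g := Nat.le_ceil _
  have hg2 : (g:ℝ) ≤ γ * √n + 1 := (Nat.ceil_lt_add_one (by positivity)).le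
  have hgpos : 0 < g := Nat.ceil_pos.mpr (by positivity)
  set V : ℝ := 2 * (R * (2 * p₀) + 4 * T R) + 2 * p₀ with hV
  have hV0 : 0 ≤ V := by have := hT0 R; positivity
  have hw : ∀ m ∈ t, ∀ i, ∫ ω, |x m i ω| ∂P ≤ s * (2 * p₀) := by
    intro m hm i
    have hZ : Measurable (Z i) := (hZp i).mono (past_le i) le_rfl
    have hpm : 0 ≤ p m := by rw [← hp m 0]; exact measureReal_nonneg
    have hi : Integrable (((Z i) ⁻¹' (D m)).indicator (1 : Ω → ℝ)) P :=
      (integrable_const (1:ℝ)).indicator (hZ (hD m))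
    calc ∫ ω, |x m i ω| ∂P ≤ ∫ ω, s * (((Z i) ⁻¹' (D m)).indicator (1 : Ω → ℝ) ω + p m) ∂P := by
          refine integral_mono (hfam.bddMeas m i).abs.integrable
            ((hi.add (integrable_const _)).const_mul s) fun ω => ?_
          simp only [hx, abs_mul, abs_of_pos hs0]
          refine mul_le_mul_of_nonneg_left ?_ hs0.le
          have h0 : 0 ≤ (D m).indicator (1 : E → ℝ) (Z i ω) :=
            indicator_nonneg (fun _ _ => zero_le_one) _
          refine (abs_sub _ _).trans (le_of_eq ?_)
          rw [abs_of_nonneg h0, abs_of_nonneg hpm]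
          rfl
      _ = s * (p m + p m) := by
          rw [integral_const_mul, integral_add hi (integrable_const _),
            integral_indicator_one (hZ (hD m)), hp]
          simp
      _ ≤ s * (2 * p₀) := mul_le_mul_of_nonneg_left (by linarith [hpp m hm]) hs0.le
  have hvar : ∀ m ∈ t, ∀ k ≤ n, ∫ ω, partSum x m k ω ^ 2 ∂P ≤ V := by
    intro m hm k hk
    refine (hfam.integral_partSum_sq_le (hTle R) (hw m hm) k).trans ?_
    rw [← mul_assoc]
    refine mul_le_of_le_one_left hV0 ?_
    rw [← hns2]
    exact mul_le_mul_of_nonneg_right (by exact_mod_cast hk) (by positivity)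
  have hmain := hfam.sum_integral_cosTest_le (q := q) (Q := q + g) (n := n) (by omega) (hTle q)
    hα hV0 hvar hkn
  rw [add_tsub_cancel_left, hns] at hmain
  have hmarkov : ∀ m, P.real {ω | η * √n ≤
      |∑ i ∈ Finset.range k, ((D m).indicator 1 (Z i ω) - p m)|}
      ≤ (∫ ω, cosTest (partSum x m k ω) ∂P) / cosTest η := by
    intro m
    rw [le_div_iff₀' hcη]
    have hb := (hfam.bddMeas_partSum m k).continuous_comp continuous_cosTest
    refine le_trans ?_ (mul_meas_ge_le_integral_of_nonneg
      (Eventually.of_forall fun ω => cosTest_nonneg _) (hb.integrable (P := P)) (cosTest η))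
    refine mul_le_mul_of_nonneg_left (measureReal_mono fun ω hω => ?_) hcη.le
    refine cosTest_mono_abs hη.le ?_
    have e : partSum x m k ω = s * ∑ i ∈ Finset.range k, ((D m).indicator 1 (Z i ω) - p m) :=
      (Finset.mul_sum _ _ _).symm
    rw [e, abs_mul, abs_of_pos hs0, hs, inv_mul_eq_div, le_div_iff₀ hsq]
    exact hω
  refine (Finset.sum_le_sum fun m _ => hmarkov m).trans ?_
  rw [← Finset.sum_div, div_le_iff₀ hcη]
  refine hmain.trans ?_
  rw [← mul_assoc]
  have hb1 : 2 * (((q + g : ℕ) : ℝ) + 1) * s * (1 + q) ≤ ν / 4 := by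
    have h1 : ((q + g : ℕ) : ℝ) + 1 ≤ (q + 2) + γ * √n := by push_cast; linarith
    have h2 : γ * √n * s = γ := by rw [mul_assoc, hs, mul_inv_cancel₀ hsq.ne', mul_one]
    have h3 : 2 * γ * (1 + q) = ν / 8 := by rw [hγ]; field_simp; ring
    calc 2 * (((q + g : ℕ) : ℝ) + 1) * s * (1 + q)
        ≤ 2 * ((q + 2) + γ * √n) * s * (1 + q) := by gcongr
      _ = 2 * ((q:ℝ) + 2) * (1 + q) / √n + 2 * (γ * √n * s) * (1 + q) := by
          rw [div_eq_mul_inv, ← hs]; ring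
      _ ≤ ν / 4 := by rw [h2, h3]; linarith
  have hb2 : (1 + 2 * (q:ℝ)) * (8 * √n * α g) ≤ ν / 4 := by
    refine le_trans ?_ hn1.le
    have : √(n:ℝ) ≤ g / γ := by rw [le_div_iff₀' hγ0]; exact hg1
    calc (1 + 2 * (q:ℝ)) * (8 * √n * α g) ≤ (1 + 2 * (q:ℝ)) * (8 * (g / γ) * α g) := by
          have := hα g
          gcongr
      _ = _ := by ring
  have hb3 : (1 + 2 * (q:ℝ)) * (V / 2) ≤ ν / 4 := by
    have : (1 + 2 * (q:ℝ)) * ((2 * R + 1) * p₀) = ν / 8 := by rw [hp₀]; field_simp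
    rw [hV]
    linarith
  have htot : 32 * T q + 2 * ((((q + g : ℕ) : ℝ) + 1) * s) * (1 + q)
      + (1 + 2 * q) * (8 * √n * α g + V / 2) ≤ ν := by linarith
  have hks : (k:ℝ) * s ^ 2 ≤ 1 := by
    rw [← hns2]
    exact mul_le_mul_of_nonneg_right (by exact_mod_cast hkn) (by positivity)
  refine (mul_le_mul_of_nonneg_left htot (by positivity)).trans ?_
  exact mul_le_of_le_one_left hν0.le hks

/-! ### Deterministic comparison of ranks and slab counts -/

lemma sum_hit_le {g : ℕ → ℝ} (hg : Monotone g) {s a b : ℝ} {K : ℕ} (hab : a ≤ b)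
    (hs : ∀ m < K, g (m + 1) - g m ≤ s) (hs0 : 0 ≤ s) :
    ∑ m ∈ (Finset.range K).filter (fun m => a < g (m + 1) ∧ g m ≤ b), (g (m + 1) - g m)
      ≤ b - a + 2 * s := by
  classical
  set φ : ℝ → ℝ := fun x => max (a - s) (min x (b + s)) with hφ
  have hφm : Monotone φ := fun x y hxy => max_le_max le_rfl (min_le_min hxy le_rfl)
  calc _ ≤ ∑ m ∈ (Finset.range K).filter (fun m => a < g (m + 1) ∧ g m ≤ b),
        (φ (g (m + 1)) - φ (g m)) := by
        refine Finset.sum_le_sum fun m hm => ?_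
        simp only [Finset.mem_filter, Finset.mem_range] at hm
        have h1 := hs m hm.1
        have h2 := hg (Nat.le_succ m)
        simp only [Nat.succ_eq_add_one] at h2
        simp only [hφ]
        rw [min_eq_left (by linarith), min_eq_left (by linarith), max_eq_right (by linarith),
          max_eq_right (by linarith)]
    _ ≤ ∑ m ∈ Finset.range K, (φ (g (m + 1)) - φ (g m)) :=
        Finset.sum_le_sum_of_subset_of_nonneg (Finset.filter_subset _ _) fun m _ _ =>
          sub_nonneg.2 (hφm (hg (Nat.le_succ m)))
    _ = φ (g K) - φ (g 0) := Finset.sum_range_sub (fun m => φ (g m)) K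
    _ ≤ b - a + 2 * s := by
        have h1 : φ (g K) ≤ b + s := max_le (by linarith) (min_le_right _ _)
        have h2 : a - s ≤ φ (g 0) := le_max_left _ _
        linarith

lemma le_sum_inside {g : ℕ → ℝ} (hg : Monotone g) {s a b : ℝ} {K : ℕ}
    (hs : ∀ m < K, g (m + 1) - g m ≤ s) (ha : g 0 ≤ a) (hb : b ≤ g K) (hs0 : 0 ≤ s) :
    b - a - 2 * s ≤
      ∑ m ∈ (Finset.range K).filter (fun m => a < g m ∧ g (m + 1) ≤ b), (g (m + 1) - g m) := by
  classical
  have hnn : ∀ m, 0 ≤ g (m + 1) - g m := fun m => sub_nonneg.2 (hg (Nat.le_succ m))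
  rcases le_or_gt (b - s) (a + s) with h | h
  · exact le_trans (by linarith) (Finset.sum_nonneg fun m _ => hnn m)
  set φ : ℝ → ℝ := fun x => max (a + s) (min x (b - s)) with hφ
  calc b - a - 2 * s = φ (g K) - φ (g 0) := by
        simp only [hφ]
        rw [min_eq_right (by linarith), min_eq_left (by linarith), max_eq_right (by linarith),
          max_eq_left (by linarith)]
        ring
    _ = ∑ m ∈ Finset.range K, (φ (g (m + 1)) - φ (g m)) :=
        (Finset.sum_range_sub (fun m => φ (g m)) K).symm
    _ ≤ _ := by
        rw [Finset.sum_filter]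
        refine Finset.sum_le_sum fun m hm => ?_
        have h1 := hs m (Finset.mem_range.1 hm)
        have h2 := hnn m
        simp only [hφ]
        split_ifs with hc
        · simp only [max_def, min_def]
          split_ifs <;> linarith
        · rw [not_and_or, not_lt, not_le] at hc
          simp only [max_def, min_def]
          rcases hc with hc | hc <;> split_ifs <;> linarith

/-- Number of `i ∈ I` with `s i < m`. -/
def cumCount (I : Finset ℕ) (s : ℕ → ℕ) (m : ℕ) : ℝ := ((I.filter fun i => s i < m).card : ℝ)

lemma cumCount_succ (I : Finset ℕ) (s : ℕ → ℕ) (m : ℕ) :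
    cumCount I s (m + 1) - cumCount I s m = ((I.filter fun i => s i = m).card : ℝ) := by
  unfold cumCount
  rw [sub_eq_iff_eq_add', ← Nat.cast_add, ← Finset.card_union_of_disjoint]
  · congr 2
    ext i
    simp only [Finset.mem_filter, Finset.mem_union]
    grind
  · rw [Finset.disjoint_filter]
    intro i _ h
    omega

lemma cumCount_zero (I : Finset ℕ) (s : ℕ → ℕ) : cumCount I s 0 = 0 := by simp [cumCount]

lemma cumCount_mono (I : Finset ℕ) (s : ℕ → ℕ) : Monotone (cumCount I s) := by
  intro a b hab
  exact Nat.cast_le.2 (Finset.card_le_card fun i hi => by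
    simp only [Finset.mem_filter] at hi ⊢
    exact ⟨hi.1, hi.2.trans_le hab⟩)

lemma abs_cumCount_sub_le {I : Finset ℕ} {s : ℕ → ℕ} {M : ℕ} (hM : 0 < M) {κ : ℝ}
    (hs : ∀ m ≤ M,
      |((I.filter fun i => s i = m).card : ℝ) - (if m = 0 then 0 else (I.card : ℝ) / M)|
      ≤ κ * (I.card / M)) {m : ℕ} (hm : m ≤ M) :
    |cumCount I s (m + 1) - I.card * (m / M)| ≤ 2 * κ * I.card := by
  have hM' : (0 : ℝ) < M := Nat.cast_pos.2 hM
  have hκ : 0 ≤ κ * (I.card / M) := (abs_nonneg _).trans (hs 0 (Nat.zero_le _))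
  have key : ∀ m ≤ M, |cumCount I s (m + 1) - I.card * (m / M)| ≤ (m + 1) * (κ * (I.card / M)) := by
    intro m
    induction m with
    | zero =>
      intro h
      have := hs 0 h
      have h0 := cumCount_succ I s 0
      rw [cumCount_zero, sub_zero] at h0
      simp only [if_true, ← h0] at this
      simpa using this
    | succ m ih =>
      intro h
      have h1 := ih (by omega)
      have h2 := hs (m + 1) h
      rw [← cumCount_succ, if_neg (Nat.succ_ne_zero m)] at h2
      have : cumCount I s (m + 1 + 1) - I.card * ((m + 1 : ℕ) / M)
          = (cumCount I s (m + 1) - I.card * (m / M))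
            + (cumCount I s (m + 1 + 1) - cumCount I s (m + 1) - I.card / M) := by
        push_cast; field_simp; ring
      rw [this]
      refine (abs_add_le _ _).trans ((add_le_add h1 h2).trans_eq ?_)
      push_cast; ring
  refine (key m hm).trans ?_
  have h3 : (m : ℝ) + 1 ≤ 2 * M := by
    have : m + 1 ≤ 2 * M := by omega
    exact_mod_cast this
  calc ((m : ℝ) + 1) * (κ * (I.card / M)) ≤ 2 * M * (κ * (I.card / M)) := by gcongr
    _ = 2 * κ * I.card := by field_simp

/-- Index `m` of the slab `((m - 1) / M, m / M]` that contains `t`. -/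
def slab (M : ℕ) (t : ℝ) : ℕ := ⌈(M : ℝ) * t⌉₊

lemma slab_mono (M : ℕ) : Monotone (slab M) := fun _ _ h =>
  Nat.ceil_mono (mul_le_mul_of_nonneg_left h (Nat.cast_nonneg M))

lemma slab_le {M : ℕ} {t : ℝ} (ht : t ≤ 1) : slab M t ≤ M :=
  Nat.ceil_le.2 (mul_le_of_le_one_right (Nat.cast_nonneg M) ht)

lemma slab_le_iff {M : ℕ} (hM : 0 < M) {t : ℝ} {m : ℕ} : slab M t ≤ m ↔ t ≤ m / M := by
  rw [slab, Nat.ceil_le, le_div_iff₀ (Nat.cast_pos.2 hM), mul_comm]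

lemma le_slab_div {M : ℕ} (hM : 0 < M) (t : ℝ) : t ≤ slab M t / M := (slab_le_iff hM).1 le_rfl

lemma slab_sub_one_div_le {M : ℕ} (hM : 0 < M) {t : ℝ} (ht : 0 ≤ t) :
    ((slab M t : ℝ) - 1) / M ≤ t := by
  rw [div_le_iff₀ (Nat.cast_pos.2 hM)]
  have := Nat.ceil_lt_add_one (mul_nonneg (Nat.cast_nonneg (α := ℝ) M) ht)
  unfold slab
  linarith [mul_comm t (M : ℝ)]

lemma cumCount_le_rank {I : Finset ℕ} {M : ℕ} {f : ℝ → ℝ} (hf : Monotone f) (y : ℕ → ℝ) (i : ℕ) :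
    cumCount I (fun t => slab M (f (y t))) (slab M (f (y i)))
      ≤ ((I.filter fun t => y t ≤ y i).card : ℝ) :=
  Nat.cast_le.2 (Finset.card_le_card fun t ht => by
    simp only [Finset.mem_filter] at ht ⊢
    refine ⟨ht.1, le_of_not_gt fun h => ?_⟩
    exact absurd (slab_mono M (hf h.le)) (not_le.2 ht.2))

lemma rank_le_cumCount {I : Finset ℕ} {M : ℕ} {f : ℝ → ℝ} (hf : Monotone f) (y : ℕ → ℝ) (i : ℕ) :
    ((I.filter fun t => y t ≤ y i).card : ℝ)
      ≤ cumCount I (fun t => slab M (f (y t))) (slab M (f (y i)) + 1) :=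
  Nat.cast_le.2 (Finset.card_le_card fun t ht => by
    simp only [Finset.mem_filter] at ht ⊢
    exact ⟨ht.1, Nat.lt_succ_of_le (slab_mono M (hf ht.2))⟩)

lemma abs_rank_sub_le {I : Finset ℕ} (hI : I.Nonempty) {M : ℕ} (hM : 0 < M) {κ : ℝ} {f : ℝ → ℝ}
    (hf : Monotone f) (hf0 : ∀ t, 0 ≤ f t) (hf1 : ∀ t, f t ≤ 1) (y : ℕ → ℝ)
    (hs : ∀ m ≤ M, |((I.filter fun i => slab M (f (y i)) = m).card : ℝ)
      - (if m = 0 then 0 else (I.card : ℝ) / M)| ≤ κ * (I.card / M)) (i : ℕ) :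
    |((I.filter fun t => y t ≤ y i).card : ℝ) / I.card - f (y i)| ≤ 1 / M + 2 * κ := by
  have hN : (0 : ℝ) < I.card := Nat.cast_pos.2 hI.card_pos
  have hM' : (0 : ℝ) < M := Nat.cast_pos.2 hM
  have hκ : 0 ≤ κ := by
    have := (abs_nonneg _).trans (hs 0 (Nat.zero_le _))
    have h2 : 0 < (I.card : ℝ) / M := by positivity
    exact nonneg_of_mul_nonneg_left this h2
  have hle := slab_le (M := M) (hf1 (y i))
  have h1 := slab_sub_one_div_le hM (hf0 (y i))
  have h2 := le_slab_div hM (f (y i))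
  have h3 := cumCount_le_rank (I := I) (M := M) hf y i
  have h4 := rank_le_cumCount (I := I) (M := M) hf y i
  generalize hm : slab M (f (y i)) = m at *
  have h5 := abs_le.1 (abs_cumCount_sub_le (s := fun t => slab M (f (y t))) hM hs hle)
  rw [abs_le]
  constructor
  · rw [le_sub_iff_add_le, le_div_iff₀ hN]
    rcases Nat.eq_zero_or_pos m with rfl | hm0
    · have : f (y i) ≤ 0 := by simpa using h2
      have h6 : 0 ≤ 1 / (M : ℝ) := by positivity
      have : (-(1 / (M : ℝ) + 2 * κ) + f (y i)) * I.card ≤ 0 :=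
        mul_nonpos_of_nonpos_of_nonneg (by linarith) hN.le
      exact this.trans (Nat.cast_nonneg _)
    · obtain ⟨m, rfl⟩ := Nat.exists_eq_succ_of_ne_zero hm0.ne'
      have h6 := abs_le.1 (abs_cumCount_sub_le (s := fun t => slab M (f (y t))) hM hs
        (show m ≤ M by omega))
      have h7 : f (y i) - 1 / M ≤ m / M := by
        have : ((m.succ : ℕ) : ℝ) / M = m / M + 1 / M := by push_cast; ring
        linarith
      have h8 := mul_le_mul_of_nonneg_right h7 hN.le
      simp only [Nat.succ_eq_add_one] at h3
      linarith [h6.1]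
  · rw [sub_le_iff_le_add, div_le_iff₀ hN]
    have h7 : (m : ℝ) / M ≤ f (y i) + 1 / M := by
      have : ((m : ℝ) - 1) / M = m / M - 1 / M := by ring
      linarith
    have h8 := mul_le_mul_of_nonneg_right h7 hN.le
    linarith [h5.2]

lemma abs_sub_le_of_slab_bounds {q p r τ w D H : ℝ} (hτ0 : 0 ≤ τ) (hτ : τ ≤ 1 / 4) (hD0 : 0 ≤ D)
    (hD1 : D ≤ 1) (hH : 0 < H) (hwH : 2 * w ≤ τ * H) (hq : 0 ≤ q)
    (hup : q ≤ p * (w * (D + 2 * τ))) (hlow : r * (w * (D - 2 * τ)) ≤ q)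
    (hp' : p * ((1 - τ) * w) ≤ H + 2 * ((1 + τ) * w))
    (hr' : H - 2 * ((1 + τ) * w) ≤ r * ((1 + τ) * w)) :
    |q - H * D| ≤ 8 * τ * H := by
  have hτ2 : τ ^ 2 ≤ τ * (1 / 4) := by rw [sq]; gcongr
  have hw2 : 2 * ((1 + τ) * w) ≤ (1 + τ) * (τ * H) := by
    rw [← mul_assoc, mul_comm 2, mul_assoc]; gcongr
  have hp1 : p * w ≤ (1 + 4 * τ) * H := by
    have h1 : p * w * (1 - τ) ≤ H * (1 + (1 + τ) * τ) := by linarith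
    have h2 : H * (1 + (1 + τ) * τ) ≤ H * ((1 + 4 * τ) * (1 - τ)) := by
      gcongr; nlinarith
    exact le_of_mul_le_mul_right (by linarith : p * w * (1 - τ) ≤ (1 + 4 * τ) * H * (1 - τ))
      (by linarith)
  have hr1 : (1 - 3 * τ) * H ≤ r * w := by
    have h1 : H * (1 - (1 + τ) * τ) ≤ r * w * (1 + τ) := by linarith
    have h2 : H * ((1 - 3 * τ) * (1 + τ)) ≤ H * (1 - (1 + τ) * τ) := by
      gcongr; nlinarith
    exact le_of_mul_le_mul_right (by linarith : (1 - 3 * τ) * H * (1 + τ) ≤ r * w * (1 + τ))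
      (by linarith)
  have hτD : τ * D ≤ τ * 1 := by gcongr
  rw [abs_le]
  constructor
  · rcases le_or_gt (D - 2 * τ) 0 with hneg | hpos
    · have : H * (D - 8 * τ) ≤ 0 := mul_nonpos_of_nonneg_of_nonpos hH.le (by linarith)
      linarith
    · have h2 : (1 - 3 * τ) * H * (D - 2 * τ) ≤ r * w * (D - 2 * τ) :=
        mul_le_mul_of_nonneg_right hr1 hpos.le
      have h3 : H * (D - 8 * τ) ≤ H * ((1 - 3 * τ) * (D - 2 * τ)) := by
        gcongr; nlinarith
      linarith
  · have h2 : p * w * (D + 2 * τ) ≤ (1 + 4 * τ) * H * (D + 2 * τ) :=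
      mul_le_mul_of_nonneg_right hp1 (by linarith)
    have h3 : H * ((1 + 4 * τ) * (D + 2 * τ)) ≤ H * (D + 8 * τ) := by
      gcongr; nlinarith
    linarith

/-- Ranks are counted through slabs: if the slab counts are close to their expected values, then so
is the number of pseudo-observations in a thin box. -/
lemma abs_card_box_sub_le {d : ℕ} (j : Fin d) {I : Finset ℕ} (hI : I.Nonempty) {M : ℕ} (hM : 0 < M)
    {F : Fin d → ℝ → ℝ} (hF : ∀ v, Monotone (F v)) (hF0 : ∀ v t, 0 ≤ F v t)
    (hF1 : ∀ v t, F v t ≤ 1) (x : ℕ → Fin d → ℝ) {κ τ h ρ D : ℝ} {u cp cm : Fin d → ℝ}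
    (hκτ : κ ≤ τ) (hτ : τ ≤ 1 / 4) (hh : 0 < h) (hMh : 1 ≤ τ * (M * h))
    (hD0 : 0 ≤ D) (hD1 : D ≤ 1)
    (hρ : h + 1 / M + 2 * κ ≤ ρ) (hρu : ρ < u j) (hu1 : u j + h ≤ 1)
    (hcp : ∀ k, u k + (1 / M + 2 * κ) ≤ cp k) (hcm : ∀ k, cm k + (1 / M + 2 * κ) ≤ u k)
    (hs : ∀ v, ∀ m ≤ M, |((I.filter fun i => slab M (F v (x i v)) = m).card : ℝ)
      - (if m = 0 then 0 else (I.card : ℝ) / M)| ≤ κ * (I.card / M))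
    (hbox : ∀ c, c = cp ∨ c = cm → ∀ m ≤ M, 0 < m → |(m : ℝ) / M - u j| ≤ ρ →
      |((I.filter fun i => slab M (F j (x i j)) = m ∧ ∀ k, k ≠ j → F k (x i k) ≤ c k).card : ℝ)
        - I.card / M * D| ≤ 2 * τ * (I.card / M)) :
    |((I.filter fun i => (u j - h < ((I.filter fun t => x t j ≤ x i j).card : ℝ) / I.card ∧
        ((I.filter fun t => x t j ≤ x i j).card : ℝ) / I.card ≤ u j + h) ∧
        ∀ k, k ≠ j → ((I.filter fun t => x t k ≤ x i k).card : ℝ) / I.card ≤ u k).card : ℝ)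
      - 2 * h * I.card * D| ≤ 8 * τ * (2 * h * I.card) := by
  classical
  have hN : (0 : ℝ) < I.card := Nat.cast_pos.2 hI.card_pos
  have hM' : (0 : ℝ) < M := Nat.cast_pos.2 hM
  set N : ℝ := (I.card : ℝ) with hNdef
  set w : ℝ := N / M with hw
  have hw0 : 0 < w := by positivity
  have hκ : 0 ≤ κ := nonneg_of_mul_nonneg_left ((abs_nonneg _).trans (hs j 0 (Nat.zero_le _))) hw0
  set s : ℕ → ℕ := fun i => slab M (F j (x i j)) with hsdef
  set g : ℕ → ℝ := cumCount I s with hg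
  have hgm : Monotone g := cumCount_mono I s
  have hg0 : g 0 = 0 := cumCount_zero I s
  have hgK : g (M + 1) = N := by
    simp only [hg, cumCount, hNdef]
    congr 2
    refine Finset.filter_true_of_mem fun i _ => Nat.lt_succ_of_le (slab_le (hF1 _ _))
  have hcum : ∀ m ≤ M, |g (m + 1) - N * (m / M)| ≤ 2 * κ * N := fun m hm =>
    abs_cumCount_sub_le hM (hs j) hm
  have hstep : ∀ m, g (m + 1) - g m = ((I.filter fun i => s i = m).card : ℝ) :=
    cumCount_succ I s
  have hBd : ∀ m < M + 1, g (m + 1) - g m ≤ (1 + τ) * w := by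
    intro m hm
    have h1 := (abs_le.1 (hs j m (by omega))).2
    rw [hstep]
    have h2 : (if m = 0 then 0 else w) ≤ w := by split_ifs <;> linarith
    have h3 : κ * w ≤ τ * w := by gcongr
    simp only [hsdef]
    linarith
  set Jp := (Finset.range (M + 1)).filter (fun m => N * (u j - h) < g (m + 1) ∧ g m ≤ N * (u j + h))
  set Jm := (Finset.range (M + 1)).filter (fun m => N * (u j - h) < g m ∧ g (m + 1) ≤ N * (u j + h))
  have hτ0 : 0 ≤ τ := hκ.trans hκτ
  have hJpsum := sum_hit_le hgm (a := N * (u j - h)) (b := N * (u j + h)) (by gcongr; linarith) hBd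
    (by positivity)
  have hMinv : 0 < 1 / (M : ℝ) := by positivity
  have hJmsum := le_sum_inside hgm (a := N * (u j - h)) (b := N * (u j + h)) hBd
    (by rw [hg0]; exact mul_nonneg hN.le (by linarith))
    (by rw [hgK]; exact mul_le_of_le_one_right hN.le hu1) (by positivity)
  have hJmp : Jm ⊆ Jp := by
    intro m hm
    simp only [Jm, Jp, Finset.mem_filter] at hm ⊢
    exact ⟨hm.1, hm.2.1.trans_le (hgm (Nat.le_succ m)), (hgm (Nat.le_succ m)).trans hm.2.2⟩
  have hloc : ∀ m ∈ Jp, m ≤ M ∧ 0 < m ∧ |(m : ℝ) / M - u j| ≤ ρ := by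
    intro m hm
    simp only [Jp, Finset.mem_filter, Finset.mem_range] at hm
    have hmM : m ≤ M := by omega
    have h1 := (abs_le.1 (hcum m hmM)).2
    have h2 : u j - h - 2 * κ < m / M := by
      have : N * (u j - h - 2 * κ) < N * (m / M) := by linarith [hm.2.1]
      exact lt_of_mul_lt_mul_left this hN.le
    have hm0 : 0 < m := by
      rcases Nat.eq_zero_or_pos m with rfl | h0
      · simp only [Nat.cast_zero, zero_div] at h2
        linarith
      · exact h0
    obtain ⟨m, rfl⟩ := Nat.exists_eq_succ_of_ne_zero hm0.ne'
    have h3 := (abs_le.1 (hcum m (by omega))).1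
    have h4 : (m : ℝ) / M ≤ u j + h + 2 * κ := by
      have : N * (m / M) ≤ N * (u j + h + 2 * κ) := by
        have := hm.2.2
        simp only [Nat.succ_eq_add_one] at this
        linarith
      exact le_of_mul_le_mul_left this hN
    have h5 : ((m.succ : ℕ) : ℝ) / M = m / M + 1 / M := by push_cast; ring
    exact ⟨hmM, hm0, abs_le.2 ⟨by linarith, by linarith⟩⟩
  have hcnt : ∀ m ∈ Jp, |(g (m + 1) - g m) - w| ≤ τ * w := by
    intro m hm
    have h1 := hs j m (hloc m hm).1
    rw [if_neg (hloc m hm).2.1.ne'] at h1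
    rw [hstep]
    exact h1.trans (by gcongr)
  set Box := I.filter fun i => (u j - h < ((I.filter fun t => x t j ≤ x i j).card : ℝ) / N ∧
        ((I.filter fun t => x t j ≤ x i j).card : ℝ) / N ≤ u j + h) ∧
        ∀ k, k ≠ j → ((I.filter fun t => x t k ≤ x i k).card : ℝ) / N ≤ u k with hBox
  set A : (Fin d → ℝ) → ℕ → Finset ℕ := fun c m =>
    I.filter fun i => slab M (F j (x i j)) = m ∧ ∀ k, k ≠ j → F k (x i k) ≤ c k with hA
  have hrank : ∀ v i, |((I.filter fun t => x t v ≤ x i v).card : ℝ) / N - F v (x i v)|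
      ≤ 1 / M + 2 * κ := fun v i =>
    abs_rank_sub_le hI hM (hF v) (hF0 v) (hF1 v) (fun t => x t v) (hs v) i
  have hlow : ∀ i, g (s i) ≤ ((I.filter fun t => x t j ≤ x i j).card : ℝ) := fun i =>
    cumCount_le_rank (hF j) (fun t => x t j) i
  have hupp : ∀ i, ((I.filter fun t => x t j ≤ x i j).card : ℝ) ≤ g (s i + 1) := fun i =>
    rank_le_cumCount (hF j) (fun t => x t j) i
  have hup : (Box.card : ℝ) ≤ ∑ m ∈ Jp, ((A cp m).card : ℝ) := by
    have hsub : Box ⊆ Jp.biUnion (A cp) := by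
      intro i hi
      simp only [hBox, Finset.mem_filter] at hi
      obtain ⟨hiI, ⟨h1, h2⟩, h3⟩ := hi
      rw [lt_div_iff₀ hN] at h1
      rw [div_le_iff₀ hN] at h2
      simp only [Finset.mem_biUnion, hA, Finset.mem_filter, Jp, Finset.mem_range]
      refine ⟨s i, ⟨Nat.lt_succ_of_le (slab_le (hF1 _ _)), ?_, ?_⟩, hiI, rfl, fun k hk => ?_⟩
      · linarith [hupp i]
      · linarith [hlow i]
      · linarith [(abs_le.1 (hrank k i)).1, h3 k hk, hcp k]
    exact_mod_cast (Finset.card_le_card hsub).trans Finset.card_biUnion_le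
  have hdown : ∑ m ∈ Jm, ((A cm m).card : ℝ) ≤ Box.card := by
    have hsub : Jm.biUnion (A cm) ⊆ Box := by
      intro i hi
      simp only [Finset.mem_biUnion, hA, Finset.mem_filter, Jm, Finset.mem_range] at hi
      obtain ⟨m, ⟨-, h1, h2⟩, hiI, him, h3⟩ := hi
      have h4 := hlow i
      have h5 := hupp i
      simp only [hsdef, him] at h4 h5
      simp only [hBox, Finset.mem_filter]
      refine ⟨hiI, ⟨?_, ?_⟩, fun k hk => ?_⟩
      · rw [lt_div_iff₀ hN]; linarith
      · rw [div_le_iff₀ hN]; linarith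
      · linarith [(abs_le.1 (hrank k i)).2, h3 k hk, hcm k]
    have := Finset.card_le_card hsub
    rw [Finset.card_biUnion] at this
    · exact_mod_cast this
    · intro m _ m' _ hne
      simp only [hA, Function.onFun]
      rw [Finset.disjoint_filter]
      intro i _ h1 h2
      exact hne (h1.1.symm.trans h2.1)
  have hup2 : ∑ m ∈ Jp, ((A cp m).card : ℝ) ≤ Jp.card * (w * (D + 2 * τ)) := by
    rw [← nsmul_eq_mul]
    refine Finset.sum_le_card_nsmul _ _ _ fun m hm => ?_
    obtain ⟨h1, h2, h3⟩ := hloc m hm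
    linarith [(abs_le.1 (hbox cp (Or.inl rfl) m h1 h2 h3)).2]
  have hdown2 : Jm.card * (w * (D - 2 * τ)) ≤ ∑ m ∈ Jm, ((A cm m).card : ℝ) := by
    rw [← nsmul_eq_mul]
    refine Finset.card_nsmul_le_sum _ _ _ fun m hm => ?_
    obtain ⟨h1, h2, h3⟩ := hloc m (hJmp hm)
    linarith [(abs_le.1 (hbox cm (Or.inr rfl) m h1 h2 h3)).1]
  have hJp : Jp.card * ((1 - τ) * w) ≤ 2 * h * N + 2 * ((1 + τ) * w) := by
    have : Jp.card * ((1 - τ) * w) ≤ ∑ m ∈ Jp, (g (m + 1) - g m) := by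
      rw [← nsmul_eq_mul]
      refine Finset.card_nsmul_le_sum _ _ _ fun m hm => ?_
      linarith [(abs_le.1 (hcnt m hm)).1]
    linarith
  have hJm : 2 * h * N - 2 * ((1 + τ) * w) ≤ Jm.card * ((1 + τ) * w) := by
    have : ∑ m ∈ Jm, (g (m + 1) - g m) ≤ Jm.card * ((1 + τ) * w) := by
      rw [← nsmul_eq_mul]
      refine Finset.sum_le_card_nsmul _ _ _ fun m hm => ?_
      linarith [(abs_le.1 (hcnt m (hJmp hm))).2]
    linarith
  have hwh : w ≤ τ * (h * N) := by
    rw [hw, div_le_iff₀ hM']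
    calc N = 1 * N := (one_mul N).symm
      _ ≤ τ * (M * h) * N := by gcongr
      _ = τ * (h * N) * M := by ring
  set H := 2 * h * N with hH
  have hH0 : 0 < H := by positivity
  have hwH : 2 * w ≤ τ * H := by rw [hH]; linarith
  exact abs_sub_le_of_slab_bounds hτ0 hτ hD0 hD1 hH0 hwH (Nat.cast_nonneg _)
    (hup.trans hup2) (hdown2.trans hdown) hJp hJm

lemma card_Icc_cast {k l : ℕ} (hkl : k ≤ l) : ((Finset.Icc k l).card : ℝ) = (l : ℝ) - k + 1 := by
  rw [Nat.card_Icc, Nat.cast_sub (by omega)]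
  push_cast; ring

lemma pdEst_eq {d : ℕ} (X : ℤ → Ω → Fin d → ℝ) (j : Fin d) {k l : ℕ} (hkl : k ≤ l)
    {u : Fin d → ℝ} (h0 : bandwidth k l ≤ u j) (h1 : u j + bandwidth k l ≤ 1)
    (hb : 0 ≤ bandwidth k l) (ω : Ω) :
    pdEst d X j k l u ω =
      (((Finset.Icc k l).filter fun i : ℕ =>
        (u j - bandwidth k l < (((Finset.Icc k l).filter fun t : ℕ => X t ω j ≤ X i ω j).card : ℝ)
            / (Finset.Icc k l).card ∧
          (((Finset.Icc k l).filter fun t : ℕ => X t ω j ≤ X i ω j).card : ℝ)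
            / (Finset.Icc k l).card ≤ u j + bandwidth k l) ∧
        ∀ v, v ≠ j → (((Finset.Icc k l).filter fun t : ℕ => X t ω v ≤ X i ω v).card : ℝ)
            / (Finset.Icc k l).card ≤ u v).card : ℝ)
      / (2 * bandwidth k l * (Finset.Icc k l).card) := by
  classical
  have hN : (0 : ℝ) < (Finset.Icc k l).card := by
    rw [card_Icc_cast hkl]
    have : (k : ℝ) ≤ l := Nat.cast_le.2 hkl
    linarith
  unfold pdEst empCop
  rw [if_pos hkl, if_pos hkl, min_eq_left h1, max_eq_left (by linarith)]
  unfold pseudoObs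
  rw [← card_Icc_cast hkl]
  generalize bandwidth k l = h at *
  set N : ℝ := ((Finset.Icc k l).card : ℝ) with hNdef
  rw [← mul_sub, ← Finset.sum_sub_distrib, Finset.card_filter]
  have key : ∀ i : ℕ, ((if ∀ v, (((Finset.Icc k l).filter fun t : ℕ => X t ω v ≤ X i ω v).card : ℝ)
        / N ≤ Function.update u j (u j + h) v then (1 : ℝ) else 0)
      - if ∀ v, (((Finset.Icc k l).filter fun t : ℕ => X t ω v ≤ X i ω v).card : ℝ)
        / N ≤ Function.update u j (u j - h) v then (1 : ℝ) else 0) =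
      if (u j - h < (((Finset.Icc k l).filter fun t : ℕ => X t ω j ≤ X i ω j).card : ℝ) / N ∧
          (((Finset.Icc k l).filter fun t : ℕ => X t ω j ≤ X i ω j).card : ℝ) / N ≤ u j + h) ∧
        ∀ v, v ≠ j → (((Finset.Icc k l).filter fun t : ℕ => X t ω v ≤ X i ω v).card : ℝ) / N ≤ u v
      then 1 else 0 := by
    intro i
    generalize hr : (fun v => (((Finset.Icc k l).filter fun t : ℕ =>
      X t ω v ≤ X i ω v).card : ℝ) / N) = r
    have hr' : ∀ v, (((Finset.Icc k l).filter fun t : ℕ =>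
      X t ω v ≤ X i ω v).card : ℝ) / N = r v := fun v => congrFun hr v
    simp only [hr']
    have hupd : ∀ y, (∀ v, r v ≤ Function.update u j y v) ↔ r j ≤ y ∧ ∀ v, v ≠ j → r v ≤ u v := by
      intro y
      constructor
      · intro H
        exact ⟨by simpa using H j, fun v hv => by simpa [hv] using H v⟩
      · rintro ⟨H1, H2⟩ v
        by_cases hv : v = j
        · subst hv; simpa using H1
        · simpa [hv] using H2 v hv
    simp only [hupd]
    by_cases H2 : ∀ v, v ≠ j → r v ≤ u v
    · by_cases H3 : r j ≤ u j - h
      · have : r j ≤ u j + h := by linarith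
        simp [H3, this, not_lt.2 H3]
      · by_cases H4 : r j ≤ u j + h
        · simp [H3, H4, not_le.1 H3]
        · simp [H3, H4]
    · simp [H2]
  simp only [key]
  push_cast
  have e : u j + h - (u j - h) = 2 * h := by ring
  rw [e, inv_mul_eq_div, div_div, mul_comm N]

/-! ### Probability integral transform and the copula -/

lemma monotone_of_eq_prob {mΩ : MeasurableSpace Ω} {P : Measure Ω} [IsProbabilityMeasure P]
    {Y : Ω → ℝ} {f : ℝ → ℝ} (hf : ∀ x, f x = P.real {ω | Y ω ≤ x}) : Monotone f := by
  intro x y hxy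
  rw [hf, hf]
  exact measureReal_mono fun ω hω => le_trans hω hxy

lemma prob_integral_transform {mΩ : MeasurableSpace Ω} {P : Measure Ω} [IsProbabilityMeasure P]
    {Y : Ω → ℝ} (hY : Measurable Y) {f : ℝ → ℝ} (hf : ∀ x, f x = P.real {ω | Y ω ≤ x})
    (hfc : Continuous f) (c : ℝ) :
    P.real {ω | f (Y ω) ≤ c} = max 0 (min c 1) := by
  have hmono := monotone_of_eq_prob hf
  have hcdf : f = ProbabilityTheory.cdf (P.map Y) := by
    funext x
    have := Measure.isProbabilityMeasure_map (μ := P) hY.aemeasurable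
    rw [ProbabilityTheory.cdf_eq_real, map_measureReal_apply hY measurableSet_Iic, hf]
    rfl
  have hbot : Tendsto f atBot (nhds 0) := hcdf ▸ ProbabilityTheory.tendsto_cdf_atBot _
  have htop : Tendsto f atTop (nhds 1) := hcdf ▸ ProbabilityTheory.tendsto_cdf_atTop _
  have hsurj : ∀ c, 0 < c → c < 1 → ∃ x, f x = c := by
    intro c h0 h1
    obtain ⟨a, ha⟩ := (hbot.eventually (gt_mem_nhds h0)).exists
    obtain ⟨b, hb⟩ := (htop.eventually (lt_mem_nhds h1)).exists
    exact mem_range_of_exists_le_of_exists_ge hfc ⟨a, ha.le⟩ ⟨b, hb.le⟩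
  have hupper : ∀ c, 0 ≤ c → c < 1 → P.real {ω | f (Y ω) ≤ c} ≤ c := by
    intro c h0 h1
    refine le_of_forall_gt_imp_ge_of_dense fun c' hc' => ?_
    rcases le_or_gt 1 c' with h | h
    · exact measureReal_le_one.trans h
    · obtain ⟨x, hx⟩ := hsurj c' (h0.trans_lt hc') h
      calc _ ≤ P.real {ω | Y ω ≤ x} := measureReal_mono fun ω hω => by
            by_contra hlt
            simp only [mem_ofPred_eq, not_le] at hω hlt
            linarith [hmono hlt.le]
        _ = c' := by rw [← hf, hx]
  have hzero : P.real {ω | f (Y ω) ≤ 0} = 0 :=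
    le_antisymm (hupper 0 le_rfl one_pos) measureReal_nonneg
  rcases le_or_gt c 0 with h0 | h0
  · rw [min_eq_left (by linarith), max_eq_left h0]
    exact le_antisymm ((measureReal_mono fun ω (hω : f (Y ω) ≤ c) => hω.trans h0).trans hzero.le)
      measureReal_nonneg
  rcases le_or_gt 1 c with h1 | h1
  · rw [min_eq_right h1, max_eq_right zero_le_one]
    have : {ω | f (Y ω) ≤ c} = univ := eq_univ_of_forall fun ω => by
      simp only [mem_ofPred_eq, hf]
      exact measureReal_le_one.trans h1
    rw [this, probReal_univ]
  · rw [min_eq_left h1.le, max_eq_right h0.le]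
    refine le_antisymm (hupper c h0.le h1) ?_
    obtain ⟨x, hx⟩ := hsurj c h0 h1
    rw [← hx, hf x]
    exact measureReal_mono fun ω (hω : Y ω ≤ x) => by
      simp only [mem_ofPred_eq, ← hf x]
      exact hmono hω

/-- The points of slab `m` in direction `v` whose other transformed coordinates are at most `c`. -/
def slabSet {d : ℕ} (F : Fin d → ℝ → ℝ) (M : ℕ) (v : Fin d) (c : Fin d → ℝ) (m : ℕ) :
    Set (Fin d → ℝ) :=
  {x | slab M (F v (x v)) = m ∧ ∀ k, k ≠ v → F k (x k) ≤ c k}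

lemma measurableSet_slabSet {d : ℕ} {F : Fin d → ℝ → ℝ} (hF : ∀ v, Continuous (F v)) (M : ℕ)
    (v : Fin d) (c : Fin d → ℝ) (m : ℕ) : MeasurableSet (slabSet F M v c m) := by
  have hm : ∀ k, Measurable fun x : Fin d → ℝ => F k (x k) := fun k =>
    (hF k).measurable.comp (measurable_pi_apply k)
  have h1 : MeasurableSet {x : Fin d → ℝ | slab M (F v (x v)) = m} :=
    (Nat.measurable_ceil.comp ((hm v).const_mul (M : ℝ))) (measurableSet_singleton m)
  have h2 : MeasurableSet {x : Fin d → ℝ | ∀ k, k ≠ v → F k (x k) ≤ c k} := by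
    simp only [ofPred_forall]
    exact MeasurableSet.iInter fun k => MeasurableSet.iInter fun _ =>
      measurableSet_le (hm k) measurable_const
  exact h1.inter h2

lemma disjoint_slabSet {d : ℕ} (F : Fin d → ℝ → ℝ) (M : ℕ) (v : Fin d) (c : Fin d → ℝ)
    {m m' : ℕ} (h : m ≠ m') : Disjoint (slabSet F M v c m) (slabSet F M v c m') :=
  Set.disjoint_left.2 fun _ h1 h2 => h (h1.1.symm.trans h2.1)

lemma slab_eq_succ_iff {M : ℕ} (hM : 0 < M) {t : ℝ} {m : ℕ} :
    slab M t = m + 1 ↔ (m : ℝ) / M < t ∧ t ≤ ((m + 1 : ℕ) : ℝ) / M := by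
  rw [← slab_le_iff hM, ← not_le, ← slab_le_iff hM]
  omega

section Copula

variable {d : ℕ} {mΩ : MeasurableSpace Ω} {P : Measure Ω} [IsProbabilityMeasure P]
  {Y : Ω → Fin d → ℝ} {F : Fin d → ℝ → ℝ} {C : (Fin d → ℝ) → ℝ}

lemma setOf_forall_le_update (Y : Ω → Fin d → ℝ) (F : Fin d → ℝ → ℝ) (c : Fin d → ℝ) (v : Fin d)
    (t : ℝ) : {ω | ∀ k, F k (Y ω k) ≤ Function.update c v t k}
      = {ω | F v (Y ω v) ≤ t ∧ ∀ k, k ≠ v → F k (Y ω k) ≤ c k} := by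
  ext ω
  simp only [mem_ofPred_eq]
  constructor
  · intro H
    exact ⟨by simpa using H v, fun k hk => by simpa [hk] using H k⟩
  · rintro ⟨H1, H2⟩ k
    by_cases hk : k = v
    · subst hk; simpa using H1
    · simpa [hk] using H2 k hk

lemma measurableSet_le_update (hY : Measurable Y) (hFc : ∀ v, Continuous (F v)) (c : Fin d → ℝ) :
    MeasurableSet {ω | ∀ k, F k (Y ω k) ≤ c k} := by
  rw [ofPred_forall]
  exact MeasurableSet.iInter fun k => measurableSet_le
    ((hFc k).measurable.comp ((measurable_pi_apply k).comp hY)) measurable_const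

lemma copula_update_sub (hY : Measurable Y) (hFc : ∀ v, Continuous (F v))
    (hC : ∀ u, C u = P.real {ω | ∀ k, F k (Y ω k) ≤ u k}) (c : Fin d → ℝ) (v : Fin d) {s t : ℝ}
    (hst : s ≤ t) :
    C (Function.update c v t) - C (Function.update c v s)
      = P.real {ω | (s < F v (Y ω v) ∧ F v (Y ω v) ≤ t) ∧ ∀ k, k ≠ v → F k (Y ω k) ≤ c k} := by
  have hsub : {ω | ∀ k, F k (Y ω k) ≤ Function.update c v s k}
      ⊆ {ω | ∀ k, F k (Y ω k) ≤ Function.update c v t k} := by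
    rw [setOf_forall_le_update, setOf_forall_le_update]
    exact fun ω h => ⟨h.1.trans hst, h.2⟩
  rw [hC, hC, ← measureReal_sdiff hsub (measurableSet_le_update hY hFc _),
    setOf_forall_le_update, setOf_forall_le_update]
  congr 1
  ext ω
  simp only [Set.mem_sdiff, mem_ofPred_eq, not_and, ← not_le]
  tauto

lemma prob_strip (hY : Measurable Y) (hF : ∀ v x, F v x = P.real {ω | Y ω v ≤ x})
    (hFc : ∀ v, Continuous (F v)) (v : Fin d) {s t : ℝ} (hst : s ≤ t) :
    P.real {ω | s < F v (Y ω v) ∧ F v (Y ω v) ≤ t} = max 0 (min t 1) - max 0 (min s 1) := by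
  have hYv : Measurable fun ω => Y ω v := (measurable_pi_apply v).comp hY
  have hsub : {ω | F v (Y ω v) ≤ s} ⊆ {ω | F v (Y ω v) ≤ t} := fun ω h => le_trans h hst
  rw [← prob_integral_transform hYv (hF v) (hFc v) t,
    ← prob_integral_transform hYv (hF v) (hFc v) s, ← measureReal_sdiff hsub
      (measurableSet_le ((hFc v).measurable.comp hYv) measurable_const)]
  congr 1
  ext ω
  simp only [Set.mem_sdiff, mem_ofPred_eq, ← not_le]
  tauto

lemma copula_update_mono (hY : Measurable Y) (hFc : ∀ v, Continuous (F v))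
    (hC : ∀ u, C u = P.real {ω | ∀ k, F k (Y ω k) ≤ u k}) (c : Fin d → ℝ) (v : Fin d) :
    Monotone fun t => C (Function.update c v t) := by
  intro s t hst
  have := copula_update_sub hY hFc hC c v hst
  have h2 := measureReal_nonneg (μ := P)
    (s := {ω | (s < F v (Y ω v) ∧ F v (Y ω v) ≤ t) ∧ ∀ k, k ≠ v → F k (Y ω k) ≤ c k})
  simp only
  linarith

lemma copula_update_sub_le (hY : Measurable Y) (hF : ∀ v x, F v x = P.real {ω | Y ω v ≤ x})
    (hFc : ∀ v, Continuous (F v))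
    (hC : ∀ u, C u = P.real {ω | ∀ k, F k (Y ω k) ≤ u k}) (c : Fin d → ℝ) (v : Fin d) {s t : ℝ}
    (hst : s ≤ t) :
    C (Function.update c v t) - C (Function.update c v s) ≤ t - s := by
  rw [copula_update_sub hY hFc hC c v hst]
  calc _ ≤ P.real {ω | s < F v (Y ω v) ∧ F v (Y ω v) ≤ t} := measureReal_mono fun ω h => h.1
    _ ≤ t - s := by
      rw [prob_strip hY hF hFc v hst]
      simp only [max_def, min_def]
      split_ifs <;> linarith

lemma copula_deriv_mem_Icc (hY : Measurable Y) (hF : ∀ v x, F v x = P.real {ω | Y ω v ≤ x})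
    (hFc : ∀ v, Continuous (F v))
    (hC : ∀ u, C u = P.real {ω | ∀ k, F k (Y ω k) ≤ u k}) {u : Fin d → ℝ} {v : Fin d} {D : ℝ}
    (hD : HasDerivAt (fun t => C (Function.update u v t)) D (u v)) : D ∈ Icc (0 : ℝ) 1 := by
  have h1 := copula_update_mono hY hFc hC u v
  have h2 : Monotone fun t => t - C (Function.update u v t) := fun s t hst => by
    have := copula_update_sub_le hY hF hFc hC u v hst
    simp only
    linarith
  have h3 := (hasDerivAt_id (u v)).sub hD
  constructor
  · rw [← hD.deriv]; exact h1.deriv_nonneg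
  · have := h3.deriv
    have h4 : 0 ≤ deriv (fun t => t - C (Function.update u v t)) (u v) := h2.deriv_nonneg
    have h5 : deriv (fun t => t - C (Function.update u v t)) (u v) = 1 - D := this
    linarith

lemma copula_clamp (hY : Measurable Y) (hF : ∀ v x, F v x = P.real {ω | Y ω v ≤ x})
    (hFc : ∀ v, Continuous (F v))
    (hC : ∀ u, C u = P.real {ω | ∀ k, F k (Y ω k) ≤ u k}) (c : Fin d → ℝ) :
    C (fun k => max 0 (min (c k) 1)) = C c := by
  rw [hC, hC]
  refine measureReal_congr ?_
  have hpos : ∀ k, ∀ᵐ ω ∂P, 0 < F k (Y ω k) := by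
    intro k
    have hYk : Measurable fun ω => Y ω k := (measurable_pi_apply k).comp hY
    have := prob_integral_transform hYk (hF k) (hFc k) 0
    rw [min_eq_left zero_le_one, max_self, measureReal_eq_zero_iff] at this
    rw [ae_iff]
    simpa only [not_lt] using this
  filter_upwards [ae_all_iff.2 hpos] with ω hω
  refine propext (forall_congr' fun k => ?_)
  have h1 : F k (Y ω k) ≤ 1 := by rw [hF]; exact measureReal_le_one
  have h0 := hω k
  simp only [le_max_iff, le_min_iff, h1, and_true, not_le.2 h0, false_or]

lemma prob_slabSet_succ (hY : Measurable Y) (hFc : ∀ v, Continuous (F v))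
    (hC : ∀ u, C u = P.real {ω | ∀ k, F k (Y ω k) ≤ u k}) {M : ℕ} (hM : 0 < M) (v : Fin d)
    (c : Fin d → ℝ) (m : ℕ) :
    P.real (Y ⁻¹' slabSet F M v c (m + 1))
      = C (Function.update c v ((m + 1 : ℕ) / M)) - C (Function.update c v (m / M)) := by
  rw [copula_update_sub hY hFc hC c v (by gcongr; omega)]
  congr 1
  ext ω
  simp only [slabSet, mem_preimage, mem_ofPred_eq, slab_eq_succ_iff hM]

lemma prob_slabSet_of_one_le (hY : Measurable Y) (hF : ∀ v x, F v x = P.real {ω | Y ω v ≤ x})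
    (hFc : ∀ v, Continuous (F v)) {M : ℕ} (hM : 0 < M) (v : Fin d) {c : Fin d → ℝ}
    (hc : ∀ k, 1 ≤ c k) {m : ℕ} (hm : m ≤ M) :
    P.real (Y ⁻¹' slabSet F M v c m) = if m = 0 then 0 else 1 / (M : ℝ) := by
  have hM' : (0 : ℝ) < M := Nat.cast_pos.2 hM
  have hc' : ∀ ω k, F k (Y ω k) ≤ c k := fun ω k => by
    rw [hF]; exact measureReal_le_one.trans (hc k)
  rcases m with _ | m
  · have hYv : Measurable fun ω => Y ω v := (measurable_pi_apply v).comp hY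
    have h := prob_integral_transform hYv (hF v) (hFc v) 0
    rw [min_eq_left zero_le_one, max_self] at h
    rw [if_pos rfl, ← h]
    congr 1
    ext ω
    simp only [slabSet, mem_preimage, mem_ofPred_eq, ← Nat.le_zero, slab_le_iff hM]
    simp [hc']
  · rw [if_neg (Nat.succ_ne_zero m)]
    have h1 : ((m + 1 : ℕ) : ℝ) / M ≤ 1 := (div_le_one hM').2 (Nat.cast_le.2 hm)
    have h2 : (m : ℝ) / M ≤ ((m + 1 : ℕ) : ℝ) / M := by gcongr; omega
    have h3 : (0 : ℝ) ≤ (m : ℝ) / M := by positivity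
    have h := prob_strip hY hF hFc v h2
    rw [min_eq_left h1, min_eq_left (h2.trans h1), max_eq_right h3, max_eq_right (h3.trans h2)] at h
    calc _ = P.real {ω | (m : ℝ) / M < F v (Y ω v) ∧ F v (Y ω v) ≤ ((m + 1 : ℕ) : ℝ) / M} := by
          congr 1
          ext ω
          simp only [slabSet, mem_preimage, mem_ofPred_eq, slab_eq_succ_iff hM]
          simp [hc']
      _ = 1 / M := by rw [h]; push_cast; ring

lemma prob_slabSet_le (hY : Measurable Y) (hF : ∀ v x, F v x = P.real {ω | Y ω v ≤ x})
    (hFc : ∀ v, Continuous (F v)) {M : ℕ} (hM : 0 < M) (v : Fin d) (c : Fin d → ℝ) {m : ℕ}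
    (hm : m ≤ M) : P.real (Y ⁻¹' slabSet F M v c m) ≤ 1 / (M : ℝ) := by
  have h := prob_slabSet_of_one_le hY hF hFc hM v (c := fun _ => 1) (fun _ => le_rfl) hm
  calc _ ≤ P.real (Y ⁻¹' slabSet F M v (fun _ => 1) m) := measureReal_mono fun ω hω =>
        ⟨hω.1, fun k _ => by rw [hF]; exact measureReal_le_one⟩
    _ ≤ 1 / (M : ℝ) := by
        rw [h]
        split_ifs
        · positivity
        · exact le_rfl

/-- Mean value theorem for the probability of a slab away from the boundary. -/
lemma exists_prob_slabSet_eq (hY : Measurable Y) (hF : ∀ v x, F v x = P.real {ω | Y ω v ≤ x})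
    (hFc : ∀ v, Continuous (F v))
    (hC : ∀ u, C u = P.real {ω | ∀ k, F k (Y ω k) ≤ u k}) {D : (Fin d → ℝ) → ℝ} {j : Fin d}
    (hD : ∀ u : Fin d → ℝ, (∀ k, u k ∈ Icc (0 : ℝ) 1) → 0 < u j → u j < 1 →
      HasDerivAt (fun t => C (Function.update u j t)) (D u) (u j))
    {M : ℕ} (hM : 0 < M) (c : Fin d → ℝ) {m : ℕ} (hm : 0 < m) (hmM : m + 1 < M) :
    ∃ ζ ∈ Ioo ((m : ℝ) / M) ((m + 1 : ℕ) / M), P.real (Y ⁻¹' slabSet F M j c (m + 1))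
      = 1 / M * D (Function.update (fun k => max 0 (min (c k) 1)) j ζ) := by
  have hM' : (0 : ℝ) < M := Nat.cast_pos.2 hM
  set b : Fin d → ℝ := fun k => max 0 (min (c k) 1) with hb
  have h2 : (m : ℝ) / M < ((m + 1 : ℕ) : ℝ) / M := by gcongr; omega
  have h0 : (0 : ℝ) < (m : ℝ) / M := by positivity
  have h1 : ((m + 1 : ℕ) : ℝ) / M < 1 := (div_lt_one hM').2 (Nat.cast_lt.2 hmM)
  have hclamp : ∀ t, 0 ≤ t → t ≤ 1 → C (Function.update c j t) = C (Function.update b j t) := by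
    intro t ht0 ht1
    rw [← copula_clamp hY hF hFc hC]
    congr 1
    funext k
    by_cases hk : k = j
    · subst hk; simp [ht0, ht1]
    · simp [hk, hb]
  have hder : ∀ t, 0 < t → t < 1 →
      HasDerivAt (fun t => C (Function.update b j t)) (D (Function.update b j t)) t := by
    intro t ht0 ht1
    have := hD (Function.update b j t) (fun k => by
      by_cases hk : k = j
      · subst hk; simp [ht0.le, ht1.le]
      · simp [hk, hb]) (by simpa using ht0) (by simpa using ht1)
    simpa using this
  obtain ⟨ζ, hζ, hζ'⟩ := exists_hasDerivAt_eq_slope (fun t => C (Function.update b j t))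
    (fun t => D (Function.update b j t)) h2
    (fun t ht => (hder t (h0.trans_le ht.1) (ht.2.trans_lt h1)).continuousAt.continuousWithinAt)
    (fun t ht => hder t (h0.trans ht.1) (ht.2.trans h1))
  refine ⟨ζ, hζ, ?_⟩
  rw [prob_slabSet_succ hY hFc hC hM, hclamp _ (h0.trans h2).le h1.le,
    hclamp _ h0.le (h2.trans h1).le, hζ']
  have : ((m + 1 : ℕ) : ℝ) / M - m / M = 1 / M := by push_cast; ring
  rw [this]
  field_simp

end Copula

/-! ### Slab counts of a mixing sequence -/

lemma stationary_prob_preimage {E : Type*} [MeasurableSpace E] {mΩ : MeasurableSpace Ω}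
    {P : Measure Ω} {X : ℤ → Ω → E} (hX : ∀ i, Measurable (X i))
    (hstat : ∀ k : ℤ, Measure.map (fun ω => fun i : ℤ => X (i + k) ω) P
        = Measure.map (fun ω => fun i : ℤ => X i ω) P) (k : ℤ) {A : Set E}
    (hA : MeasurableSet A) : P.real (X k ⁻¹' A) = P.real (X 0 ⁻¹' A) := by
  have hS : MeasurableSet {y : ℤ → E | y 0 ∈ A} := measurable_pi_apply 0 hA
  have h := congrArg (fun ν => ν {y : ℤ → E | y 0 ∈ A}) (hstat k)
  rw [Measure.map_apply (measurable_pi_lambda _ fun i => hX _) hS,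
    Measure.map_apply (measurable_pi_lambda _ fun i => hX _) hS] at h
  simp only [preimage_ofPred_eq, zero_add] at h
  exact congrArg ENNReal.toReal h

/-- The polynomial mixing rate `r ^ (-a)`, `a > 1`, is summable and is `o(1 / r)`. -/
lemma mixing_rate_properties (K : ℝ) {a : ℝ} (ha : 1 < a) :
    (∀ r : ℕ, 0 ≤ |K| * (r : ℝ) ^ (-a)) ∧ Summable (fun r : ℕ => |K| * (r : ℝ) ^ (-a)) ∧
      Tendsto (fun r : ℕ => (r : ℝ) * (|K| * (r : ℝ) ^ (-a))) atTop (nhds 0) := by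
  refine ⟨fun r => by positivity, (Real.summable_nat_rpow.2 (by linarith)).mul_left _, ?_⟩
  have h := ((tendsto_rpow_neg_atTop (show 0 < a - 1 by linarith)).comp
    tendsto_natCast_atTop_atTop).const_mul |K|
  rw [mul_zero] at h
  refine h.congr' ?_
  filter_upwards [eventually_gt_atTop 0] with r hr
  have hr' : (0 : ℝ) < r := Nat.cast_pos.2 hr
  simp only [Function.comp]
  rw [show -(a - 1) = 1 + -a by ring, Real.rpow_add hr', Real.rpow_one]
  ring

lemma exists_stationary_sum_deviation_le {E : Type*} [mE : MeasurableSpace E]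
    [mΩ : MeasurableSpace Ω] {P : Measure Ω} [IsProbabilityMeasure P] {X : ℤ → Ω → E}
    (hX : ∀ i, Measurable (X i))
    (hstat : ∀ k : ℤ, Measure.map (fun ω => fun i : ℤ => X (i + k) ω) P
        = Measure.map (fun ω => fun i : ℤ => X i ω) P) {a : ℝ} (ha : 1 < a)
    (hmix : ∃ K : ℝ, ∀ r : ℕ, 1 ≤ r → ∀ p : ℤ, ∀ A B : Set Ω,
      MeasurableSet[⨆ i : {i : ℤ // i ≤ p}, MeasurableSpace.comap (X i.1) mE] A →
      MeasurableSet[⨆ i : {i : ℤ // p + r ≤ i}, MeasurableSpace.comap (X i.1) mE] B →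
      |(P (A ∩ B)).toReal - (P A).toReal * (P B).toReal| ≤ K * (r : ℝ) ^ (-a))
    {η μ : ℝ} (hη : 0 < η) (hμ : 0 < μ) :
    ∃ p₀ > 0, ∀ᶠ n : ℕ in atTop, ∀ k ≤ n, ∀ (t : Finset ℕ) (D : ℕ → Set E),
      (∀ m, MeasurableSet (D m)) → (t : Set ℕ).PairwiseDisjoint D →
      (∀ m ∈ t, P.real (X 0 ⁻¹' D m) ≤ p₀) →
      ∑ m ∈ t, P.real {ω | η * √n ≤ |∑ i ∈ Finset.range k,
        ((D m).indicator 1 (X ((i : ℤ) + 1) ω) - P.real (X 0 ⁻¹' D m))|} ≤ μ := by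
  obtain ⟨K, hK⟩ := hmix
  obtain ⟨h1, h2, h3⟩ := mixing_rate_properties K ha
  obtain ⟨p₀, hp₀, h⟩ := exists_sum_deviation_le (P := P) (Z := fun (i : ℕ) => X ((i : ℤ) + 1))
    (past := fun p : ℕ => ⨆ i : {i : ℤ // i ≤ (p : ℤ) + 1}, MeasurableSpace.comap (X i.1) mE)
    (fut := fun p : ℕ => ⨆ i : {i : ℤ // (p : ℤ) + 1 ≤ i}, MeasurableSpace.comap (X i.1) mE)
    (α := fun r : ℕ => |K| * (r : ℝ) ^ (-a))
    (fun p => iSup_le fun i => (hX i.1).comap_le) (fun p => iSup_le fun i => (hX i.1).comap_le)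
    (fun p q hpq => iSup_le fun i => le_iSup_of_le
      (⟨i.1, i.2.trans (by gcongr)⟩ : {i : ℤ // i ≤ (q : ℤ) + 1}) le_rfl)
    (fun p q hpq => iSup_le fun i => le_iSup_of_le
      (⟨i.1, le_trans (by gcongr) i.2⟩ : {i : ℤ // (p : ℤ) + 1 ≤ i}) le_rfl)
    (fun r hr p A B hA hB => by
      refine (hK r hr ((p : ℤ) + 1) A B hA ?_).trans
        (mul_le_mul_of_nonneg_right (le_abs_self K) (by positivity))
      have e : (((p + r : ℕ) : ℤ) + 1) = (p : ℤ) + 1 + r := by push_cast; ring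
      rwa [e] at hB)
    h1 h2 h3
    (fun i => Measurable.of_comap_le (le_iSup_of_le
      (⟨(i : ℤ) + 1, le_rfl⟩ : {z : ℤ // z ≤ (i : ℤ) + 1}) le_rfl))
    (fun i => Measurable.of_comap_le (le_iSup_of_le
      (⟨(i : ℤ) + 1, le_rfl⟩ : {z : ℤ // (i : ℤ) + 1 ≤ z}) le_rfl)) hη hμ
  refine ⟨p₀, hp₀, h.mono fun n hn k hk t D hD hdisj hp => ?_⟩
  exact hn k hk t D _ hD hdisj (fun m i => stationary_prob_preimage hX hstat _ (hD m)) hp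

/-- Some slab count on an initial block of the form `1, …, ⌊b n / L⌋` is far from its mean. -/
def badEvent [MeasurableSpace Ω] (P : Measure Ω) {d : ℕ} (X : ℤ → Ω → Fin d → ℝ)
    (F : Fin d → ℝ → ℝ) (Cs : Finset (Fin d → ℝ)) (L M n : ℕ) (η : ℝ) : Set Ω :=
  {ω | ∃ v, ∃ c ∈ Cs, ∃ b ≤ L, ∃ m ≤ M, η * √n ≤ |∑ i ∈ Finset.range (b * n / L),
    ((slabSet F M v c m).indicator 1 (X ((i : ℤ) + 1) ω) - P.real (X 0 ⁻¹' slabSet F M v c m))|}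

lemma tendsto_badEvent [mΩ : MeasurableSpace Ω] {P : Measure Ω} [IsProbabilityMeasure P] {d : ℕ}
    {X : ℤ → Ω → Fin d → ℝ} (hX : ∀ i, Measurable (X i))
    (hstat : ∀ k : ℤ, Measure.map (fun ω => fun i : ℤ => X (i + k) ω) P
        = Measure.map (fun ω => fun i : ℤ => X i ω) P)
    {F : Fin d → ℝ → ℝ} (hF : ∀ v x, F v x = P.real {ω | X 0 ω v ≤ x})
    (hFc : ∀ v, Continuous (F v)) {a : ℝ} (ha : 1 < a)
    (hmix : ∃ K : ℝ, ∀ r : ℕ, 1 ≤ r → ∀ p : ℤ, ∀ A B : Set Ω,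
      MeasurableSet[⨆ i : {i : ℤ // i ≤ p},
        MeasurableSpace.comap (X i.1) (inferInstance : MeasurableSpace (Fin d → ℝ))] A →
      MeasurableSet[⨆ i : {i : ℤ // p + r ≤ i},
        MeasurableSpace.comap (X i.1) (inferInstance : MeasurableSpace (Fin d → ℝ))] B →
      |(P (A ∩ B)).toReal - (P A).toReal * (P B).toReal| ≤ K * (r : ℝ) ^ (-a))
    (Cs : Finset (Fin d → ℝ)) {L : ℕ} (hL : 0 < L) {M : ℕ → ℕ} (hM : Tendsto M atTop atTop)
    {η : ℝ} (hη : 0 < η) :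
    Tendsto (fun n : ℕ => P (badEvent P X F Cs L (M n) n η)) atTop (nhds 0) := by
  have hreal : ∀ τ : ℝ, 0 < τ → ∀ᶠ n : ℕ in atTop, P.real (badEvent P X F Cs L (M n) n η) ≤ τ := by
    intro τ hτ
    set c₀ : ℝ := (d : ℝ) * Cs.card * (L + 1) with hc₀
    have hc₀' : 0 ≤ c₀ := by positivity
    obtain ⟨p₀, hp₀, h⟩ := exists_stationary_sum_deviation_le hX hstat ha hmix hη
      (show 0 < τ / (c₀ + 1) by positivity)
    have hMinv : ∀ᶠ n : ℕ in atTop, 1 / (M n : ℝ) ≤ p₀ := by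
      have := (tendsto_one_div_atTop_nhds_zero_nat (𝕜 := ℝ)).comp hM
      exact (this.eventually (gt_mem_nhds hp₀)).mono fun n hn => hn.le
    filter_upwards [h, hMinv, hM.eventually_gt_atTop 0] with n hn hMn hMpos
    set S : Fin d → (Fin d → ℝ) → ℕ → ℕ → Set Ω := fun v c b m =>
      {ω | η * √n ≤ |∑ i ∈ Finset.range (b * n / L), ((slabSet F (M n) v c m).indicator 1
        (X ((i : ℤ) + 1) ω) - P.real (X 0 ⁻¹' slabSet F (M n) v c m))|} with hS
    have hsub : badEvent P X F Cs L (M n) n η ⊆ ⋃ v ∈ (Finset.univ : Finset (Fin d)), ⋃ c ∈ Cs,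
        ⋃ b ∈ Finset.range (L + 1), ⋃ m ∈ Finset.range (M n + 1), S v c b m := by
      rintro ω ⟨v, c, hc, b, hb, m, hm, hω⟩
      simp only [mem_iUnion]
      exact ⟨v, Finset.mem_univ v, c, hc, b, Finset.mem_range.2 (by omega), m,
        Finset.mem_range.2 (by omega), hω⟩
    have hblock : ∀ v c, ∀ b ∈ Finset.range (L + 1),
        P.real (⋃ m ∈ Finset.range (M n + 1), S v c b m) ≤ τ / (c₀ + 1) := by
      intro v c b hb
      refine (measureReal_biUnion_finset_le _ _).trans ?_
      refine hn (b * n / L) ?_ _ (slabSet F (M n) v c) (measurableSet_slabSet hFc _ _ _)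
        (fun m _ m' _ hne => disjoint_slabSet F _ v c hne) fun m hm => ?_
      · exact Nat.div_le_of_le_mul (Nat.mul_le_mul_right n (by simpa [Nat.lt_succ_iff] using hb))
      · exact (prob_slabSet_le (hX 0) hF hFc hMpos v c
          (by simpa [Nat.lt_succ_iff] using hm)).trans hMn
    calc P.real (badEvent P X F Cs L (M n) n η)
        ≤ ∑ v : Fin d, ∑ c ∈ Cs, ∑ b ∈ Finset.range (L + 1),
          P.real (⋃ m ∈ Finset.range (M n + 1), S v c b m) := by
          refine (measureReal_mono hsub (measure_ne_top _ _)).trans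
            ((measureReal_biUnion_finset_le _ _).trans ?_)
          refine Finset.sum_le_sum fun v _ => (measureReal_biUnion_finset_le _ _).trans ?_
          exact Finset.sum_le_sum fun c _ => measureReal_biUnion_finset_le _ _
      _ ≤ ∑ v : Fin d, ∑ c ∈ Cs, ∑ b ∈ Finset.range (L + 1), τ / (c₀ + 1) := by
          gcongr with v _ c _ b hb
          exact hblock v c b hb
      _ = c₀ * (τ / (c₀ + 1)) := by simp [hc₀]; ring
      _ ≤ τ := by
          rw [mul_div_assoc', div_le_iff₀ (by positivity)]
          nlinarith
  rw [ENNReal.tendsto_atTop_zero]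
  intro e he
  rcases eq_or_ne e ⊤ with rfl | htop
  · exact ⟨0, fun _ _ => le_top⟩
  obtain ⟨N, hN⟩ := eventually_atTop.1 (hreal e.toReal (ENNReal.toReal_pos he.ne' htop))
  exact ⟨N, fun n hn => (ENNReal.toReal_le_toReal (measure_ne_top _ _) htop).1 (hN n hn)⟩

lemma abs_sub_le_of_grid {T : ℕ → ℝ} (hT : Monotone T) {p e : ℝ} (hp : 0 ≤ p) {n L : ℕ}
    (hL : 0 < L) (hg : ∀ b ≤ L, |T (b * n / L) - (b * n / L : ℕ) * p| ≤ e) {k : ℕ} (hk : k ≤ n) :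
    |T k - k * p| ≤ e + (n / L + 1) * p := by
  have hL' : (0 : ℝ) < L := Nat.cast_pos.2 hL
  rcases hk.eq_or_lt with rfl | hkn
  · have h := hg L le_rfl
    rw [Nat.mul_div_cancel_left _ hL] at h
    have : 0 ≤ ((k : ℝ) / L + 1) * p := by positivity
    linarith
  have hn : 0 < n := by omega
  set b := k * L / n with hb
  have hbL : b < L := Nat.div_lt_of_lt_mul (by nlinarith)
  have hlow : b * n / L ≤ k := Nat.div_le_of_le_mul (by
    rw [mul_comm L]; exact Nat.div_mul_le_self _ _)
  have hupp : k ≤ (b + 1) * n / L := (Nat.le_div_iff_mul_le hL).2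
    (Nat.lt_mul_of_div_lt (Nat.lt_succ_self _) hn).le
  have h1 := abs_le.1 (hg b hbL.le)
  have h2 := abs_le.1 (hg (b + 1) hbL)
  have h3 : (((b + 1) * n / L : ℕ) : ℝ) ≤ (b + 1) * n / L := by
    have := @Nat.cast_div_le ℝ _ _ _ ((b + 1) * n) L
    push_cast at this
    exact this
  have h4 : (b : ℝ) * n / L - 1 ≤ ((b * n / L : ℕ) : ℝ) := by
    have : ((b * n : ℕ) : ℝ) / L < ((b * n / L : ℕ) : ℝ) + 1 := by
      rw [← Nat.floor_div_eq_div (K := ℝ)]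
      exact Nat.lt_floor_add_one _
    push_cast at this
    linarith
  have hgap : (((b + 1) * n / L : ℕ) : ℝ) - ((b * n / L : ℕ) : ℝ) ≤ n / L + 1 := by
    have : ((b : ℝ) + 1) * n / L = b * n / L + n / L := by ring
    linarith
  have h5 := hT hlow
  have h6 := hT hupp
  have h7 : ((b * n / L : ℕ) : ℝ) ≤ k := Nat.cast_le.2 hlow
  have h8 : (k : ℝ) ≤ ((b + 1) * n / L : ℕ) := Nat.cast_le.2 hupp
  have h9 := mul_le_mul_of_nonneg_right hgap hp
  have h10 := mul_le_mul_of_nonneg_right h7 hp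
  have h11 := mul_le_mul_of_nonneg_right h8 hp
  rw [abs_le]
  constructor <;> nlinarith

lemma card_filter_mem_eq_sum_sub {E : Type*} (x : ℤ → E) (A : Set E) {k l : ℕ} (hkl : k ≤ l)
    [DecidablePred fun i : ℕ => x i ∈ A] :
    (((Finset.Icc (k + 1) l).filter fun i : ℕ => x i ∈ A).card : ℝ)
      = ∑ i ∈ Finset.range l, A.indicator (1 : E → ℝ) (x ((i : ℤ) + 1))
        - ∑ i ∈ Finset.range k, A.indicator (1 : E → ℝ) (x ((i : ℤ) + 1)) := by
  rw [← Finset.sum_Ico_eq_sub _ hkl, Finset.card_filter]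
  have h := Finset.sum_Ico_add' (fun i : ℕ => A.indicator (1 : E → ℝ) (x i)) k l 1
  push_cast at h ⊢
  rw [h]
  have e : Finset.Icc (k + 1) l = Finset.Ico (k + 1) (l + 1) := by ext; simp
  rw [e]
  exact Finset.sum_congr rfl fun i _ => by simp [indicator_apply]

/-- Off the bad event all slab counts over long blocks are relatively close to their means. -/
lemma abs_card_slab_sub_le [mΩ : MeasurableSpace Ω] {P : Measure Ω} [IsProbabilityMeasure P] {d : ℕ}
    {X : ℤ → Ω → Fin d → ℝ} {F : Fin d → ℝ → ℝ} {Cs : Finset (Fin d → ℝ)} {L M n : ℕ} (hL : 0 < L)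
    (hM : 0 < M) {η κ : ℝ} {ω : Ω} (hω : ω ∉ badEvent P X F Cs L M n η) {v : Fin d}
    {c : Fin d → ℝ} (hc : c ∈ Cs) {m : ℕ} (hm : m ≤ M)
    (hp : P.real (X 0 ⁻¹' slabSet F M v c m) ≤ 1 / M) {k l : ℕ} (hkl : k ≤ l) (hl : l ≤ n)
    (hκ : 2 * (η * √n * M + (n / L + 1)) ≤ κ * ((l : ℝ) - k))
    [DecidablePred fun i : ℕ => X i ω ∈ slabSet F M v c m] :
    |(((Finset.Icc (k + 1) l).filter fun i : ℕ => X i ω ∈ slabSet F M v c m).card : ℝ)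
      - ((l : ℝ) - k) * P.real (X 0 ⁻¹' slabSet F M v c m)| ≤ κ * (((l : ℝ) - k) / M) := by
  have hM' : (0 : ℝ) < M := Nat.cast_pos.2 hM
  set p := P.real (X 0 ⁻¹' slabSet F M v c m)
  set T : ℕ → ℝ := fun k => ∑ i ∈ Finset.range k,
    (slabSet F M v c m).indicator (1 : (Fin d → ℝ) → ℝ) (X ((i : ℤ) + 1) ω) with hTdef
  have hT : Monotone T := by
    refine monotone_nat_of_le_succ fun k => ?_
    simp only [hTdef, Finset.sum_range_succ]
    exact le_add_of_nonneg_right (indicator_nonneg (fun _ _ => zero_le_one) _)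
  have hg : ∀ b ≤ L, |T (b * n / L) - (b * n / L : ℕ) * p| ≤ η * √n := by
    intro b hb
    by_contra hlt
    refine hω ⟨v, c, hc, b, hb, m, hm, ?_⟩
    rw [Finset.sum_sub_distrib]
    simpa using (not_le.1 hlt).le
  have h1 := abs_sub_le_of_grid hT measureReal_nonneg hL hg hl
  have h2 := abs_sub_le_of_grid hT measureReal_nonneg hL hg (hkl.trans hl)
  have h3 : ((n : ℝ) / L + 1) * p ≤ (n / L + 1) * (1 / M) := by gcongr
  have h4 : 2 * (η * √n + (n / L + 1) * (1 / M)) ≤ κ * (((l : ℝ) - k) / M) := by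
    rw [← mul_div_assoc κ, le_div_iff₀ hM']
    calc _ = 2 * (η * √n * M + (n / L + 1)) := by field_simp
      _ ≤ _ := hκ
  rw [card_filter_mem_eq_sum_sub (fun i => X i ω) _ hkl]
  change |T l - T k - ((l : ℝ) - k) * p| ≤ _
  rw [show T l - T k - ((l : ℝ) - k) * p = (T l - l * p) - (T k - k * p) by ring]
  refine (abs_sub _ _).trans ?_
  linarith

/-- Number of slabs used for sample size `n`, of order `√n`. -/
def slabNumber (B n : ℕ) : ℕ := B * (Nat.sqrt n + 1)

lemma le_slabNumber (B n : ℕ) : (B : ℝ) * √n ≤ slabNumber B n := by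
  unfold slabNumber
  push_cast
  gcongr
  exact Real.real_sqrt_le_nat_sqrt_succ

lemma slabNumber_le (B : ℕ) {n : ℕ} (hn : 1 ≤ n) : (slabNumber B n : ℝ) ≤ 2 * B * √n := by
  unfold slabNumber
  push_cast
  have h1 : (Nat.sqrt n : ℝ) ≤ √n := Real.nat_sqrt_le_real_sqrt
  have h2 : (1 : ℝ) ≤ √n := Real.one_le_sqrt.2 (by exact_mod_cast hn)
  have h3 : (B : ℝ) * (Nat.sqrt n + 1) ≤ B * (2 * √n) := by gcongr; linarith
  linarith

lemma tendsto_slabNumber {B : ℕ} (hB : 0 < B) : Tendsto (slabNumber B) atTop atTop := by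
  have h : Tendsto (fun n : ℕ => √(n : ℝ)) atTop atTop :=
    Real.tendsto_sqrt_atTop.comp tendsto_natCast_atTop_atTop
  refine tendsto_natCast_atTop_iff.1 (tendsto_atTop_mono (fun n => ?_) h)
  refine le_trans ?_ (le_slabNumber B n)
  exact le_mul_of_one_le_left (Real.sqrt_nonneg _) (by exact_mod_cast hB)

/-- The grid `{z / G : z ∈ {-1, …, G + 2}}` in every coordinate. -/
def gridPoints (d G : ℕ) : Finset (Fin d → ℝ) :=
  open Classical in
  (Fintype.piFinset fun _ : Fin d => Finset.Icc (-1 : ℤ) (G + 2)).image fun z k => (z k : ℝ) / G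

lemma mem_gridPoints {d G : ℕ} {z : Fin d → ℤ} (hz : ∀ k, z k ∈ Finset.Icc (-1 : ℤ) (G + 2)) :
    (fun k => (z k : ℝ) / G) ∈ gridPoints d G := by
  classical
  unfold gridPoints
  exact Finset.mem_image_of_mem _ (Fintype.mem_piFinset.2 hz)

lemma exists_gridPoints_brackets {d G : ℕ} (hG : 0 < G) {u : Fin d → ℝ}
    (hu : ∀ k, u k ∈ Icc (0 : ℝ) 1) :
    ∃ cp ∈ gridPoints d G, ∃ cm ∈ gridPoints d G, ∀ k,
      (u k + 1 / G ≤ cp k ∧ cp k ≤ u k + 2 / G) ∧ (u k - 2 / G ≤ cm k ∧ cm k + 1 / G ≤ u k) := by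
  have hG' : (0 : ℝ) < G := Nat.cast_pos.2 hG
  have hfl : ∀ k, 0 ≤ ⌊(G : ℝ) * u k⌋ ∧ ⌊(G : ℝ) * u k⌋ ≤ G := by
    intro k
    refine ⟨Int.floor_nonneg.2 (mul_nonneg hG'.le (hu k).1), ?_⟩
    have : (G : ℝ) * u k ≤ ((G : ℤ) : ℝ) := by
      push_cast; exact mul_le_of_le_one_right hG'.le (hu k).2
    exact_mod_cast (Int.floor_le _).trans this
  refine ⟨_, mem_gridPoints (z := fun k => ⌊(G : ℝ) * u k⌋ + 2) fun k => ?_,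
    _, mem_gridPoints (z := fun k => ⌊(G : ℝ) * u k⌋ - 1) fun k => ?_, fun k => ?_⟩
  · have := hfl k
    simp only [Finset.mem_Icc]; omega
  · have := hfl k
    simp only [Finset.mem_Icc]; omega
  · have h1 := Int.floor_le ((G : ℝ) * u k)
    have h2 := Int.lt_floor_add_one ((G : ℝ) * u k)
    have e1 : u k + 1 / G = (G * u k + 1) / G := by field_simp
    have e2 : u k + 2 / G = (G * u k + 2) / G := by field_simp
    have e3 : u k - 2 / G = (G * u k - 2) / G := by field_simp
    refine ⟨⟨?_, ?_⟩, ?_, ?_⟩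
    · rw [e1]; push_cast; gcongr ?_ / _; linarith
    · rw [e2]; push_cast; gcongr
    · rw [e3]; push_cast; gcongr ?_ / _; linarith
    · rw [← le_sub_iff_add_le]
      have e4 : u k - 1 / G = (G * u k - 1) / G := by field_simp
      rw [e4]; push_cast; gcongr

lemma exists_one_le_mem_gridPoints {d G : ℕ} (hG : 0 < G) :
    ∃ c ∈ gridPoints d G, ∀ k, 1 ≤ c k := by
  refine ⟨_, mem_gridPoints (z := fun _ => (G : ℤ)) fun k => ?_, fun k => ?_⟩
  · simp only [Finset.mem_Icc]; omega
  · have hG' : (G : ℝ) ≠ 0 := Nat.cast_ne_zero.2 hG.ne'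
    simp [hG']

lemma exists_partial_modulus {d : ℕ} {D : (Fin d → ℝ) → ℝ} {j : Fin d}
    (hD : ContinuousOn D {u : Fin d → ℝ | (∀ k, u k ∈ Icc (0 : ℝ) 1) ∧ 0 < u j ∧ u j < 1})
    {δ τ : ℝ} (hδ : 0 < δ) (hτ : 0 < τ) :
    ∃ r > 0, ∀ u u' : Fin d → ℝ, (∀ k, u k ∈ Icc (0 : ℝ) 1) → (∀ k, u' k ∈ Icc (0 : ℝ) 1) →
      u j ∈ Icc δ (1 - δ) → u' j ∈ Icc δ (1 - δ) → (∀ k, |u k - u' k| < r) →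
      |D u - D u'| ≤ τ := by
  set S : Set (Fin d → ℝ) := (univ.pi fun _ => Icc (0 : ℝ) 1) ∩ {u | u j ∈ Icc δ (1 - δ)}
  have hS : IsCompact S := (isCompact_univ_pi fun _ => isCompact_Icc).inter_right
    (isClosed_Icc.preimage (continuous_apply j))
  have hcont : ContinuousOn D S := hD.mono fun u hu =>
    ⟨fun k => hu.1 k (mem_univ k), by linarith [hu.2.1], by linarith [hu.2.2]⟩
  obtain ⟨r, hr, h⟩ := Metric.uniformContinuousOn_iff.1
    (hS.uniformContinuousOn_of_continuous hcont) τ hτ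
  refine ⟨r, hr, fun u u' hu hu' huj huj' hd => ?_⟩
  exact (h u ⟨fun k _ => hu k, huj⟩ u' ⟨fun k _ => hu' k, huj'⟩
    ((dist_pi_lt_iff hr).2 fun k => by simpa [Real.dist_eq] using hd k)).le

lemma abs_clamp_sub_le {c t : ℝ} (ht : t ∈ Icc (0 : ℝ) 1) : |max 0 (min c 1) - t| ≤ |c - t| := by
  obtain ⟨h0, h1⟩ := ht
  simp only [max_def, min_def, abs_le]
  rcases abs_cases (c - t) with ⟨h, _⟩ | ⟨h, _⟩ <;> rw [h] <;> split_ifs <;>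
    constructor <;> linarith

lemma bandwidth_eq {N : ℝ} {k l : ℕ} (hN : (l : ℝ) - k + 1 = N) (h4 : 4 ≤ N) :
    bandwidth k l = (√N)⁻¹ := by
  unfold bandwidth
  rw [hN, min_eq_left]
  have : (2 : ℝ) ≤ √N := Real.le_sqrt_of_sq_le (by linarith)
  rw [one_div]
  gcongr

set_option maxHeartbeats 1600000 in
/-- Off the bad event, the estimator is uniformly close to the partial derivative. -/
lemma abs_pdEst_sub_le [mΩ : MeasurableSpace Ω] {P : Measure Ω} [IsProbabilityMeasure P] {d : ℕ}
    {X : ℤ → Ω → Fin d → ℝ} (hX : ∀ i, Measurable (X i)) {F : Fin d → ℝ → ℝ}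
    (hF : ∀ v x, F v x = P.real {ω | X 0 ω v ≤ x}) (hFc : ∀ v, Continuous (F v))
    {C : (Fin d → ℝ) → ℝ} (hC : ∀ u, C u = P.real {ω | ∀ k, F k (X 0 ω k) ≤ u k})
    {D : (Fin d → ℝ) → ℝ} {j : Fin d}
    (hD : ∀ u : Fin d → ℝ, (∀ k, u k ∈ Icc (0 : ℝ) 1) → 0 < u j → u j < 1 →
      HasDerivAt (fun t => C (Function.update u j t)) (D u) (u j))
    {δ τ r κ ε η : ℝ} {G B L n : ℕ} (hδ : 0 < δ) (hτ0 : 0 < τ) (hτ : τ ≤ 1 / 4)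
    (hmod : ∀ u u' : Fin d → ℝ, (∀ k, u k ∈ Icc (0 : ℝ) 1) → (∀ k, u' k ∈ Icc (0 : ℝ) 1) →
      u j ∈ Icc (δ / 2) (1 - δ / 2) → u' j ∈ Icc (δ / 2) (1 - δ / 2) → (∀ k, |u k - u' k| < r) →
      |D u - D u'| ≤ τ)
    (hG : 0 < G) (hGr : 2 / (G : ℝ) < r) (hκ0 : 0 < κ) (hκτ : κ ≤ τ) (hκr : 16 * κ ≤ r)
    (hκδ : 16 * κ ≤ δ) (hκG : κ ≤ 1 / (3 * G)) (hB : 0 < B) (hBτ : 1 ≤ τ * B) (hL : 0 < L)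
    (hLκ : 16 ≤ κ * ε * L) (hη : η * (16 * B) = κ * ε) (hη0 : 0 ≤ η) (hε : 0 < ε) (hε1 : ε < 1)
    (hn : 16 ≤ ε * κ ^ 2 * n) {ω : Ω}
    (hω : ω ∉ badEvent P X F (gridPoints d G) L (slabNumber B n) n η) {k l : ℕ} (hkl : k ≤ l)
    (hl : l ≤ n) (hN : ε * n ≤ 2 * ((l : ℝ) - k)) {u : Fin d → ℝ}
    (hu : ∀ v, u v ∈ Icc (0 : ℝ) 1) (huj : u j ∈ Icc δ (1 - δ)) :
    |pdEst d X j (k + 1) l u ω - D u| ≤ 8 * τ := by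
  classical
  have hκ1 : κ ≤ 1 / 4 := hκτ.trans hτ
  have hn0 : (0 : ℝ) ≤ n := Nat.cast_nonneg n
  have hB' : (1 : ℝ) ≤ B := by exact_mod_cast hB
  have hG' : (0 : ℝ) < G := Nat.cast_pos.2 hG
  have hL' : (0 : ℝ) < L := Nat.cast_pos.2 hL
  -- sample size
  have hκn : 16 ≤ κ ^ 2 * n := by
    have : ε * κ ^ 2 * n ≤ 1 * κ ^ 2 * n := by gcongr
    linarith
  have hκ2 : κ ^ 2 ≤ 1 / 16 := by nlinarith
  have hεn : 256 ≤ ε * n := by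
    have : κ ^ 2 * (ε * n) ≤ 1 / 16 * (ε * n) := by gcongr
    nlinarith
  have hn1 : 1 ≤ n := by
    rcases Nat.eq_zero_or_pos n with rfl | h
    · norm_num at hκn
    · exact h
  have hκεn : 64 ≤ κ * (ε * n) := by
    have : κ * (κ * (ε * n)) ≤ 1 / 4 * (κ * (ε * n)) := by gcongr
    nlinarith
  set N : ℝ := (l : ℝ) - k with hNdef
  have hN4 : 4 ≤ N := by linarith
  have hNκ : 1 ≤ κ ^ 2 * N := by
    have : κ ^ 2 * (ε * n) ≤ κ ^ 2 * (2 * N) := by gcongr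
    nlinarith
  have hNn : N ≤ n := by
    have h1 : (l : ℝ) ≤ n := Nat.cast_le.2 hl
    have h2 : (0 : ℝ) ≤ k := Nat.cast_nonneg k
    linarith
  have hkl1 : k + 1 ≤ l := by
    have : (k : ℝ) + 1 ≤ l := by linarith
    exact_mod_cast this
  have hlen : (l : ℝ) - (k + 1 : ℕ) + 1 = N := by push_cast; ring
  have hcard : ((Finset.Icc (k + 1) l).card : ℝ) = N := by rw [card_Icc_cast hkl1, hlen]
  -- number of slabs
  set M := slabNumber B n with hMdef
  have hM : 0 < M := by rw [hMdef, slabNumber]; positivity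
  have hM' : (0 : ℝ) < M := Nat.cast_pos.2 hM
  have hBM : (B : ℝ) * √n ≤ M := le_slabNumber B n
  have hMB : (M : ℝ) ≤ 2 * B * √n := slabNumber_le B hn1
  have hκsn : 1 ≤ κ * √n := by
    have : 1 ≤ (κ * √n) ^ 2 := by rw [mul_pow, Real.sq_sqrt hn0]; linarith
    nlinarith [mul_nonneg hκ0.le (Real.sqrt_nonneg (n : ℝ))]
  have hMκ : 1 / (M : ℝ) ≤ κ := by
    rw [div_le_iff₀ hM']
    refine hκsn.trans (mul_le_mul_of_nonneg_left (le_trans ?_ hBM) hκ0.le)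
    exact le_mul_of_one_le_left (Real.sqrt_nonneg _) hB'
  -- bandwidth
  have hbw : bandwidth (k + 1) l = (√N)⁻¹ := bandwidth_eq hlen hN4
  set h := bandwidth (k + 1) l with hh
  have hsN : 0 < √N := Real.sqrt_pos.2 (by linarith)
  have hh0 : 0 < h := by rw [hbw]; positivity
  have hhκ : h ≤ κ := by
    rw [hbw, inv_le_comm₀ hsN hκ0]
    refine Real.le_sqrt_of_sq_le ?_
    rw [inv_pow, inv_le_iff_one_le_mul₀ (by positivity)]
    linarith
  have hMh : 1 ≤ τ * (M * h) := by
    have h1 : √N ≤ √n := Real.sqrt_le_sqrt hNn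
    have h2 : (B : ℝ) ≤ M * h := by
      rw [hbw, ← div_eq_mul_inv, le_div_iff₀ hsN]
      refine le_trans ?_ hBM
      gcongr
    exact hBτ.trans (by gcongr)
  have huj0 : 0 < u j := hδ.trans_le huj.1
  have huj1 : u j < 1 := by linarith [huj.2]
  have hDu : D u ∈ Icc (0 : ℝ) 1 := copula_deriv_mem_Icc (hX 0) hF hFc hC (hD u hu huj0 huj1)
  -- slab counts
  have hcount : ∀ v, ∀ c ∈ gridPoints d G, ∀ m ≤ M,
      |(((Finset.Icc (k + 1) l).filter fun i : ℕ => X i ω ∈ slabSet F M v c m).card : ℝ)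
        - N * P.real (X 0 ⁻¹' slabSet F M v c m)| ≤ κ * (N / M) := by
    intro v c hc m hm
    refine abs_card_slab_sub_le hL hM hω hc hm (prob_slabSet_le (hX 0) hF hFc hM v c hm) hkl hl ?_
    have h1 : η * √n * M ≤ κ * (ε * n) / 8 := by
      calc η * √n * M ≤ η * √n * (2 * B * √n) := by gcongr
        _ = η * (16 * B) / 8 * (√n * √n) := by ring
        _ = κ * (ε * n) / 8 := by rw [hη, Real.mul_self_sqrt hn0]; ring
    have h2 : (n : ℝ) / L ≤ κ * (ε * n) / 16 := by
      rw [div_le_iff₀ hL']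
      have : 16 * (n : ℝ) ≤ κ * ε * L * n := by gcongr
      linarith
    have h3 : κ * (ε * n) ≤ κ * (2 * N) := by gcongr
    linarith
  obtain ⟨c₁, hc₁, hc₁'⟩ := exists_one_le_mem_gridPoints (d := d) hG
  obtain ⟨cp, hcp, cm, hcm, hbr⟩ := exists_gridPoints_brackets hG hu
  have hrG : 1 / (M : ℝ) + 2 * κ ≤ 1 / G := by
    have : 1 / (3 * (G : ℝ)) = 1 / G / 3 := by field_simp
    linarith
  have hFmono : ∀ v, Monotone (F v) := fun v => monotone_of_eq_prob (hF v)
  have hF0 : ∀ v t, 0 ≤ F v t := fun v t => by rw [hF]; exact measureReal_nonneg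
  have hF1 : ∀ v t, F v t ≤ 1 := fun v t => by rw [hF]; exact measureReal_le_one
  have key := abs_card_box_sub_le j (I := Finset.Icc (k + 1) l) (Finset.nonempty_Icc.2 hkl1) hM
    hFmono hF0 hF1 (fun i => X i ω) (κ := κ) (τ := τ) (h := h) (ρ := 4 * κ) (D := D u) (u := u)
    (cp := cp) (cm := cm) hκτ hτ hh0 hMh hDu.1 hDu.2 (by linarith) (by linarith [huj.1])
    (by linarith [huj.2]) (fun v => by linarith [(hbr v).1.1]) (fun v => by linarith [(hbr v).2.2])
    (fun v m hm => by
      have h1 := hcount v c₁ hc₁ m hm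
      rw [prob_slabSet_of_one_le (hX 0) hF hFc hM v hc₁' hm] at h1
      rw [hcard]
      convert h1 using 3
      · congr 2
        refine Finset.filter_congr fun i _ => ?_
        simp only [slabSet, mem_ofPred_eq]
        exact ⟨fun h => ⟨h, fun v _ => (hF1 _ _).trans (hc₁' v)⟩, fun h => h.1⟩
      · split_ifs <;> ring)
    (fun c hc m hm hm0 hloc => by
      have hcG : c ∈ gridPoints d G := by rcases hc with rfl | rfl <;> assumption
      have hcu : ∀ v, |c v - u v| ≤ 2 / G := fun v => by
        have h1 : 0 < 1 / (G : ℝ) := by positivity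
        have h2 := hbr v
        rw [abs_le]
        rcases hc with rfl | rfl <;> constructor <;> linarith [h2.1.1, h2.1.2, h2.2.1, h2.2.2]
      have h1 := hcount j c hcG m hm
      obtain ⟨m, rfl⟩ := Nat.exists_eq_succ_of_ne_zero hm0.ne'
      have hloc' := abs_le.1 hloc
      have hstep : ((m.succ : ℕ) : ℝ) / M = m / M + 1 / M := by push_cast; ring
      have hm0 : 0 < m := by
        have : 0 < (m : ℝ) / M := by linarith [huj.1]
        have h3 : (0 : ℝ) < m := by
          by_contra hneg
          have : (m : ℝ) / M ≤ 0 := div_nonpos_of_nonpos_of_nonneg (not_lt.1 hneg) hM'.le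
          linarith
        exact_mod_cast h3
      have hmM : m + 1 < M := by
        have : ((m.succ : ℕ) : ℝ) / M < 1 := by linarith [huj.2]
        rw [div_lt_one hM'] at this
        exact_mod_cast this
      obtain ⟨ζ, hζ, hpζ⟩ := exists_prob_slabSet_eq (hX 0) hF hFc hC hD hM c hm0 hmM
      have hζ1 : (m : ℝ) / M < ζ := hζ.1
      have hζ2 : ζ < ((m.succ : ℕ) : ℝ) / M := hζ.2
      have hζδ : ζ ∈ Icc (δ / 2) (1 - δ / 2) :=
        ⟨by linarith [huj.1], by linarith [huj.2]⟩
      set w := Function.update (fun v => max 0 (min (c v) 1)) j ζ with hw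
      have hDw : |D w - D u| ≤ τ := by
        refine hmod w u (fun v => ?_) hu ?_ ⟨by linarith [huj.1], by linarith [huj.2]⟩ fun v => ?_
        · by_cases hv : v = j
          · subst hv
            simp only [hw, Function.update_self]
            exact ⟨by linarith [hζδ.1], by linarith [hζδ.2]⟩
          · simp [hw, hv]
        · simpa [hw] using hζδ
        · by_cases hv : v = j
          · subst hv
            simp only [hw, Function.update_self]
            rw [abs_lt]
            constructor <;> linarith
          · simp only [hw, Function.update_of_ne hv]
            exact ((abs_clamp_sub_le (hu v)).trans (hcu v)).trans_lt hGr
      have hNM : 0 < N / M := by positivity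
      rw [hcard]
      rw [Nat.succ_eq_add_one, hpζ] at h1
      have h2 : |N / M * (D w - D u)| ≤ N / M * τ := by
        rw [abs_mul, abs_of_pos hNM]; gcongr
      have h3 : κ * (N / M) ≤ τ * (N / M) := by gcongr
      set q : ℝ :=
        (((Finset.Icc (k + 1) l).filter fun i : ℕ => X i ω ∈ slabSet F M j c (m + 1)).card : ℝ)
      have h4 : |q - N / M * D u| ≤ 2 * τ * (N / M) := by
        have e : q - N / M * D u = (q - N * (1 / M * D w)) + N / M * (D w - D u) := by ring
        rw [e]
        refine (abs_add_le _ _).trans ?_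
        linarith
      convert h4 using 4
      exact congrArg Finset.card (Finset.filter_congr fun i _ => Iff.rfl))
  rw [pdEst_eq X j hkl1 (by linarith [huj.1]) (by linarith [huj.2]) hh0.le, ← hh]
  have hpos : 0 < 2 * h * ((Finset.Icc (k + 1) l).card : ℝ) := by rw [hcard]; positivity

  have key2 := div_le_div_of_nonneg_right key hpos.le
  rw [mul_div_cancel_right₀ _ hpos.ne', ← abs_of_pos hpos, ← abs_div, abs_of_pos hpos, sub_div,
    mul_div_cancel_left₀ _ hpos.ne'] at key2
  convert key2 using 4

/-- for a strictly stationary, strongly mixing sequence with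
`α_r = O(r^{-a})`, `a > 1`, continuous margins, and a copula satisfying Condition 2,
the finite-difference estimator of `Ċ_j` based on the subsample `X_{⌊ns⌋+1}, …, X_{⌊nt⌋}`
converges to `Ċ_j` uniformly over `δ ≤ u_j ≤ 1−δ` and `t − s ≥ ε`, in outer
probability. -/
theorem pdEst_uniform_consistency {Ω : Type*} [MeasurableSpace Ω]
    (P : Measure Ω) [IsProbabilityMeasure P]
    (d : ℕ) (hd : 1 ≤ d)
    (X : ℤ → Ω → Fin d → ℝ) (hX : ∀ i, Measurable (X i))
    -- strict stationarity
    (hstat : ∀ k : ℤ,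
      Measure.map (fun ω => fun i : ℤ => X (i + k) ω) P
        = Measure.map (fun ω => fun i : ℤ => X i ω) P)
    -- marginal c.d.f.s, assumed continuous
    (F : Fin d → ℝ → ℝ)
    (hF : ∀ j x, F j x = (P {ω | X 0 ω j ≤ x}).toReal)
    (hFcont : ∀ j, Continuous (F j))
    -- strong mixing coefficients α_r = O(r^{-a}) for some a > 1
    (a : ℝ) (ha : 1 < a)
    (hmix : ∃ K : ℝ, ∀ r : ℕ, 1 ≤ r → ∀ p : ℤ, ∀ A B : Set Ω,
      MeasurableSet[⨆ i : {i : ℤ // i ≤ p},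
        MeasurableSpace.comap (X i.1) (inferInstance : MeasurableSpace (Fin d → ℝ))] A →
      MeasurableSet[⨆ i : {i : ℤ // p + r ≤ i},
        MeasurableSpace.comap (X i.1) (inferInstance : MeasurableSpace (Fin d → ℝ))] B →
      |(P (A ∩ B)).toReal - (P A).toReal * (P B).toReal| ≤ K * (r : ℝ) ^ (-a))
    -- the copula of X_0
    (C : (Fin d → ℝ) → ℝ)
    (hC : ∀ u : Fin d → ℝ, C u = (P {ω | ∀ j, F j (X 0 ω j) ≤ u j}).toReal)
    -- Condition 2, with Ċ_j extended by 0 to the boundary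
    (Cdot : Fin d → (Fin d → ℝ) → ℝ)
    (hCdot_deriv : ∀ (j : Fin d) (u : Fin d → ℝ), (∀ k, u k ∈ Icc (0:ℝ) 1) →
      0 < u j → u j < 1 →
      HasDerivAt (fun t => C (Function.update u j t)) (Cdot j u) (u j))
    (hCdot_cont : ∀ j : Fin d, ContinuousOn (Cdot j)
      {u : Fin d → ℝ | (∀ k, u k ∈ Icc (0:ℝ) 1) ∧ 0 < u j ∧ u j < 1})
    (hCdot_zero : ∀ (j : Fin d) (u : Fin d → ℝ), (∀ k, u k ∈ Icc (0:ℝ) 1) →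
      u j = 0 ∨ u j = 1 → Cdot j u = 0)
    (j : Fin d) :
    ∀ δ : ℝ, 0 < δ → δ < 1/2 → ∀ ε : ℝ, 0 < ε → ε < 1 →
      ∀ ε' : ℝ, 0 < ε' →
        Tendsto (fun n : ℕ =>
            P {ω | ε' < ⨆ q : {q : ℝ × ℝ × (Fin d → ℝ) //
                  q.1 ∈ Icc (0:ℝ) 1 ∧ q.2.1 ∈ Icc (0:ℝ) 1 ∧ q.1 ≤ q.2.1 ∧
                    ε ≤ q.2.1 - q.1 ∧ (∀ k, q.2.2 k ∈ Icc (0:ℝ) 1) ∧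
                    δ ≤ q.2.2 j ∧ q.2.2 j ≤ 1 - δ},
                |pdEst d X j (⌊(n : ℝ) * q.1.1⌋₊ + 1) ⌊(n : ℝ) * q.1.2.1⌋₊ q.1.2.2 ω
                  - Cdot j q.1.2.2|})
          atTop (nhds 0) := by
  intro δ hδ0 _ ε hε0 hε1 ε' hε'
  have hF' : ∀ v x, F v x = P.real {ω | X 0 ω v ≤ x} := hF
  have hC' : ∀ u, C u = P.real {ω | ∀ k, F k (X 0 ω k) ≤ u k} := hC
  set τ : ℝ := min (ε' / 8) (1 / 4) with hτdef
  have hτ0 : 0 < τ := by positivity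
  obtain ⟨r, hr, hmod⟩ := exists_partial_modulus (hCdot_cont j) (half_pos hδ0) hτ0
  obtain ⟨G, hG⟩ := exists_nat_gt (2 / r)
  have hG' : (0 : ℝ) < G := lt_trans (by positivity) hG
  obtain ⟨κ, hκ0, hκ⟩ : ∃ κ : ℝ, 0 < κ ∧ κ ≤ min (min τ (r / 16)) (min (δ / 16) (1 / (3 * G))) :=
    ⟨_, by positivity, le_rfl⟩
  simp only [le_min_iff] at hκ
  obtain ⟨⟨hκτ, hκr⟩, hκδ, hκG⟩ := hκ
  obtain ⟨B, hB⟩ := exists_nat_gt (1 / τ)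
  have hB' : (0 : ℝ) < B := lt_trans (by positivity) hB
  obtain ⟨L, hL⟩ := exists_nat_gt (16 / (κ * ε))
  have hL' : (0 : ℝ) < L := lt_trans (by positivity) hL
  have hB0 : 0 < B := Nat.cast_pos.1 hB'
  have hL0 : 0 < L := Nat.cast_pos.1 hL'
  have hη0 : 0 < κ * ε / (16 * B) := by positivity
  refine tendsto_of_tendsto_of_tendsto_of_le_of_le' tendsto_const_nhds
    (tendsto_badEvent hX hstat hF' hFcont ha hmix (gridPoints d G) hL0 (tendsto_slabNumber hB0) hη0)
    (Eventually.of_forall fun _ => zero_le) ?_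
  filter_upwards [(tendsto_natCast_atTop_atTop (R := ℝ)).eventually_ge_atTop (16 / (ε * κ ^ 2)),
    (tendsto_natCast_atTop_atTop (R := ℝ)).eventually_ge_atTop (2 / ε)] with n hn hnε
  refine measure_mono fun ω hω => ?_
  by_contra hbad
  refine not_le.2 hω (Real.iSup_le (fun ⟨⟨s, t, u⟩, hs, ht, hst, hε, hu, huj0, huj1⟩ => ?_) hε'.le)
  rw [div_le_iff₀ (by positivity)] at hn hnε
  rw [div_lt_iff₀ (by positivity)] at hG hB hL
  have hn0 : (0 : ℝ) ≤ n := Nat.cast_nonneg n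
  have hl : ⌊(n : ℝ) * t⌋₊ ≤ n :=
    (Nat.floor_mono (mul_le_of_le_one_right hn0 ht.2)).trans_eq (Nat.floor_natCast n)
  have h1 : (⌊(n : ℝ) * s⌋₊ : ℝ) ≤ n * s := Nat.floor_le (mul_nonneg hn0 hs.1)
  have h2 : (n : ℝ) * t < ⌊(n : ℝ) * t⌋₊ + 1 := Nat.lt_floor_add_one _
  have h3 : (n : ℝ) * ε ≤ n * (t - s) := by gcongr
  refine (abs_pdEst_sub_le hX hF' hFcont hC' (hCdot_deriv j) hδ0 hτ0 (min_le_right _ _) hmod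
    (Nat.cast_pos.1 hG') ?_ hκ0 hκτ (by linarith) (by linarith) hκG hB0 (by linarith) hL0
    (by linarith) (div_mul_cancel₀ _ (by positivity)) hη0.le hε0 hε1 (by linarith) hbad
    (Nat.floor_mono (by gcongr)) hl (by linarith) hu ⟨huj0, huj1⟩).trans ?_
  · rw [div_lt_iff₀ hG']
    linarith
  · linarith [min_le_left (ε' / 8) (1 / 4)]
end
end
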